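/- Call $\ell:(0,\infty)\to(0,\infty)$ slowly varying if it is measurable, bounded above and below by positive constants on each compact subset of $(0,\infty)$, and $\lim_{x\to\infty}\ell(\lambda x)/\ell(x)=1$ for every $\lambda>0$. Let $(Y,\mu)$ be a probability space, $F:Y\to Y$ a measure-preserving map, and $\varphi:Y\to\{1,2,3,\dots\}$ a measurable function with $\mu(\varphi>n)=\ell(n)n^{-\beta}$ for all $n\ge1$, where $\ell$ is slowly varying and $\beta\in(0,\tfrac12]$. Let $R:L^1(Y,\mu)\to L^1(Y,\mu)$ be the transfer operator of $F$, characterized by $\int_Y (Rv)\,w\,d\mu=\int_Y v\,(w\circ F)\,d\mu$ for all $v\in L^1(Y,\mu)$ and $w\in L^\infty(Y,\mu)$, and put $R_nv=R(1_{\{\varphi=n\}}v)$ for $n\ge1$. Let $\mathcal B$ be a complex Banach space which is a linear subspace of $L^\infty(Y,\mu)$ (functions that agree $\mu$-almost everywhere being identified), contains the constant functions, and satisfies $\|v\|_{L^\infty}\le\|v\|_{\mathcal B}$ for $v\in\mathcal B$. Assume: (H1) each $R_n$ maps $\mathcal B$ boundedly into $\mathcal B$, and there is a constant $C>0$ with $\|R_n\|_{\mathcal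 B}\le C\mu(\varphi=n)$ for all $n\ge1$; hence $R(z)=\sum_{n\ge1}z^nR_n$ is a bounded operator on $\mathcal B$ for $|z|\le1$, and $R(1)=R$ on $\mathcal B$. (H2) (i) $1$ is a simple isolated eigenvalue of $R(1)$ on $\mathcal B$, i.e. $1$ is an isolated point of the spectrum whose spectral (Riesz) projection has rank one; equivalently, $1$ is an isolated point of the spectrum, $\ker(R(1)-I)$ is one-dimensional, and $\mathcal B=\ker(R(1)-I)\oplus\operatorname{ran}(R(1)-I)$. (ii) For every $z\in\mathbb C$ with $|z|\le1$ and $z\ne1$, $1$ does not belong to the spectrum of $R(z)$ on $\mathcal B$. Define operators $T_n:\mathcal B\to\mathcal B$ by $T_0=I$ and $T_n=\sum_{j=1}^nT_{n-j}R_j$ for $n\ge1$. Then for every $v\in\mathcal B$ with $v\ge0$, for $\mu$-almost every $y\in Y$ all the values $(T_nv)(y)$ are real and $$\liminf_{n\to\infty}\ell(n)\,n^{1-\beta}\,(T_nv)(y)=\frac{\sin(\beta\pi)}{\pi}\int_Y v\,d\mu .$$ -/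

import Mathlib

open MeasureTheory Filter Topology

/-- A function `l : (0,∞) → (0,∞)` (given as a function on `ℝ` whose values outside `(0,∞)` are
irrelevant) is slowly varying: it is measurable on `(0,∞)`, bounded above and below by positive
constants on each compact subset of `(0,∞)`, and `l (a x) / l x → 1` as `x → ∞` for all `a > 0`. -/
def SlowlyVarying (l : ℝ → ℝ) : Prop :=
  Measurable (fun x : Set.Ioi (0 : ℝ) => l x) ∧
  (∀ K : Set ℝ, IsCompact K → K ⊆ Set.Ioi 0 →
    ∃ c C : ℝ, 0 < c ∧ ∀ x ∈ K, c ≤ l x ∧ l x ≤ C) ∧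
  ∀ a : ℝ, 0 < a → Tendsto (fun x => l (a * x) / l x) atTop (𝓝 1)

/-- `g` is (a version of) the image `R v` of `v ∈ L¹(μ)` under the transfer operator `R` of `F`:
`g` is integrable and `∫ g w dμ = ∫ v (w ∘ F) dμ` for all bounded measurable `w`.
This determines `g` up to `μ`-null sets. -/
def IsTransferOf {Y : Type*} [MeasurableSpace Y] (μ : Measure Y) (F : Y → Y)
    (v g : Y → ℂ) : Prop :=
  Integrable g μ ∧
  ∀ w : Y → ℂ, Measurable w → (∃ M : ℝ, ∀ y, ‖w y‖ ≤ M) →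
    ∫ y, g y * w y ∂μ = ∫ y, v y * w (F y) ∂μ

/-- `a` is a simple isolated eigenvalue of the bounded operator `A`: it is an isolated point of the
spectrum and has algebraic multiplicity one, that is, `ker (A - a)` is one-dimensional and the
whole space is the direct sum of `ker (A - a)` and `range (A - a)`.  On a Banach space this says
that the spectral (Riesz) projection of `A` at the isolated point `a` has rank one. -/
def IsSimpleIsolatedEigenvalue {B : Type*} [NormedAddCommGroup B] [NormedSpace ℂ B]
    (A : B →L[ℂ] B) (a : ℂ) : Prop :=
  (∃ U ∈ 𝓝 a, spectrum ℂ A ∩ U = {a}) ∧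
  Module.finrank ℂ (LinearMap.ker ((A : B →ₗ[ℂ] B) - a • LinearMap.id)) = 1 ∧
  IsCompl (LinearMap.ker ((A : B →ₗ[ℂ] B) - a • LinearMap.id))
    (LinearMap.range ((A : B →ₗ[ℂ] B) - a • LinearMap.id))

/-- The power series `R(z) = ∑_{n ≥ 1} zⁿ Rₙ`. -/
noncomputable def renewalSeries {B : Type*} [NormedAddCommGroup B] [NormedSpace ℂ B]
    (Rn : ℕ → B →L[ℂ] B) (z : ℂ) : B →L[ℂ] B :=
  ∑' n : ℕ, z ^ (n + 1) • Rn (n + 1)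

/-- The renewal operators `T₀ = I`, `Tₙ = ∑_{j=1}^{n} T_{n-j} R_j` for `n ≥ 1`
(in the sum below, the index `j : Fin (n + 1)` stands for `j + 1`). -/
noncomputable def renewalOp {B : Type*} [NormedAddCommGroup B] [NormedSpace ℂ B]
    (Rn : ℕ → B →L[ℂ] B) : ℕ → B →L[ℂ] B
  | 0 => ContinuousLinearMap.id ℂ B
  | n + 1 => ∑ j : Fin (n + 1), (renewalOp Rn (n - j)).comp (Rn (j + 1))
  decreasing_by omega

/-- An antitone function with values in `(0, 1]` that is regularly varying of index `-β` along
integers. -/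
structure RegularTail (p : ℝ → ℝ) (β : ℝ) : Prop where
  anti : Antitone p
  pos : ∀ x, 0 < p x
  le_one : ∀ x, p x ≤ 1
  nat_ratio : ∀ a : ℕ, 1 ≤ a →
    Tendsto (fun j : ℕ => p (a * j) / p j) atTop (𝓝 ((a : ℝ) ^ (-β)))

namespace RegularTail

variable {p : ℝ → ℝ} {β : ℝ}

lemma nat_ratio_div (hp : RegularTail p β) {a b : ℕ} (ha : 1 ≤ a) (hb : 1 ≤ b) :
    Tendsto (fun j : ℕ => p (a * j) / p (b * j)) atTop (𝓝 (((a : ℝ) / b) ^ (-β))) := by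
  have h1 := (hp.nat_ratio a ha).div (hp.nat_ratio b hb)
    (Real.rpow_pos_of_pos (by exact_mod_cast hb) _).ne'
  rw [Real.div_rpow (by positivity) (by positivity)]
  refine h1.congr fun j => ?_
  have := (hp.pos j).ne'
  have := (hp.pos (b * j)).ne'
  simp only [Pi.div_apply]
  field_simp

/-- Regular variation along integers and monotonicity give regular variation along the reals. -/
lemma ratio (hp : RegularTail p β) {c : ℝ} (hc : 0 < c) :
    Tendsto (fun x => p (c * x) / p x) atTop (𝓝 (c ^ (-β))) := by
  have hlo : Tendsto (fun A : ℕ => ((⌈c * ((A : ℝ) + 1)⌉₊ : ℝ) / (A : ℝ)) ^ (-β)) atTop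
      (𝓝 (c ^ (-β))) := by
    have h1 : Tendsto (fun A : ℕ => (⌈c * ((A : ℝ) + 1)⌉₊ : ℝ) / ((A : ℝ) + 1)) atTop (𝓝 c) :=
      (tendsto_nat_ceil_mul_div_atTop hc.le).comp
        (tendsto_atTop_add_const_right _ 1 tendsto_natCast_atTop_atTop)
    have h2 : Tendsto (fun A : ℕ => ((A : ℝ) + 1) / (A : ℝ)) atTop (𝓝 1) := by
      have := (tendsto_natCast_div_add_atTop (1 : ℝ)).inv₀ one_ne_zero
      simpa using this
    have h3 := h1.mul h2
    rw [mul_one] at h3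
    refine (h3.congr fun A => ?_).rpow_const (Or.inl hc.ne')
    have : (A : ℝ) + 1 ≠ 0 := by positivity
    field_simp
  have hhi : Tendsto (fun A : ℕ => ((⌊c * (A : ℝ)⌋₊ : ℝ) / ((A + 1 : ℕ) : ℝ)) ^ (-β)) atTop
      (𝓝 (c ^ (-β))) := by
    have h1 : Tendsto (fun A : ℕ => (⌊c * (A : ℝ)⌋₊ : ℝ) / (A : ℝ)) atTop (𝓝 c) :=
      (tendsto_nat_floor_mul_div_atTop hc.le).comp tendsto_natCast_atTop_atTop
    have h3 := h1.mul (tendsto_natCast_div_add_atTop (1 : ℝ))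
    rw [mul_one] at h3
    refine (h3.congr' ?_).rpow_const (Or.inl hc.ne')
    filter_upwards [eventually_gt_atTop 0] with A hA
    have : (A : ℝ) ≠ 0 := by positivity
    push_cast
    field_simp
  have key : ∀ A : ℕ, 1 ≤ A → ∀ᶠ x : ℝ in atTop,
      (A : ℝ) * ⌊x / A⌋₊ ≤ x ∧ x ≤ ((A + 1 : ℕ) : ℝ) * ⌊x / A⌋₊ := by
    intro A hA
    have hA' : (0 : ℝ) < A := by exact_mod_cast hA
    have : Tendsto (fun x : ℝ => ⌊x / A⌋₊) atTop atTop :=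
      tendsto_nat_floor_atTop.comp (tendsto_id.atTop_div_const hA')
    filter_upwards [this.eventually_ge_atTop A, eventually_ge_atTop 0] with x hx hx0
    constructor
    · have := Nat.floor_le (div_nonneg hx0 hA'.le)
      rw [le_div_iff₀ hA'] at this
      linarith
    · have := Nat.lt_floor_add_one (x / A)
      rw [div_lt_iff₀ hA'] at this
      have h2 : (A : ℝ) ≤ ⌊x / A⌋₊ := by exact_mod_cast hx
      push_cast
      nlinarith
  have hfl : ∀ A : ℕ, 1 ≤ A → Tendsto (fun x : ℝ => ⌊x / A⌋₊) atTop atTop := fun A hA =>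
    tendsto_nat_floor_atTop.comp (tendsto_id.atTop_div_const (by exact_mod_cast hA))
  rw [tendsto_order]
  constructor
  · intro d hd
    obtain ⟨A, hA1, hA⟩ := ((eventually_ge_atTop 1).and (hlo.eventually (lt_mem_nhds hd))).exists
    have hb : 1 ≤ ⌈c * ((A : ℝ) + 1)⌉₊ := Nat.one_le_ceil_iff.2 (by positivity)
    have h1 := ((hp.nat_ratio_div hb hA1).comp (hfl A hA1)).eventually (lt_mem_nhds hA)
    filter_upwards [h1, key A hA1] with x hx hk
    refine hx.trans_le ?_
    have h2 : c * x ≤ (⌈c * ((A : ℝ) + 1)⌉₊ : ℝ) * ⌊x / A⌋₊ := by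
      have := Nat.le_ceil (c * ((A : ℝ) + 1))
      have h3 := hk.2
      push_cast at h3
      calc c * x ≤ c * (((A : ℝ) + 1) * ⌊x / A⌋₊) := by gcongr
        _ = c * ((A : ℝ) + 1) * ⌊x / A⌋₊ := by ring
        _ ≤ _ := by gcongr
    exact div_le_div₀ (hp.pos _).le (hp.anti h2) (hp.pos _) (hp.anti hk.1)
  · intro d hd
    have hcA : Tendsto (fun A : ℕ => c * (A : ℝ)) atTop atTop :=
      tendsto_natCast_atTop_atTop.const_mul_atTop hc
    obtain ⟨A, ⟨hA1, hA2⟩, hA⟩ := (((eventually_ge_atTop 1).and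
      (hcA.eventually_ge_atTop 1)).and (hhi.eventually (gt_mem_nhds hd))).exists
    have hb : 1 ≤ ⌊c * (A : ℝ)⌋₊ := Nat.one_le_floor_iff _ |>.2 hA2
    have h1 := ((hp.nat_ratio_div hb (Nat.le_add_left 1 A)).comp (hfl A hA1)).eventually
      (gt_mem_nhds hA)
    filter_upwards [h1, key A hA1] with x hx hk
    refine lt_of_le_of_lt ?_ hx
    have h2 : (⌊c * (A : ℝ)⌋₊ : ℝ) * ⌊x / A⌋₊ ≤ c * x := by
      have := Nat.floor_le (show 0 ≤ c * (A : ℝ) by positivity)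
      calc (⌊c * (A : ℝ)⌋₊ : ℝ) * ⌊x / A⌋₊ ≤ c * (A : ℝ) * ⌊x / A⌋₊ := by gcongr
        _ = c * ((A : ℝ) * ⌊x / A⌋₊) := by ring
        _ ≤ _ := by gcongr; exact hk.1
    exact div_le_div₀ (hp.pos _).le (hp.anti h2) (hp.pos _) (hp.anti hk.2)

/-- Upper Potter bound. -/
lemma potter_upper (hp : RegularTail p β) {α : ℝ} (hα0 : 0 ≤ α) (hα : α < β) :
    ∃ C : ℝ, 0 < C ∧ ∀ x y : ℝ, 1 / 4 ≤ x → x ≤ y → p y ≤ C * (x / y) ^ α * p x := by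
  have h2 : ∀ᶠ x in atTop, p (2 * x) / p x < (2 : ℝ) ^ (-α) :=
    (hp.ratio two_pos).eventually (gt_mem_nhds
      (Real.rpow_lt_rpow_of_exponent_lt one_lt_two (by linarith)))
  obtain ⟨X, hX1, hX⟩ := ((eventually_ge_atTop (1 : ℝ)).and (eventually_forall_ge_atTop.2 h2)).exists
  have hit : ∀ k : ℕ, ∀ x, X ≤ x → p (2 ^ k * x) ≤ ((2 : ℝ) ^ k) ^ (-α) * p x := by
    intro k
    induction k with
    | zero => intro x _; simp
    | succ k ih =>
      intro x hx
      have h3 := hX (2 ^ k * x) (hx.trans (le_mul_of_one_le_left (by linarith)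
        (one_le_pow₀ one_le_two)))
      rw [div_lt_iff₀ (hp.pos _)] at h3
      rw [pow_succ', mul_assoc, Real.mul_rpow (by norm_num) (by positivity), mul_assoc]
      exact h3.le.trans (by gcongr; exact ih x hx)
  have hmain : ∀ x y : ℝ, X ≤ x → x ≤ y → p y ≤ 2 ^ α * (x / y) ^ α * p x := by
    intro x y hx hxy
    have hx0 : 0 < x := by linarith
    have hy0 : 0 < y := by linarith
    obtain ⟨k, hk1, hk2⟩ := exists_nat_pow_near ((one_le_div hx0).2 hxy) one_lt_two
    rw [le_div_iff₀ hx0] at hk1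
    refine (hp.anti hk1).trans ((hit k x hx).trans ?_)
    have : ((2 : ℝ) ^ k) ^ (-α) ≤ 2 ^ α * (x / y) ^ α := by
      rw [← Real.mul_rpow (by norm_num) (by positivity), Real.rpow_neg (by positivity),
        ← Real.inv_rpow (by positivity)]
      refine Real.rpow_le_rpow (by positivity) ?_ hα0
      rw [div_lt_iff₀ hx0, pow_succ] at hk2
      rw [inv_le_iff_one_le_mul₀ (by positivity), mul_comm, ← mul_assoc, ← mul_div_assoc,
        le_div_iff₀ hy0]
      linarith
    exact mul_le_mul_of_nonneg_right this (hp.pos _).le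
  refine ⟨2 ^ α * (4 * X) ^ α, by positivity, fun x y hx hxy => ?_⟩
  have hx0 : 0 < x := by linarith
  have hy0 : 0 < y := by linarith
  have h2α : (1 : ℝ) ≤ 2 ^ α := Real.one_le_rpow one_le_two hα0
  have h4α : (1 : ℝ) ≤ (4 * X) ^ α := Real.one_le_rpow (by linarith) hα0
  rcases le_or_gt X x with hXx | hXx
  · refine (hmain x y hXx hxy).trans ?_
    have := hp.pos x
    gcongr
    exact le_mul_of_one_le_right (by positivity) h4α
  · rcases le_or_gt X y with hXy | hXy
    · refine (hmain X y le_rfl hXy).trans ?_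
      have h5 : (X / y) ^ α ≤ (4 * X) ^ α * (x / y) ^ α := by
        rw [← Real.mul_rpow (by positivity) (by positivity)]
        refine Real.rpow_le_rpow (by positivity) ?_ hα0
        rw [← mul_div_assoc]
        gcongr
        nlinarith
      rw [mul_assoc (2 ^ α) ((4 * X) ^ α)]
      have := hp.anti hXx.le
      have := hp.pos X
      gcongr
    · have h5 : 1 ≤ (4 * X) ^ α * (x / y) ^ α := by
        rw [← Real.mul_rpow (by positivity) (by positivity)]
        refine Real.one_le_rpow ?_ hα0
        rw [← mul_div_assoc, le_div_iff₀ hy0]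
        nlinarith
      have h6 : 1 ≤ 2 ^ α * (4 * X) ^ α * (x / y) ^ α := by
        rw [mul_assoc]; exact one_le_mul_of_one_le_of_one_le h2α h5
      exact (hp.anti hxy).trans (le_mul_of_one_le_left (hp.pos _).le h6)

/-- Lower Potter bound. -/
lemma potter_lower (hp : RegularTail p β) {γ : ℝ} (hγ0 : 0 ≤ γ) (hγ : β < γ) :
    ∃ C : ℝ, 0 < C ∧ ∀ x y : ℝ, 0 < x → x ≤ y → p x ≤ C * (y / x) ^ γ * p y := by
  have h2 : ∀ᶠ x in atTop, (2 : ℝ) ^ (-γ) < p (2 * x) / p x :=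
    (hp.ratio two_pos).eventually (lt_mem_nhds
      (Real.rpow_lt_rpow_of_exponent_lt one_lt_two (by linarith)))
  obtain ⟨X, hX1, hX⟩ := ((eventually_ge_atTop (1 : ℝ)).and (eventually_forall_ge_atTop.2 h2)).exists
  have hit : ∀ k : ℕ, ∀ x, X ≤ x → p x ≤ ((2 : ℝ) ^ k) ^ γ * p (2 ^ k * x) := by
    intro k
    induction k with
    | zero => intro x _; simp
    | succ k ih =>
      intro x hx
      have h3 := hX (2 ^ k * x) (hx.trans (le_mul_of_one_le_left (by linarith)
        (one_le_pow₀ one_le_two)))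
      rw [lt_div_iff₀ (hp.pos _), Real.rpow_neg (by norm_num), inv_mul_lt_iff₀ (by positivity)]
        at h3
      refine (ih x hx).trans ?_
      rw [pow_succ, Real.mul_rpow (by positivity) (by norm_num), mul_assoc (((2 : ℝ) ^ k) ^ γ)]
      refine mul_le_mul_of_nonneg_left ?_ (by positivity)
      rw [mul_comm ((2 : ℝ) ^ k) 2, mul_assoc (2 : ℝ)]
      exact h3.le
  have hmain : ∀ x y : ℝ, X ≤ x → x ≤ y → p x ≤ 2 ^ γ * (y / x) ^ γ * p y := by
    intro x y hx hxy
    have hx0 : 0 < x := by linarith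
    obtain ⟨k, hk1, hk2⟩ := exists_nat_pow_near ((one_le_div hx0).2 hxy) one_lt_two
    refine (hit (k + 1) x hx).trans ?_
    rw [div_lt_iff₀ hx0] at hk2
    have hy0 : 0 < y := hx0.trans_le hxy
    refine mul_le_mul ?_ (hp.anti hk2.le) (hp.pos _).le (by positivity)
    rw [← Real.mul_rpow (by norm_num) (div_nonneg (hx0.le.trans hxy) hx0.le)]
    refine Real.rpow_le_rpow (by positivity) ?_ hγ0
    rw [pow_succ']
    gcongr
  have hpX := hp.pos X
  have h2γ : (1 : ℝ) ≤ 2 ^ γ := Real.one_le_rpow one_le_two hγ0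
  refine ⟨2 ^ γ / p X, by positivity, fun x y hx hxy => ?_⟩
  have hy0 : 0 < y := by linarith
  have hpy := hp.pos y
  have hfac : 1 ≤ (y / x) ^ γ := Real.one_le_rpow ((one_le_div hx).2 hxy) hγ0
  rcases le_or_gt X x with hXx | hXx
  · refine (hmain x y hXx hxy).trans ?_
    gcongr
    rw [le_div_iff₀ hpX]
    exact mul_le_of_le_one_right (by positivity) (hp.le_one X)
  · refine (hp.le_one x).trans ?_
    rw [div_mul_eq_mul_div, div_mul_eq_mul_div, one_le_div hpX]
    rcases le_or_gt X y with hXy | hXy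
    · refine (hmain X y le_rfl hXy).trans ?_
      gcongr
    · have := hp.anti hXy.le
      have : 1 ≤ 2 ^ γ * (y / x) ^ γ := one_le_mul_of_one_le_of_one_le h2γ hfac
      nlinarith

end RegularTail

/-- The Laplace transform of `t ^ (a - 1)` at a complex point of the right half-plane. -/
lemma integral_rpow_mul_cexp_neg_mul {a : ℝ} (ha : 0 < a) {r : ℂ} (hr : 0 < r.re) :
    ∫ t in Set.Ioi (0 : ℝ), ((t ^ (a - 1) : ℝ) : ℂ) * Complex.exp (-r * t) =
      (Real.Gamma a : ℂ) * r ^ (-(a : ℂ)) := by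
  have hreal : ∀ (s σ : ℝ), -1 < s → 0 < σ →
      IntegrableOn (fun t : ℝ => t ^ s * Real.exp (-σ * t)) (Set.Ioi 0) := fun s σ hs hσ => by
    simpa using integrableOn_rpow_mul_exp_neg_mul_rpow hs one_pos hσ
  have hmeas : ∀ (s : ℝ) (r : ℂ), AEStronglyMeasurable
      (fun t : ℝ => ((t ^ s : ℝ) : ℂ) * Complex.exp (-r * t)) (volume.restrict (Set.Ioi 0)) :=
    fun s r => by
      have : Measurable (fun t : ℝ => t ^ s) := by fun_prop
      exact ((Complex.measurable_ofReal.comp this).mul (by fun_prop)).aestronglyMeasurable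
  have hnorm : ∀ (s : ℝ) (r : ℂ) (t : ℝ), 0 < t →
      ‖((t ^ s : ℝ) : ℂ) * Complex.exp (-r * t)‖ = t ^ s * Real.exp (-r.re * t) := by
    intro s r t ht
    rw [norm_mul, Complex.norm_real, Real.norm_of_nonneg (by positivity), Complex.norm_exp]
    simp
  have hdiff : DifferentiableOn ℂ
      (fun r : ℂ => ∫ t in Set.Ioi (0 : ℝ), ((t ^ (a - 1) : ℝ) : ℂ) * Complex.exp (-r * t))
      {r | 0 < r.re} := by
    intro r₀ hr₀
    have hr₀' : 0 < r₀.re := hr₀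
    have hopen : {r : ℂ | r₀.re / 2 < r.re} ∈ 𝓝 r₀ :=
      (isOpen_lt continuous_const Complex.continuous_re).mem_nhds (by simp; linarith)
    refine (hasDerivAt_integral_of_dominated_loc_of_deriv_le
      (F' := fun r t => ((t ^ a : ℝ) : ℂ) * Complex.exp (-r * t) * (-1))
      (bound := fun t => t ^ a * Real.exp (-(r₀.re / 2) * t)) hopen
      (Eventually.of_forall fun r => hmeas _ r) ?_ ((hmeas a r₀).mul_const _) ?_
      (hreal a _ (by linarith) (by linarith)) ?_).2.differentiableAt.differentiableWithinAt
    · refine (hreal (a - 1) r₀.re (by linarith) hr₀).mono' (hmeas _ _) ?_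
      filter_upwards [ae_restrict_mem measurableSet_Ioi] with t ht
      exact (hnorm _ _ _ ht).le
    · filter_upwards [ae_restrict_mem measurableSet_Ioi] with t ht r hr
      have ht0 : 0 < t := ht
      have hr' : r₀.re / 2 < r.re := hr
      rw [norm_mul, hnorm _ _ _ ht]
      simp only [norm_neg, norm_one, mul_one]
      gcongr
    · filter_upwards [ae_restrict_mem measurableSet_Ioi] with t ht r hr
      have ht0 : 0 < t := ht
      have h1 : HasDerivAt (fun r : ℂ => Complex.exp (-r * t))
          (Complex.exp (-r * t) * (-1 * t)) r :=
        ((hasDerivAt_neg r).mul_const (t : ℂ)).cexp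
      refine (h1.const_mul (((t ^ (a - 1) : ℝ) : ℂ))).congr_deriv ?_
      have : t ^ a = t ^ (a - 1) * t := by
        rw [Real.rpow_sub_one ht0.ne', div_mul_cancel₀ _ ht0.ne']
      rw [this]
      push_cast
      ring
  have hopen : IsOpen {r : ℂ | 0 < r.re} := isOpen_lt continuous_const Complex.continuous_re
  have hdiff2 : DifferentiableOn ℂ (fun r : ℂ => (Real.Gamma a : ℂ) * r ^ (-(a : ℂ)))
      {r | 0 < r.re} := by
    intro r hr
    refine (DifferentiableAt.const_mul ?_ _).differentiableWithinAt
    exact differentiableAt_id.cpow (differentiableAt_const _) (Or.inl hr)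
  have hconn : IsPreconnected {r : ℂ | 0 < r.re} :=
    (convex_halfSpace_re_gt 0).isPreconnected
  refine (hdiff.analyticOnNhd hopen).eqOn_of_preconnected_of_frequently_eq
    (hdiff2.analyticOnNhd hopen) hconn (z₀ := 1) (by simp) ?_ hr
  have hreal_eq : ∀ σ : ℝ, 0 < σ →
      ∫ t in Set.Ioi (0 : ℝ), ((t ^ (a - 1) : ℝ) : ℂ) * Complex.exp (-(σ : ℂ) * t) =
      (Real.Gamma a : ℂ) * (σ : ℂ) ^ (-(a : ℂ)) := by
    intro σ hσ
    have h1 := Real.integral_rpow_mul_exp_neg_mul_Ioi ha hσ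
    have h2 : ∫ t in Set.Ioi (0 : ℝ), ((t ^ (a - 1) : ℝ) : ℂ) * Complex.exp (-(σ : ℂ) * t) =
        ∫ t in Set.Ioi (0 : ℝ), ((t ^ (a - 1) * Real.exp (-(σ * t)) : ℝ) : ℂ) := by
      refine integral_congr_ae (Eventually.of_forall fun t => ?_)
      simp
    rw [h2, integral_complex_ofReal, h1, one_div, Real.inv_rpow hσ.le, ← Real.rpow_neg hσ.le]
    push_cast
    rw [Complex.ofReal_cpow hσ.le]
    push_cast
    ring
  have hseq : Tendsto (fun n : ℕ => ((1 + 1 / ((n : ℝ) + 1) : ℝ) : ℂ)) atTop (𝓝[≠] 1) := by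
    refine tendsto_nhdsWithin_iff.2 ⟨?_, Eventually.of_forall fun n => ?_⟩
    · have := (tendsto_one_div_add_atTop_nhds_zero_nat (𝕜 := ℝ)).const_add 1
      rw [add_zero] at this
      have h := (Complex.continuous_ofReal.tendsto 1).comp this
      rwa [Complex.ofReal_one] at h
    · intro h
      have h1 := Complex.ofReal_injective
        ((Set.mem_singleton_iff.1 h).trans Complex.ofReal_one.symm)
      have : (0 : ℝ) < 1 / ((n : ℝ) + 1) := by positivity
      linarith
  exact hseq.frequently (Eventually.frequently (Eventually.of_forall fun n =>
    hreal_eq _ (by positivity)))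

namespace RegularTail

variable {p : ℝ → ℝ} {β : ℝ}

lemma measurable (hp : RegularTail p β) : Measurable p := hp.anti.measurable

/-- Abelian theorem for the Laplace transform of the tail, at complex arguments. -/
lemma tendsto_laplace (hp : RegularTail p β) (hβ0 : 0 < β) (hβ1 : β < 1) {u : ℂ}
    (hu : 0 < u.re) :
    Tendsto (fun n : ℕ => (∫ x in Set.Ioi (0 : ℝ), u * Complex.exp (-u * x) * (p (n * x) : ℂ)) /
      (p n : ℂ)) atTop (𝓝 ((Real.Gamma (1 - β) : ℂ) * u ^ (β : ℂ))) := by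
  obtain ⟨C, hC, hpot⟩ := hp.potter_lower (γ := (β + 1) / 2) (by linarith) (by linarith)
  have hlim : ∫ x in Set.Ioi (0 : ℝ), u * Complex.exp (-u * x) * ((x ^ (-β) : ℝ) : ℂ) =
      (Real.Gamma (1 - β) : ℂ) * u ^ (β : ℂ) := by
    have h1 := integral_rpow_mul_cexp_neg_mul (a := 1 - β) (by linarith) hu
    have hu0 : u ≠ 0 := by rintro rfl; simp at hu
    calc _ = ∫ x in Set.Ioi (0 : ℝ), u * (((x ^ ((1 - β) - 1) : ℝ) : ℂ) * Complex.exp (-u * x)) := by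
          refine integral_congr_ae (Eventually.of_forall fun x => ?_)
          simp only [show (1 - β) - 1 = -β by ring]
          ring
      _ = _ := by
          rw [integral_const_mul, h1]
          have : u ^ (β : ℂ) = u * u ^ (-((1 - β : ℝ) : ℂ)) := by
            have h2 : (β : ℂ) = 1 + -((1 - β : ℝ) : ℂ) := by push_cast; ring
            rw [h2, Complex.cpow_add _ _ hu0, Complex.cpow_one]
          rw [this]
          ring
  rw [← hlim]
  have hrw : ∀ n : ℕ, (∫ x in Set.Ioi (0 : ℝ), u * Complex.exp (-u * x) * (p (n * x) : ℂ)) /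
      (p n : ℂ) = ∫ x in Set.Ioi (0 : ℝ), u * Complex.exp (-u * x) * ((p (n * x) / p n : ℝ) : ℂ) := by
    intro n
    rw [← integral_div]
    refine integral_congr_ae (Eventually.of_forall fun x => ?_)
    push_cast
    ring
  simp_rw [hrw]
  have hreal : ∀ (s σ : ℝ), -1 < s → 0 < σ →
      IntegrableOn (fun t : ℝ => t ^ s * Real.exp (-σ * t)) (Set.Ioi 0) := fun s σ hs hσ => by
    simpa using integrableOn_rpow_mul_exp_neg_mul_rpow hs one_pos hσ
  refine tendsto_integral_filter_of_dominated_convergence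
    (fun x => ‖u‖ * (C * (x ^ (-((β + 1) / 2)) * Real.exp (-u.re * x)) + Real.exp (-u.re * x)))
    (Eventually.of_forall fun n => ?_) ?_ ?_ ?_
  · have hm : Measurable fun x : ℝ => p (n * x) / p n :=
      (hp.measurable.comp (measurable_const_mul _)).div_const _
    exact ((by fun_prop : Measurable fun x : ℝ => u * Complex.exp (-u * x)).mul
      (Complex.measurable_ofReal.comp hm)).aestronglyMeasurable
  · filter_upwards [eventually_ge_atTop 1] with n hn
    filter_upwards [ae_restrict_mem measurableSet_Ioi] with x hx
    have hx0 : 0 < x := hx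
    have hn0 : (0 : ℝ) < n := by exact_mod_cast hn
    have hpn := hp.pos n
    rw [norm_mul, norm_mul, Complex.norm_real, Real.norm_of_nonneg
      (div_nonneg (hp.pos _).le (hp.pos _).le), Complex.norm_exp]
    have : (-u * (x : ℂ)).re = -u.re * x := by simp
    rw [this]
    have hb : p (n * x) / p n ≤ C * x ^ (-((β + 1) / 2)) + 1 := by
      rcases le_total x 1 with h1 | h1
      · have h2 := hpot (n * x) n (by positivity) (mul_le_of_le_one_right hn0.le h1)
        have h3 : (n : ℝ) / (n * x) = x⁻¹ := by field_simp
        rw [h3, Real.inv_rpow hx0.le, ← Real.rpow_neg hx0.le] at h2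
        have := (div_le_iff₀ hpn).2 h2
        linarith
      · have h2 := hp.anti (le_mul_of_one_le_right hn0.le h1)
        have := (div_le_one hpn).2 h2
        have : 0 ≤ C * x ^ (-((β + 1) / 2)) := by positivity
        linarith
    calc _ ≤ ‖u‖ * Real.exp (-u.re * x) * (C * x ^ (-((β + 1) / 2)) + 1) := by gcongr
      _ = _ := by ring
  · exact (((hreal _ _ (by linarith) hu).const_mul C).add
      (exp_neg_integrableOn_Ioi 0 hu)).const_mul _
  · filter_upwards [ae_restrict_mem measurableSet_Ioi] with x hx
    have h1 := (hp.ratio (c := x) hx).comp tendsto_natCast_atTop_atTop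
    refine Tendsto.const_mul _ ((Complex.continuous_ofReal.tendsto _).comp ?_)
    refine h1.congr fun n => ?_
    simp [mul_comm]

/-- Karamata's bound for the truncated mean. -/
lemma integral_Ioc_le (hp : RegularTail p β) (hβ0 : 0 < β) (hβ1 : β < 1) :
    ∃ C : ℝ, 0 < C ∧ ∀ N : ℝ, 0 < N → ∫ x in Set.Ioc 0 N, p x ≤ C * N * p N := by
  obtain ⟨C, hC, hpot⟩ := hp.potter_lower (γ := (β + 1) / 2) (by linarith) (by linarith)
  set γ := (β + 1) / 2 with hγ
  have hγ1 : γ < 1 := by rw [hγ]; linarith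
  refine ⟨C / (1 - γ), div_pos hC (by linarith), fun N hN => ?_⟩
  have hi : IntegrableOn (fun x : ℝ => x ^ (-γ)) (Set.Ioc 0 N) := by
    rw [← intervalIntegrable_iff_integrableOn_Ioc_of_le hN.le]
    exact intervalIntegral.intervalIntegrable_rpow' (by linarith)
  have hval : ∫ x in Set.Ioc 0 N, x ^ (-γ) = N ^ (1 - γ) / (1 - γ) := by
    rw [← intervalIntegral.integral_of_le hN.le, integral_rpow (Or.inl (by linarith)),
      Real.zero_rpow (by linarith)]
    rw [sub_zero, show -γ + 1 = 1 - γ by ring]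
  calc ∫ x in Set.Ioc 0 N, p x ≤ ∫ x in Set.Ioc 0 N, C * N ^ γ * p N * x ^ (-γ) := by
        refine integral_mono_of_nonneg (Eventually.of_forall fun x => (hp.pos x).le)
          (hi.const_mul _) ?_
        filter_upwards [ae_restrict_mem measurableSet_Ioc] with x hx
        have := hpot x N hx.1 hx.2
        rw [Real.div_rpow hN.le hx.1.le] at this
        rw [Real.rpow_neg hx.1.le]
        calc p x ≤ _ := this
          _ = _ := by ring
    _ = C / (1 - γ) * (N ^ γ * N ^ (1 - γ)) * p N := by
        rw [integral_const_mul, hval]; ring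
    _ = _ := by rw [← Real.rpow_add hN]; simp

/-- A lower bound on a nonnegative sequence of order `1 / (k * p k)` gives the corresponding lower
bound for its Abel sums. -/
lemma mul_gamma_le_of_abel_sum_le (hp : RegularTail p β) (hβ0 : 0 < β) {t b' : ℕ → ℝ} {a b : ℝ}
    (ha : 0 ≤ a) (ht : ∀ k, 0 ≤ t k) (hta : ∀ᶠ k : ℕ in atTop, a ≤ k * p k * t k)
    (hb : Tendsto b' atTop (𝓝 b))
    (hsum : ∀ᶠ n : ℕ in atTop, ∀ K : ℕ,
      p n * ∑ k ∈ Finset.range K, Real.exp (-(k / n)) * t k ≤ b' n) :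
    a * Real.Gamma β ≤ b := by
  set f : ℕ → ℝ → ENNReal := fun n y => ∑' k : ℕ,
    (Set.Ioc ((k : ℝ) / n) (((k + 1 : ℕ) : ℝ) / n)).indicator
      (fun _ => ENNReal.ofReal (p n * n * (Real.exp (-(((k + 1 : ℕ) : ℝ) / n)) * t (k + 1)))) y
    with hf
  have hfm : ∀ n, Measurable (f n) := fun n =>
    Measurable.tsum fun k => measurable_const.indicator measurableSet_Ioc
  have hint : ∀ᶠ n in atTop, ∫⁻ y in Set.Ioi (0 : ℝ), f n y ≤ ENNReal.ofReal (b' n) := by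
    filter_upwards [hsum, eventually_ge_atTop 1] with n hn hn1
    have hn0 : (0 : ℝ) < n := by exact_mod_cast hn1
    rw [hf, lintegral_tsum fun k => (measurable_const.indicator measurableSet_Ioc).aemeasurable]
    refine ENNReal.tsum_le_of_sum_range_le fun K => ?_
    have hterm : ∀ k : ℕ, ∫⁻ y in Set.Ioi (0 : ℝ),
        (Set.Ioc ((k : ℝ) / n) (((k + 1 : ℕ) : ℝ) / n)).indicator (fun _ => ENNReal.ofReal
          (p n * n * (Real.exp (-(((k + 1 : ℕ) : ℝ) / n)) * t (k + 1)))) y ≤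
        ENNReal.ofReal (p n * (Real.exp (-(((k + 1 : ℕ) : ℝ) / n)) * t (k + 1))) := by
      intro k
      refine (lintegral_mono' Measure.restrict_le_self le_rfl).trans ?_
      rw [lintegral_indicator_const measurableSet_Ioc, Real.volume_Ioc,
        ← ENNReal.ofReal_mul (mul_nonneg (mul_nonneg (hp.pos _).le hn0.le)
          (mul_nonneg (Real.exp_pos _).le (ht _)))]
      refine (congrArg ENNReal.ofReal ?_).le
      push_cast
      field_simp
      ring
    refine (Finset.sum_le_sum fun k _ => hterm k).trans ?_
    rw [← ENNReal.ofReal_sum_of_nonneg fun k _ => mul_nonneg (hp.pos _).le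
      (mul_nonneg (Real.exp_pos _).le (ht _))]
    refine ENNReal.ofReal_le_ofReal (le_trans ?_ (hn (K + 1)))
    rw [← Finset.mul_sum, Finset.sum_range_succ']
    refine mul_le_mul_of_nonneg_left ?_ (hp.pos _).le
    exact le_add_of_nonneg_right (mul_nonneg (Real.exp_pos _).le (ht _))
  have hlim : ∀ y : ℝ, 0 < y →
      ENNReal.ofReal (a * (y ^ (β - 1) * Real.exp (-y))) ≤ liminf (fun n => f n y) atTop := by
    intro y hy
    have hny : Tendsto (fun n : ℕ => y * (n : ℝ)) atTop atTop :=
      tendsto_natCast_atTop_atTop.const_mul_atTop hy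
    have hk : Tendsto (fun n : ℕ => ⌈y * (n : ℝ)⌉₊) atTop atTop :=
      tendsto_nat_ceil_atTop.comp hny
    have hkn : Tendsto (fun n : ℕ => (⌈y * (n : ℝ)⌉₊ : ℝ) / n) atTop (𝓝 y) :=
      (tendsto_nat_ceil_mul_div_atTop hy.le).comp tendsto_natCast_atTop_atTop
    have hr : Tendsto (fun n : ℕ => p (y * n) / p n) atTop (𝓝 (y ^ (-β))) :=
      (hp.ratio hy).comp tendsto_natCast_atTop_atTop
    have hL : Tendsto (fun n : ℕ => a * (((p (y * n) / p n)⁻¹ * ((⌈y * (n : ℝ)⌉₊ : ℝ) / n)⁻¹) *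
        Real.exp (-((⌈y * (n : ℝ)⌉₊ : ℝ) / n)))) atTop (𝓝 (a * (y ^ (β - 1) * Real.exp (-y)))) := by
      have h1 : y ^ (β - 1) = (y ^ (-β))⁻¹ * y⁻¹ := by
        rw [Real.rpow_sub_one hy.ne', Real.rpow_neg hy.le, inv_inv, div_eq_mul_inv]
      rw [h1]
      exact (((hr.inv₀ (Real.rpow_pos_of_pos hy _).ne').mul (hkn.inv₀ hy.ne')).mul
        ((Real.continuous_exp.tendsto _).comp hkn.neg)).const_mul a
    rw [← (ENNReal.tendsto_ofReal hL).liminf_eq]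
    refine liminf_le_liminf ?_
    filter_upwards [hk.eventually hta, eventually_ge_atTop 1, hk.eventually_ge_atTop 1]
      with n hn hn1 hk1
    have hn0 : (0 : ℝ) < n := by exact_mod_cast hn1
    set k := ⌈y * (n : ℝ)⌉₊ with hkdef
    have hk0 : (0 : ℝ) < k := by exact_mod_cast hk1
    have hyk : y * n ≤ k := Nat.le_ceil _
    have hky : (k : ℝ) < y * n + 1 := Nat.ceil_lt_add_one (by positivity)
    refine le_trans ?_ (ENNReal.le_tsum (k - 1))
    have hmem : y ∈ Set.Ioc (((k - 1 : ℕ) : ℝ) / n) (((k - 1 + 1 : ℕ) : ℝ) / n) := by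
      rw [Nat.sub_add_cancel hk1, Nat.cast_sub hk1, Set.mem_Ioc, div_lt_iff₀ hn0, le_div_iff₀ hn0]
      push_cast
      exact ⟨by linarith, hyk⟩
    rw [Set.indicator_of_mem hmem, Nat.sub_add_cancel hk1]
    refine ENNReal.ofReal_le_ofReal ?_
    have hpk := hp.pos k
    have hpn := hp.pos n
    have hpy := hp.pos (y * n)
    have h1 : (p (y * n) / p n)⁻¹ ≤ p n / p k := by
      rw [inv_div]
      exact div_le_div_of_nonneg_left hpn.le hpk (hp.anti hyk)
    calc _ ≤ (k * p k * t k) * ((p n / p k * ((k : ℝ) / n)⁻¹) * Real.exp (-((k : ℝ) / n))) := by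
          have := ht k
          gcongr
      _ = _ := by field_simp
  have hgint : IntegrableOn (fun y : ℝ => y ^ (β - 1) * Real.exp (-y)) (Set.Ioi 0) := by
    simpa using integrableOn_rpow_mul_exp_neg_mul_rpow (s := β - 1) (by linarith) one_pos one_pos
  have hgam : ∫ y in Set.Ioi (0 : ℝ), a * (y ^ (β - 1) * Real.exp (-y)) = a * Real.Gamma β := by
    rw [integral_const_mul, Real.Gamma_eq_integral hβ0]
    congr 1
    exact integral_congr_ae (Eventually.of_forall fun y => mul_comm _ _)
  have hchain : ENNReal.ofReal (a * Real.Gamma β) ≤ ENNReal.ofReal b := by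
    rw [← hgam, ofReal_integral_eq_lintegral_ofReal (hgint.const_mul a)]
    · calc _ ≤ ∫⁻ y in Set.Ioi (0 : ℝ), liminf (fun n => f n y) atTop := by
            refine lintegral_mono_ae ?_
            filter_upwards [ae_restrict_mem measurableSet_Ioi] with y hy
            exact hlim y hy
        _ ≤ liminf (fun n => ∫⁻ y in Set.Ioi (0 : ℝ), f n y) atTop := lintegral_liminf_le hfm
        _ ≤ liminf (fun n => ENNReal.ofReal (b' n)) atTop := liminf_le_liminf hint
        _ = _ := (ENNReal.tendsto_ofReal hb).liminf_eq
    · filter_upwards [ae_restrict_mem measurableSet_Ioi] with y hy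
      have : (0 : ℝ) < y := hy
      positivity
  have hb0 : 0 ≤ b := by
    refine ge_of_tendsto hb ?_
    filter_upwards [hsum] with n hn
    simpa using hn 0
  exact (ENNReal.ofReal_le_ofReal_iff hb0).1 hchain

end RegularTail

/-- The tail `x ↦ μ (φ > x)` of an integer valued function. -/
noncomputable def tailFun {Y : Type*} [MeasurableSpace Y] (μ : Measure Y) (φ : Y → ℕ) (x : ℝ) : ℝ :=
  μ.real {y | x < (φ y : ℝ)}

lemma tailFun_natCast {Y : Type*} [MeasurableSpace Y] {μ : Measure Y} {φ : Y → ℕ} (n : ℕ) :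
    tailFun μ φ n = μ.real {y | n < φ y} := by
  simp [tailFun]

section Tail

variable {Y : Type*} [MeasurableSpace Y] {μ : Measure Y} [IsProbabilityMeasure μ] {φ : Y → ℕ}

lemma measurableSet_lt_natCast (hφ : Measurable φ) (x : ℝ) :
    MeasurableSet {y | x < (φ y : ℝ)} :=
  measurableSet_lt measurable_const (measurable_from_top.comp hφ)

lemma regularTail_tailFun {l : ℝ → ℝ} (hl : SlowlyVarying l) {β : ℝ}
    (htail : ∀ n : ℕ, 1 ≤ n → μ.real {y | n < φ y} = l n * (n : ℝ) ^ (-β)) :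
    RegularTail (tailFun μ φ) β := by
  have hanti : Antitone (tailFun μ φ) := fun x x' hx =>
    measureReal_mono fun y (hy : x' < _) => hx.trans_lt hy
  have hlpos : ∀ n : ℕ, 1 ≤ n → 0 < l n := by
    intro n hn
    obtain ⟨c, C, hc, h⟩ := hl.2.1 {(n : ℝ)} isCompact_singleton (by
      simp only [Set.singleton_subset_iff, Set.mem_Ioi]; exact_mod_cast hn)
    exact hc.trans_le (h n rfl).1
  have hnpos : ∀ n : ℕ, 1 ≤ n → 0 < tailFun μ φ n := fun n hn => by
    rw [tailFun_natCast, htail n hn]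
    exact mul_pos (hlpos n hn) (Real.rpow_pos_of_pos (by exact_mod_cast hn) _)
  refine ⟨hanti, fun x => ?_, fun x => measureReal_le_one, fun a ha => ?_⟩
  · refine (hnpos (⌈x⌉₊ + 1) (by omega)).trans_le (hanti ?_)
    push_cast
    linarith [Nat.le_ceil x]
  · have h1 := (hl.2.2 a (by exact_mod_cast ha)).comp tendsto_natCast_atTop_atTop
    have h2 := h1.mul_const ((a : ℝ) ^ (-β))
    rw [one_mul] at h2
    refine h2.congr' ?_
    filter_upwards [eventually_ge_atTop 1] with j hj
    have hj0 : (0 : ℝ) < j := by exact_mod_cast hj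
    have ha0 : (0 : ℝ) < a := by exact_mod_cast ha
    have h3 := tailFun_natCast (μ := μ) (φ := φ) (a * j)
    rw [htail (a * j) (Nat.mul_pos ha hj)] at h3
    push_cast at h3
    rw [h3, tailFun_natCast, htail j hj, Real.mul_rpow ha0.le hj0.le]
    have := hlpos j hj
    have := Real.rpow_pos_of_pos hj0 (-β)
    simp only [Function.comp]
    field_simp

lemma integral_integral_indicator_lt (hφ : Measurable φ) {E : Type*} [NormedAddCommGroup E]
    [NormedSpace ℝ E] [CompleteSpace E] {g : ℝ → E} (hg : IntegrableOn g (Set.Ioi 0)) :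
    ∫ y, (∫ x in Set.Ioi (0 : ℝ), (Set.Iio (φ y : ℝ)).indicator g x) ∂μ =
      ∫ x in Set.Ioi (0 : ℝ), tailFun μ φ x • g x := by
  have hs : MeasurableSet {q : Y × ℝ | q.2 < (φ q.1 : ℝ)} :=
    measurableSet_lt measurable_snd ((measurable_from_top.comp hφ).comp measurable_fst)
  have hi : Integrable (Function.uncurry fun y x => (Set.Iio (φ y : ℝ)).indicator g x)
      (μ.prod (volume.restrict (Set.Ioi 0))) := (hg.comp_snd μ).indicator hs
  rw [integral_integral_swap hi]
  refine integral_congr_ae (Eventually.of_forall fun x => ?_)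
  have : (fun y => (Set.Iio (φ y : ℝ)).indicator g x) =
      {y | x < (φ y : ℝ)}.indicator fun _ => g x := by
    ext y; simp [Set.indicator_apply]
  simp only [this]
  rw [integral_indicator_const _ (measurableSet_lt_natCast hφ x), tailFun]

lemma integrable_one_sub_cexp (hφ : Measurable φ) {w : ℂ} (hw : 0 ≤ w.re) :
    Integrable (fun y => 1 - Complex.exp (-w * φ y)) μ := by
  have hm : Measurable fun y => Complex.exp (-w * φ y) :=
    (measurable_from_top (f := fun n : ℕ => Complex.exp (-w * n))).comp hφ
  refine Integrable.of_bound (C := 2) (measurable_const.sub hm).aestronglyMeasurable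
    (Eventually.of_forall fun y => ?_)
  refine (norm_sub_le _ _).trans ?_
  have : ‖Complex.exp (-w * φ y)‖ ≤ 1 := by
    rw [Complex.norm_exp, Real.exp_le_one_iff]
    simp only [Complex.mul_re, Complex.neg_re, Complex.natCast_re, Complex.natCast_im, mul_zero,
      sub_zero]
    have : (0 : ℝ) ≤ φ y := Nat.cast_nonneg _
    nlinarith
  simp only [norm_one]
  linarith

lemma integral_one_sub_cexp (hφ : Measurable φ) {w : ℂ} (hw : 0 < w.re) :
    ∫ y, (1 - Complex.exp (-w * φ y)) ∂μ =
      ∫ x in Set.Ioi (0 : ℝ), w * Complex.exp (-w * x) * (tailFun μ φ x : ℂ) := by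
  have hw0 : w ≠ 0 := by rintro rfl; simp at hw
  have hg : IntegrableOn (fun x : ℝ => w * Complex.exp (-w * x)) (Set.Ioi 0) :=
    (integrableOn_exp_mul_complex_Ioi (a := -w) (by simpa using hw) 0).const_mul w
  have h1 := integral_integral_indicator_lt (μ := μ) hφ hg
  have h2 : ∀ y, ∫ x in Set.Ioi (0 : ℝ), (Set.Iio (φ y : ℝ)).indicator
      (fun x : ℝ => w * Complex.exp (-w * x)) x = 1 - Complex.exp (-w * φ y) := by
    intro y
    rw [setIntegral_indicator measurableSet_Iio, Set.Ioi_inter_Iio, ← integral_Ioc_eq_integral_Ioo,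
      ← intervalIntegral.integral_of_le (Nat.cast_nonneg _), intervalIntegral.integral_const_mul,
      integral_exp_mul_complex (neg_ne_zero.2 hw0)]
    push_cast
    field_simp
    simp
  simp_rw [h2] at h1
  rw [h1]
  refine integral_congr_ae (Eventually.of_forall fun x => ?_)
  simp only [Complex.real_smul]
  ring

lemma integral_norm_one_sub_cexp_le {β : ℝ} (hφ : Measurable φ)
    (hp : RegularTail (tailFun μ φ) β) (hβ0 : 0 < β) (hβ1 : β < 1) :
    ∃ C : ℝ, 0 < C ∧ ∀ w : ℂ, 0 ≤ w.re → w ≠ 0 →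
      ∫ y, ‖1 - Complex.exp (-w * φ y)‖ ∂μ ≤ C * tailFun μ φ (1 / ‖w‖) := by
  obtain ⟨C, hC, hK⟩ := hp.integral_Ioc_le hβ0 hβ1
  refine ⟨2 * C, by positivity, fun w hw hw0 => ?_⟩
  have hnw : 0 < ‖w‖ := norm_pos_iff.2 hw0
  set g : ℝ → ℝ := (Set.Ioo 0 (1 / ‖w‖)).indicator fun _ => 2 * ‖w‖ with hgdef
  have hg : IntegrableOn g (Set.Ioi 0) := by
    refine (IntegrableOn.integrable_indicator ?_ measurableSet_Ioo).integrableOn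
    exact integrableOn_const (by simp)
  have h1 := integral_integral_indicator_lt (μ := μ) hφ hg
  have hinner : ∀ y, ∫ x in Set.Ioi (0 : ℝ), (Set.Iio (φ y : ℝ)).indicator g x =
      2 * ‖w‖ * min (φ y : ℝ) (1 / ‖w‖) := by
    intro y
    rw [setIntegral_indicator measurableSet_Iio, Set.Ioi_inter_Iio, hgdef,
      setIntegral_indicator measurableSet_Ioo, Set.Ioo_inter_Ioo, setIntegral_const, sup_idem,
      Real.volume_real_Ioo_of_le (le_min (Nat.cast_nonneg _) (by positivity))]
    simp [mul_comm]
  have houter : ∫ x in Set.Ioi (0 : ℝ), tailFun μ φ x • g x =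
      2 * ‖w‖ * ∫ x in Set.Ioc 0 (1 / ‖w‖), tailFun μ φ x := by
    have : (fun x => tailFun μ φ x • g x) =
        (Set.Ioo 0 (1 / ‖w‖)).indicator fun x => 2 * ‖w‖ * tailFun μ φ x := by
      ext x
      simp only [hgdef, Set.indicator_apply, smul_eq_mul]
      split_ifs <;> ring
    rw [this, setIntegral_indicator measurableSet_Ioo,
      Set.inter_eq_self_of_subset_right Set.Ioo_subset_Ioi_self, integral_const_mul,
      integral_Ioc_eq_integral_Ioo]
  rw [houter] at h1
  simp_rw [hinner] at h1
  have hpt : ∀ y, ‖1 - Complex.exp (-w * φ y)‖ ≤ 2 * ‖w‖ * min (φ y : ℝ) (1 / ‖w‖) := by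
    intro y
    have h2 : ‖Complex.exp (-w * φ y)‖ ≤ 1 := by
      rw [Complex.norm_exp, Real.exp_le_one_iff]
      simp only [Complex.mul_re, Complex.neg_re, Complex.natCast_re, Complex.natCast_im, mul_zero,
        sub_zero]
      have : (0 : ℝ) ≤ φ y := Nat.cast_nonneg _
      nlinarith
    have hz : ‖-w * φ y‖ = ‖w‖ * φ y := by simp
    rcases le_total ((φ y : ℝ)) (1 / ‖w‖) with h | h
    · rw [min_eq_left h, norm_sub_rev]
      rw [le_div_iff₀ hnw] at h
      refine (Complex.norm_exp_sub_one_le (by rw [hz]; linarith)).trans ?_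
      rw [hz]
      linarith
    · rw [min_eq_right h]
      refine (norm_sub_le _ _).trans ?_
      rw [mul_assoc, mul_one_div_cancel hnw.ne', norm_one]
      linarith
  have hmi : Integrable (fun y => 2 * ‖w‖ * min (φ y : ℝ) (1 / ‖w‖)) μ := by
    refine Integrable.const_mul (Integrable.of_bound (C := 1 / ‖w‖)
      ((measurable_from_top (f := fun n : ℕ => min (n : ℝ) (1 / ‖w‖))).comp
        hφ).aestronglyMeasurable (Eventually.of_forall fun y => ?_)) _
    rw [Function.comp_apply, Real.norm_of_nonneg (le_min (Nat.cast_nonneg _) (by positivity))]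
    exact min_le_right _ _
  calc _ ≤ ∫ y, 2 * ‖w‖ * min (φ y : ℝ) (1 / ‖w‖) ∂μ :=
        integral_mono (integrable_one_sub_cexp hφ hw).norm hmi hpt
    _ ≤ 2 * ‖w‖ * (C * (1 / ‖w‖) * tailFun μ φ (1 / ‖w‖)) := by
        rw [h1]
        gcongr
        exact hK _ (by positivity)
    _ = _ := by field_simp

lemma le_re_integral_one_sub_cexp {β : ℝ} (hφ : Measurable φ)
    (hp : RegularTail (tailFun μ φ) β) (hβ0 : 0 < β) :
    ∃ c w₀ : ℝ, 0 < c ∧ 0 < w₀ ∧ ∀ w : ℂ, 0 ≤ w.re → w ≠ 0 → ‖w‖ ≤ w₀ →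
      c * tailFun μ φ (1 / ‖w‖) ≤ (∫ y, (1 - Complex.exp (-w * φ y)) ∂μ).re := by
  set p := tailFun μ φ with hpdef
  have h3 : (3 : ℝ) ^ (-β) < 1 := Real.rpow_lt_one_of_one_lt_of_neg (by norm_num) (by linarith)
  set d := (1 - (3 : ℝ) ^ (-β)) / 2 with hd
  have hd0 : 0 < d := by rw [hd]; linarith
  have hd1 : d ≤ 1 / 2 := by
    have : 0 < (3 : ℝ) ^ (-β) := by positivity
    rw [hd]; linarith
  have hev : ∀ᶠ x in atTop, p (3 * x) / p x < 1 - d :=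
    (hp.ratio (by norm_num : (0 : ℝ) < 3)).eventually (gt_mem_nhds (by rw [hd]; linarith))
  obtain ⟨X, hX1, hX⟩ := ((eventually_ge_atTop (1 : ℝ)).and (eventually_forall_ge_atTop.2 hev)).exists
  obtain ⟨C, hC, hpot⟩ := hp.potter_lower (γ := β + 1) (by linarith) (by linarith)
  refine ⟨d / (C * 4 ^ (β + 1)), 1 / X, by positivity, by positivity, fun w hw hw0 hwX => ?_⟩
  have hnw : 0 < ‖w‖ := norm_pos_iff.2 hw0
  have hint := integrable_one_sub_cexp (μ := μ) hφ hw
  have hre : (∫ y, (1 - Complex.exp (-w * φ y)) ∂μ).re =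
      ∫ y, (1 - Real.exp (-(w.re * φ y)) * Real.cos (w.im * φ y)) ∂μ := by
    rw [← RCLike.re_eq_complex_re, ← integral_re hint]
    refine integral_congr_ae (Eventually.of_forall fun y => ?_)
    simp [Complex.exp_re]
  have hreint : Integrable (fun y => 1 - Real.exp (-(w.re * φ y)) * Real.cos (w.im * φ y)) μ := by
    refine hint.re.congr (Eventually.of_forall fun y => ?_)
    simp [Complex.exp_re]
  have hcosle : ∀ y, Real.exp (-(w.re * φ y)) * Real.cos (w.im * φ y) ≤
      Real.exp (-(w.re * φ y)) := fun y =>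
    mul_le_of_le_one_right (Real.exp_pos _).le (Real.cos_le_one _)
  have hexple : ∀ y, Real.exp (-(w.re * φ y)) ≤ 1 := fun y => by
    rw [Real.exp_le_one_iff]
    have : (0 : ℝ) ≤ φ y := Nat.cast_nonneg _
    nlinarith
  have hnonneg : ∀ y, 0 ≤ 1 - Real.exp (-(w.re * φ y)) * Real.cos (w.im * φ y) := fun y => by
    linarith [hcosle y, hexple y]
  have hset : ∀ (S : Set Y) (a : ℝ), MeasurableSet S →
      (∀ y ∈ S, a ≤ 1 - Real.exp (-(w.re * φ y)) * Real.cos (w.im * φ y)) →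
      μ.real S * a ≤ ∫ y, (1 - Real.exp (-(w.re * φ y)) * Real.cos (w.im * φ y)) ∂μ := by
    intro S a hS h
    rw [← smul_eq_mul, ← integral_indicator_const a hS]
    refine integral_mono ((integrable_const a).indicator hS) hreint fun y => ?_
    by_cases hy : y ∈ S
    · rw [Set.indicator_of_mem hy]; exact h y hy
    · rw [Set.indicator_of_notMem hy]; exact hnonneg y
  have hmain : d * p (4 * (1 / ‖w‖)) ≤ (∫ y, (1 - Complex.exp (-w * φ y)) ∂μ).re := by
    rw [hre]
    have hle := Complex.norm_le_abs_re_add_abs_im w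
    rw [abs_of_nonneg hw] at hle
    rcases le_or_gt |w.im| w.re with hab | hab
    · have ha : 0 < w.re := by linarith
      have h4 := hset {y | 1 / w.re < (φ y : ℝ)} (1 / 2) (measurableSet_lt_natCast hφ _) (by
        intro y hy
        have hy' : 1 / w.re < (φ y : ℝ) := hy
        rw [div_lt_iff₀ ha] at hy'
        have h5 : Real.exp (-(w.re * φ y)) ≤ Real.exp (-1) := Real.exp_le_exp.2 (by linarith)
        have h6 : Real.exp (-1) ≤ 1 / 2 := by
          rw [Real.exp_neg, inv_le_comm₀ (Real.exp_pos _) (by norm_num)]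
          linarith [Real.add_one_le_exp 1]
        linarith [hcosle y])
      refine le_trans ?_ h4
      have h7 : p (4 * (1 / ‖w‖)) ≤ p (1 / w.re) := by
        refine hp.anti ?_
        rw [← mul_div_assoc, mul_one, div_le_div_iff₀ ha hnw]
        linarith
      calc d * p (4 * (1 / ‖w‖)) ≤ 1 / 2 * p (1 / w.re) :=
            mul_le_mul hd1 h7 (hp.pos _).le (by norm_num)
        _ = _ := mul_comm _ _
    · have hb : 0 < |w.im| := lt_of_le_of_lt hw hab
      set x := Real.pi / (2 * |w.im|) with hx
      have hxX : X ≤ x := by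
        have h8 := (Complex.abs_im_le_norm w).trans hwX
        rw [le_div_iff₀ (by linarith)] at h8
        rw [hx, le_div_iff₀ (by positivity)]
        nlinarith [Real.pi_gt_three]
      have hx4 : x ≤ 4 * (1 / ‖w‖) := by
        rw [hx, ← mul_div_assoc, mul_one, div_le_div_iff₀ (by positivity) hnw]
        nlinarith [Real.pi_lt_four, Real.pi_pos]
      have hS := (measurableSet_lt_natCast hφ x).diff (measurableSet_lt_natCast hφ (3 * x))
      have h4 := hset _ 1 hS (by
        rintro y ⟨hy1, hy2⟩
        have hy1' : x < (φ y : ℝ) := hy1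
        have hy2' : (φ y : ℝ) ≤ 3 * x := not_lt.1 hy2
        rw [hx, div_lt_iff₀ (by positivity)] at hy1'
        rw [hx, ← mul_div_assoc, le_div_iff₀ (by positivity)] at hy2'
        have h9 : Real.cos (w.im * φ y) ≤ 0 := by
          rw [← Real.cos_abs, abs_mul, Nat.abs_cast]
          exact Real.cos_nonpos_of_pi_div_two_le_of_le (by linarith) (by linarith)
        have := mul_nonpos_of_nonneg_of_nonpos (Real.exp_pos (-(w.re * φ y))).le h9
        linarith)
      refine le_trans ?_ h4
      have hx0 : 0 < x := by linarith
      have hsub : {y | 3 * x < (φ y : ℝ)} ⊆ {y | x < (φ y : ℝ)} := fun y hy => by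
        have hy' : 3 * x < (φ y : ℝ) := hy
        show x < (φ y : ℝ)
        linarith
      rw [measureReal_sdiff hsub (measurableSet_lt_natCast hφ _), mul_one]
      change _ ≤ p x - p (3 * x)
      have h10 := hX x hxX
      rw [div_lt_iff₀ (hp.pos _)] at h10
      have h11 := mul_le_mul_of_nonneg_left (hp.anti hx4) hd0.le
      linarith
  refine le_trans ?_ hmain
  have h12 := hpot (1 / ‖w‖) (4 * (1 / ‖w‖)) (by positivity) (by
    have : 0 < 1 / ‖w‖ := by positivity
    linarith)
  rw [mul_div_cancel_right₀ _ (by positivity)] at h12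
  calc _ ≤ d / (C * 4 ^ (β + 1)) * (C * 4 ^ (β + 1) * p (4 * (1 / ‖w‖))) := by gcongr
    _ = _ := by field_simp

/-- The Laplace exponent of `φ` at the scale `n`. -/
lemma tendsto_integral_one_sub_cexp {β : ℝ} (hφ : Measurable φ)
    (hp : RegularTail (tailFun μ φ) β) (hβ0 : 0 < β) (hβ1 : β < 1) {u : ℂ} (hu : 0 < u.re) :
    Tendsto (fun n : ℕ => (∫ y, (1 - Complex.exp (-(u / n) * φ y)) ∂μ) / (tailFun μ φ n : ℂ))
      atTop (𝓝 ((Real.Gamma (1 - β) : ℂ) * u ^ (β : ℂ))) := by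
  refine (hp.tendsto_laplace hβ0 hβ1 hu).congr' ?_
  filter_upwards [eventually_ge_atTop 1] with n hn
  have hn0 : (0 : ℝ) < n := by exact_mod_cast hn
  have hnc : (n : ℂ) ≠ 0 := by exact_mod_cast hn0.ne'
  have hre : 0 < (u / n).re := by
    rw [Complex.div_natCast_re]
    positivity
  rw [integral_one_sub_cexp hφ hre]
  congr 1
  have h1 := integral_comp_mul_left_Ioi
    (fun x : ℝ => (u / n) * Complex.exp (-(u / n) * x) * (tailFun μ φ x : ℂ)) 0 hn0
  rw [mul_zero] at h1
  have h2 : ∫ x in Set.Ioi (0 : ℝ), u * Complex.exp (-u * x) * (tailFun μ φ (n * x) : ℂ) =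
      ∫ x in Set.Ioi (0 : ℝ), (n : ℂ) * ((u / n) *
        Complex.exp (-(u / n) * ((n * x : ℝ) : ℂ)) * (tailFun μ φ (n * x) : ℂ)) := by
    refine integral_congr_ae (Eventually.of_forall fun x => ?_)
    simp only
    have : -(u / n) * ((n * x : ℝ) : ℂ) = -u * x := by push_cast; field_simp
    rw [this]
    field_simp
  rw [h2, integral_const_mul, h1, Complex.real_smul]
  push_cast
  rw [← mul_assoc, mul_inv_cancel₀ hnc, one_mul]

end Tail

section Banach

variable {B : Type*} [NormedAddCommGroup B] [NormedSpace ℂ B]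

/-- The Sherman–Morrison formula for the inverse of a rank one perturbation. -/
lemma inverse_sub_smulRight (m : B →L[ℂ] ℂ) (e : B) {A : B →L[ℂ] B} (hA : IsUnit A)
    (hδ : 1 - m (Ring.inverse A e) ≠ 0) :
    IsUnit (A - m.smulRight e) ∧ Ring.inverse (A - m.smulRight e) = Ring.inverse A +
      (1 - m (Ring.inverse A e))⁻¹ • (Ring.inverse A * m.smulRight e * Ring.inverse A) := by
  set X := Ring.inverse A with hX
  set P := m.smulRight e with hP
  set δ := 1 - m (X e) with hδdef
  have h1 : A * X = 1 := Ring.mul_inverse_cancel _ hA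
  have h2 : X * A = 1 := Ring.inverse_mul_cancel _ hA
  have h3 : P * X * P = (1 - δ) • P := by
    ext v
    simp [hP, hδdef, smul_smul, mul_comm]
  have h4 : (A - P) * (X + δ⁻¹ • (X * P * X)) = 1 := by
    calc (A - P) * (X + δ⁻¹ • (X * P * X))
        = A * X + δ⁻¹ • (A * X * P * X) - P * X - δ⁻¹ • (P * X * P * X) := by
          simp only [sub_mul, mul_add, mul_smul_comm, mul_assoc, smul_sub]
          abel
      _ = 1 + (δ⁻¹ - 1 - δ⁻¹ * (1 - δ)) • (P * X) := by
          rw [h1, h3, smul_mul_assoc, smul_smul, sub_smul, sub_smul, one_mul, one_smul]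
          abel
      _ = 1 := by
          rw [mul_sub, inv_mul_cancel₀ hδ]
          simp
  have h5 : (X + δ⁻¹ • (X * P * X)) * (A - P) = 1 := by
    calc (X + δ⁻¹ • (X * P * X)) * (A - P)
        = X * A + δ⁻¹ • (X * P * (X * A)) - X * P - δ⁻¹ • (X * (P * X * P)) := by
          simp only [mul_sub, add_mul, smul_mul_assoc, mul_assoc]
          abel
      _ = 1 + (δ⁻¹ - 1 - δ⁻¹ * (1 - δ)) • (X * P) := by
          rw [h2, h3, mul_smul_comm, smul_smul, sub_smul, sub_smul, mul_one, one_smul]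
          abel
      _ = 1 := by
          rw [mul_sub, inv_mul_cancel₀ hδ]
          simp
  exact ⟨⟨⟨_, _, h4, h5⟩, rfl⟩, Ring.inverse_unit ⟨A - P, _, h4, h5⟩⟩

lemma exists_isUnit_one_sub_smul [CompleteSpace B] {X : Type*} [TopologicalSpace X] {K : Set X}
    (hK : IsCompact K) {g : X → B →L[ℂ] B} (hg : ContinuousOn g K)
    (hu : ∀ x ∈ K, IsUnit (1 - g x)) :
    ∃ s₀ M : ℝ, s₀ < 1 ∧ 0 < M ∧ ∀ s : ℝ, s₀ ≤ s → s ≤ 1 → ∀ x ∈ K,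
      IsUnit (1 - (s : ℂ) • g x) ∧ ‖Ring.inverse (1 - (s : ℂ) • g x)‖ ≤ M := by
  have : CompactSpace K := isCompact_iff_compactSpace.1 hK
  have hg' : Continuous fun x : K => g x := continuousOn_iff_continuous_domRestrict.1 hg
  have hinv : ∀ x : K, ContinuousAt (Ring.inverse : (B →L[ℂ] B) → _) (1 - g x) := fun x => by
    obtain ⟨y, hy⟩ := hu x x.2
    rw [← hy]
    exact NormedRing.inverse_continuousAt y
  have hcont : Continuous fun x : K => ‖Ring.inverse (1 - g x)‖ :=
    continuous_norm.comp (continuous_iff_continuousAt.2 fun x =>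
      ContinuousAt.comp (f := fun x : K => 1 - g x) (hinv x)
        (continuous_const.sub hg').continuousAt)
  obtain ⟨M, hM⟩ := isCompact_univ.bddAbove_image hcont.continuousOn
  have hM' : ∀ x : K, ‖Ring.inverse (1 - g x)‖ ≤ M := fun x => hM ⟨x, trivial, rfl⟩
  have hev : ∀ᶠ s : ℝ in 𝓝 1, ∀ x ∈ (Set.univ : Set K),
      IsUnit (1 - (s : ℂ) • g x) ∧ ‖Ring.inverse (1 - (s : ℂ) • g x)‖ < |M| + 1 := by
    refine isCompact_univ.eventually_forall_of_forall_eventually fun x _ => ?_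
    have hc : Continuous fun q : ℝ × K => 1 - (q.1 : ℂ) • g q.2 :=
      continuous_const.sub ((Complex.continuous_ofReal.comp continuous_fst).smul
        (hg'.comp continuous_snd))
    have ht : Tendsto (fun q : ℝ × K => 1 - (q.1 : ℂ) • g q.2) (𝓝 (1, x)) (𝓝 (1 - g x)) := by
      simpa using hc.tendsto (1, x)
    refine (ht.eventually (Units.isOpen.mem_nhds (hu x x.2))).and ?_
    refine (((hinv x).tendsto.comp ht).norm).eventually (gt_mem_nhds ?_)
    exact lt_of_le_of_lt ((hM' x).trans (le_abs_self M)) (lt_add_one _)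
  obtain ⟨ε, hε, hball⟩ := Metric.eventually_nhds_iff.1 hev
  refine ⟨1 - ε / 2, |M| + 1, by linarith, by positivity, fun s hs1 hs2 x hx => ?_⟩
  have := hball (y := s) (by rw [Real.dist_eq, abs_sub_lt_iff]; constructor <;> linarith)
    ⟨x, hx⟩ trivial
  exact ⟨this.1, this.2.le⟩

end Banach

lemma Complex.re_cpow_pos {u : ℂ} (hu : 0 < u.re) {β : ℝ} (hβ0 : 0 < β) (hβ1 : β < 1) :
    0 < (u ^ (β : ℂ)).re := by
  have hu0 : u ≠ 0 := by rintro rfl; simp at hu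
  rw [Complex.cpow_def_of_ne_zero hu0, Complex.exp_re]
  refine mul_pos (Real.exp_pos _) (Real.cos_pos_of_mem_Ioo ?_)
  have h := Complex.abs_arg_lt_pi_div_two_iff.2 (Or.inl hu)
  rw [abs_lt] at h
  have : (Complex.log u * (β : ℂ)).im = u.arg * β := by simp [Complex.log_im]
  rw [this]
  have := Real.pi_pos
  constructor <;> nlinarith

/-- The data on which the resolvent analysis depends: a family of operators `R z` on the closed
unit disc, an invariant functional `m` and an invariant vector `e` for `R 1`, with `m ∘ R z`
controlled by the generating function of `φ`. -/
structure RenewalResolvent {Y : Type*} [MeasurableSpace Y] (μ : Measure Y) (φ : Y → ℕ)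
    {B : Type*} [NormedAddCommGroup B] [NormedSpace ℂ B]
    (m : B →L[ℂ] ℂ) (e : B) (R : ℂ → B →L[ℂ] B) : Prop where
  map_e : m e = 1
  one_e : R 1 e = e
  map_one : ∀ v, m (R 1 v) = m v
  defect_e : ∀ z : ℂ, ‖z‖ ≤ 1 → m e - m (R z e) = ∫ y, (1 - z ^ φ y) ∂μ
  defect_le : ∀ z : ℂ, ‖z‖ ≤ 1 → ∀ v, ‖m v - m (R z v)‖ ≤ ‖v‖ * ∫ y, ‖1 - z ^ φ y‖ ∂μ
  cont : ContinuousOn R (Metric.closedBall 0 1)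
  isUnit_one : IsUnit (1 - R 1 + m.smulRight e)
  isUnit : ∀ z : ℂ, ‖z‖ ≤ 1 → z ≠ 1 → IsUnit (1 - R z)

namespace RenewalResolvent

variable {Y : Type*} [MeasurableSpace Y] {μ : Measure Y} {φ : Y → ℕ}
  {B : Type*} [NormedAddCommGroup B] [NormedSpace ℂ B]
  {m : B →L[ℂ] ℂ} {e : B} {R : ℂ → B →L[ℂ] B} {β : ℝ}

lemma norm_exp_neg_le_one {w : ℂ} (hw : 0 ≤ w.re) : ‖Complex.exp (-w)‖ ≤ 1 := by
  rw [Complex.norm_exp, Real.exp_le_one_iff]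
  simpa using hw

lemma exp_neg_pow (w : ℂ) (n : ℕ) : Complex.exp (-w) ^ n = Complex.exp (-w * n) := by
  rw [← Complex.exp_nat_mul, mul_comm]

lemma inverse_one_e (h : RenewalResolvent μ φ m e R) :
    Ring.inverse (1 - R 1 + m.smulRight e) e = e := by
  have h1 : (1 - R 1 + m.smulRight e) e = e := by simp [h.one_e, h.map_e]
  calc Ring.inverse (1 - R 1 + m.smulRight e) e
      = (Ring.inverse (1 - R 1 + m.smulRight e) * (1 - R 1 + m.smulRight e)) e := by
        rw [mul_apply_eq_comp, h1]
    _ = e := by rw [Ring.inverse_mul_cancel _ h.isUnit_one]; rfl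

lemma map_inverse_one (h : RenewalResolvent μ φ m e R) (v : B) :
    m (Ring.inverse (1 - R 1 + m.smulRight e) v) = m v := by
  have h1 : ∀ v, m ((1 - R 1 + m.smulRight e) v) = m v := fun v => by
    simp [h.map_one, h.map_e]
  rw [← h1 (Ring.inverse (1 - R 1 + m.smulRight e) v), ← mul_apply_eq_comp,
    Ring.mul_inverse_cancel _ h.isUnit_one]
  rfl

/-- `1 - s R(e^{-w}) + m ⊗ e` and its inverse are continuous at `s = 1`, `w = 0`. -/
lemma tendsto_regularized (h : RenewalResolvent μ φ m e R) :
    Tendsto (fun q : ℝ × ℂ => 1 - (q.1 : ℂ) • R (Complex.exp (-q.2)) + m.smulRight e)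
      (𝓝[{q | 0 ≤ q.2.re}] (1, 0)) (𝓝 (1 - R 1 + m.smulRight e)) := by
  have h1 : Tendsto (fun q : ℝ × ℂ => Complex.exp (-q.2)) (𝓝[{q | 0 ≤ q.2.re}] (1, 0))
      (𝓝[Metric.closedBall 0 1] 1) := by
    refine tendsto_nhdsWithin_iff.2 ⟨?_, ?_⟩
    · have : Continuous fun q : ℝ × ℂ => Complex.exp (-q.2) := by fun_prop
      have h2 := this.tendsto (1, 0)
      simp only [neg_zero, Complex.exp_zero] at h2
      exact h2.mono_left nhdsWithin_le_nhds
    · filter_upwards [self_mem_nhdsWithin] with q hq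
      rw [mem_closedBall_zero_iff]
      exact norm_exp_neg_le_one hq
  have h2 : Tendsto (fun q : ℝ × ℂ => (q.1 : ℂ)) (𝓝[{q | 0 ≤ q.2.re}] (1, 0)) (𝓝 1) := by
    have : Continuous fun q : ℝ × ℂ => (q.1 : ℂ) := by fun_prop
    simpa using (this.tendsto (1, 0)).mono_left nhdsWithin_le_nhds
  have h3 : Tendsto (fun q : ℝ × ℂ => R (Complex.exp (-q.2))) (𝓝[{q | 0 ≤ q.2.re}] (1, 0))
      (𝓝 (R 1)) := (h.cont 1 (by simp)).tendsto.comp h1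
  simpa using (tendsto_const_nhds.sub (h2.smul h3)).add_const (m.smulRight e)

lemma tendsto_inverse_regularized [CompleteSpace B] (h : RenewalResolvent μ φ m e R) :
    Tendsto (fun q : ℝ × ℂ =>
        Ring.inverse (1 - (q.1 : ℂ) • R (Complex.exp (-q.2)) + m.smulRight e))
      (𝓝[{q | 0 ≤ q.2.re}] (1, 0)) (𝓝 (Ring.inverse (1 - R 1 + m.smulRight e))) := by
  obtain ⟨y, hy⟩ := h.isUnit_one
  have : ContinuousAt (Ring.inverse : (B →L[ℂ] B) → _) (1 - R 1 + m.smulRight e) := by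
    rw [← hy]
    exact NormedRing.inverse_continuousAt y
  exact this.tendsto.comp h.tendsto_regularized

lemma tendsto_regularized_seq [CompleteSpace B] (h : RenewalResolvent μ φ m e R) {s : ℕ → ℝ} {w : ℕ → ℂ}
    (hs : Tendsto s atTop (𝓝 1)) (hw : Tendsto w atTop (𝓝 0)) (hre : ∀ n, 0 ≤ (w n).re) :
    Tendsto (fun n => 1 - (s n : ℂ) • R (Complex.exp (-w n)) + m.smulRight e) atTop
        (𝓝 (1 - R 1 + m.smulRight e)) ∧
      Tendsto (fun n => Ring.inverse (1 - (s n : ℂ) • R (Complex.exp (-w n)) + m.smulRight e)) atTop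
        (𝓝 (Ring.inverse (1 - R 1 + m.smulRight e))) := by
  have hq : Tendsto (fun n : ℕ => (s n, w n)) atTop (𝓝[{q : ℝ × ℂ | 0 ≤ q.2.re}] (1, 0)) :=
    tendsto_nhdsWithin_iff.2 ⟨hs.prodMk_nhds hw, Eventually.of_forall hre⟩
  have h1 := h.tendsto_regularized.comp hq
  have h2 := h.tendsto_inverse_regularized.comp hq
  simp only [Function.comp_def] at h1 h2
  exact ⟨h1, h2⟩

/-- The scalar denominator of the resolvent, expressed through the defect of `m ∘ R z`. -/
lemma one_sub_map_inverse (h : RenewalResolvent μ φ m e R) {s : ℝ} {z : ℂ} (hz : ‖z‖ ≤ 1)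
    (hA : IsUnit (1 - (s : ℂ) • R z + m.smulRight e)) {x : B}
    (hx : x = Ring.inverse (1 - (s : ℂ) • R z + m.smulRight e) e) :
    1 - m x = (1 - s) * m x + s * ((∫ y, (1 - z ^ φ y) ∂μ) + (m (x - e) - m (R z (x - e)))) := by
  have h1 : (1 - (s : ℂ) • R z + m.smulRight e) x = e := by
    rw [hx, ← mul_apply_eq_comp, Ring.mul_inverse_cancel _ hA]
    rfl
  have h2 := congrArg m h1
  simp only [add_apply, sub_apply,
    one_apply_eq_self, smul_apply,
    ContinuousLinearMap.smulRight_apply, map_add, map_sub, map_smul, h.map_e, smul_eq_mul,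
    mul_one] at h2
  rw [← h.defect_e z hz]
  simp only [map_sub]
  linear_combination -h2

lemma resolvent_formula {s : ℝ} {z : ℂ}
    (hA : IsUnit (1 - (s : ℂ) • R z + m.smulRight e))
    (hδ : 1 - m (Ring.inverse (1 - (s : ℂ) • R z + m.smulRight e) e) ≠ 0) :
    IsUnit (1 - (s : ℂ) • R z) ∧ Ring.inverse (1 - (s : ℂ) • R z) =
      Ring.inverse (1 - (s : ℂ) • R z + m.smulRight e) +
      (1 - m (Ring.inverse (1 - (s : ℂ) • R z + m.smulRight e) e))⁻¹ •
        (Ring.inverse (1 - (s : ℂ) • R z + m.smulRight e) * m.smulRight e *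
          Ring.inverse (1 - (s : ℂ) • R z + m.smulRight e)) := by
  have := inverse_sub_smulRight m e hA hδ
  rwa [add_sub_cancel_right] at this

/-- Bound on the resolvent near the singularity. -/
lemma eventually_norm_inverse_le [IsProbabilityMeasure μ] [CompleteSpace B]
    (h : RenewalResolvent μ φ m e R) (hφ : Measurable φ)
    (hp : RegularTail (tailFun μ φ) β) (hβ0 : 0 < β) (hβ1 : β < 1) :
    ∃ M : ℝ, 0 < M ∧ ∀ᶠ q : ℝ × ℂ in 𝓝 (1, 0), q.1 ≤ 1 → 0 ≤ q.2.re → q.2 ≠ 0 →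
      IsUnit (1 - (q.1 : ℂ) • R (Complex.exp (-q.2))) ∧
      ‖Ring.inverse (1 - (q.1 : ℂ) • R (Complex.exp (-q.2)))‖ ≤ M / tailFun μ φ (1 / ‖q.2‖) := by
  obtain ⟨C, hC, hup⟩ := integral_norm_one_sub_cexp_le hφ hp hβ0 hβ1
  obtain ⟨c, w₀, hc, hw₀, hlo⟩ := le_re_integral_one_sub_cexp hφ hp hβ0
  set P := m.smulRight e with hP
  set X₀ := Ring.inverse (1 - R 1 + P) with hX₀
  set K := ‖X₀‖ + 1 with hK
  have hK0 : 0 < K := by positivity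
  obtain ⟨η, hη0, hη1, hη2⟩ : ∃ η : ℝ, 0 < η ∧ η * C ≤ c / 2 ∧ ‖m‖ * η ≤ 1 := by
    refine ⟨min (c / (2 * C)) (1 / (‖m‖ + 1)), by positivity, ?_, ?_⟩
    · calc _ ≤ c / (2 * C) * C := by gcongr; exact min_le_left _ _
        _ = c / 2 := by field_simp
    · calc _ ≤ ‖m‖ * (1 / (‖m‖ + 1)) := by gcongr; exact min_le_right _ _
        _ ≤ 1 := by rw [mul_one_div, div_le_one (by positivity)]; linarith
  refine ⟨K + 4 / c * (K * ‖P‖ * K), by positivity, ?_⟩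
  have e1 := h.tendsto_regularized.eventually (Units.isOpen.mem_nhds h.isUnit_one)
  have e2 := h.tendsto_inverse_regularized.norm.eventually (gt_mem_nhds (lt_add_one _))
  have e3 : ∀ᶠ q : ℝ × ℂ in 𝓝[{q | 0 ≤ q.2.re}] (1, 0),
      ‖Ring.inverse (1 - (q.1 : ℂ) • R (Complex.exp (-q.2)) + P) e - e‖ < η := by
    have h1 : Tendsto (fun q : ℝ × ℂ =>
        Ring.inverse (1 - (q.1 : ℂ) • R (Complex.exp (-q.2)) + P) e)
        (𝓝[{q | 0 ≤ q.2.re}] (1, 0)) (𝓝 e) := by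
      have := ((ContinuousLinearMap.apply ℂ B e).continuous.tendsto _).comp
        h.tendsto_inverse_regularized
      simp only [ContinuousLinearMap.apply_apply, h.inverse_one_e] at this
      exact this
    have := (tendsto_iff_norm_sub_tendsto_zero.1 h1).eventually (gt_mem_nhds hη0)
    exact this
  have e4 : ∀ᶠ q : ℝ × ℂ in 𝓝 (1, 0), 1 / 2 < q.1 ∧ ‖q.2‖ < w₀ := by
    refine (continuous_fst.tendsto _).eventually (lt_mem_nhds (by norm_num)) |>.and ?_
    have : Tendsto (fun q : ℝ × ℂ => ‖q.2‖) (𝓝 (1, 0)) (𝓝 0) := by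
      simpa using (continuous_snd.norm.tendsto ((1 : ℝ), (0 : ℂ)))
    exact this.eventually (gt_mem_nhds hw₀)
  rw [eventually_nhdsWithin_iff] at e1 e2 e3
  filter_upwards [e1, e2, e3, e4] with q h1 h2 h3 h4 hq1 hq2 hq3
  have hA : IsUnit (1 - (q.1 : ℂ) • R (Complex.exp (-q.2)) + P) := h1 hq2
  replace h2 := (h2 hq2).le
  replace h3 := (h3 hq2).le
  set X := Ring.inverse (1 - (q.1 : ℂ) • R (Complex.exp (-q.2)) + P) with hX
  have hz := norm_exp_neg_le_one hq2
  set t := tailFun μ φ (1 / ‖q.2‖) with ht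
  have ht0 : 0 < t := hp.pos _
  have hδre : c / 4 * t ≤ (1 - m (X e)).re := by
    rw [h.one_sub_map_inverse hz hA rfl]
    have hdef := h.defect_le _ hz (X e - e)
    simp_rw [exp_neg_pow] at hdef ⊢
    have hb1 : ‖m (X e - e) - m (R (Complex.exp (-q.2)) (X e - e))‖ ≤ c / 2 * t := by
      refine hdef.trans ?_
      calc _ ≤ η * (C * t) := mul_le_mul h3 (hup _ hq2 hq3)
            (integral_nonneg fun _ => norm_nonneg _) hη0.le
        _ = η * C * t := by ring
        _ ≤ _ := by gcongr
    have hb2 := (abs_le.1 ((Complex.abs_re_le_norm _).trans hb1)).1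
    have hb3 := hlo q.2 hq2 hq3 h4.2.le
    have hb4 : 0 ≤ (m (X e)).re := by
      have h5 : ‖m (X e - e)‖ ≤ 1 :=
        (m.le_opNorm _).trans ((mul_le_mul_of_nonneg_left h3 (norm_nonneg _)).trans hη2)
      have h6 := (abs_le.1 ((Complex.abs_re_le_norm _).trans h5)).1
      rw [map_sub, h.map_e, Complex.sub_re, Complex.one_re] at h6
      linarith
    have hre : ∀ a b : ℂ, ((1 - (q.1 : ℂ)) * a + (q.1 : ℂ) * b).re =
        (1 - q.1) * a.re + q.1 * b.re := fun a b => by simp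
    rw [hre, Complex.add_re]
    have hb5 : 0 ≤ (1 - q.1) * (m (X e)).re := mul_nonneg (by linarith) hb4
    have hct : 0 < c * t := by positivity
    nlinarith [h4.1]
  have hδn : c / 4 * t ≤ ‖1 - m (X e)‖ := hδre.trans (Complex.re_le_norm _)
  have hδ0 : 1 - m (X e) ≠ 0 := by
    intro h0
    rw [h0, norm_zero] at hδn
    have : 0 < c / 4 * t := by positivity
    linarith
  obtain ⟨hu, hf⟩ := resolvent_formula hA hδ0
  refine ⟨hu, ?_⟩
  rw [hf]
  refine (norm_add_le _ _).trans ?_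
  rw [norm_smul, norm_inv]
  have hXPX : ‖X * P * X‖ ≤ K * ‖P‖ * K := by
    refine (norm_mul_le _ _).trans (mul_le_mul ((norm_mul_le _ _).trans ?_) h2 (norm_nonneg _)
      (by positivity))
    gcongr
  have hinv : ‖1 - m (X e)‖⁻¹ ≤ 4 / c * t⁻¹ := by
    rw [show 4 / c * t⁻¹ = (c / 4 * t)⁻¹ by field_simp]
    exact inv_anti₀ (by positivity) hδn
  have ht1 : 1 ≤ t⁻¹ := (one_le_inv₀ ht0).2 (hp.le_one _)
  calc _ ≤ K * t⁻¹ + 4 / c * t⁻¹ * (K * ‖P‖ * K) := by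
        refine add_le_add (h2.trans (le_mul_of_one_le_right hK0.le ht1)) ?_
        exact mul_le_mul hinv hXPX (norm_nonneg _) (by positivity)
    _ = _ := by rw [div_eq_mul_inv _ t]; ring

end RenewalResolvent

lemma RegularTail.tendsto_zero {p : ℝ → ℝ} {β : ℝ} (hp : RegularTail p β) (hβ0 : 0 < β) :
    Tendsto (fun n : ℕ => p n) atTop (𝓝 0) := by
  obtain ⟨C, hC, hpot⟩ := hp.potter_upper (α := β / 2) (by linarith) (by linarith)
  have h1 : Tendsto (fun n : ℕ => C * (n : ℝ) ^ (-(β / 2))) atTop (𝓝 0) := by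
    simpa using ((tendsto_rpow_neg_atTop (by linarith : 0 < β / 2)).comp
      tendsto_natCast_atTop_atTop).const_mul C
  refine squeeze_zero' (Eventually.of_forall fun n => (hp.pos n).le) ?_ h1
  filter_upwards [eventually_ge_atTop 1] with n hn
  have hn1 : (1 : ℝ) ≤ n := by exact_mod_cast hn
  refine (hpot 1 n (by norm_num) hn1).trans ?_
  rw [one_div, Real.inv_rpow (by positivity), ← Real.rpow_neg (by positivity)]
  exact mul_le_of_le_one_right (by positivity) (hp.le_one _)

namespace RenewalResolvent

variable {Y : Type*} [MeasurableSpace Y] {μ : Measure Y} [IsProbabilityMeasure μ] {φ : Y → ℕ}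
  {B : Type*} [NormedAddCommGroup B] [NormedSpace ℂ B] [CompleteSpace B]
  {m : B →L[ℂ] ℂ} {e : B} {R : ℂ → B →L[ℂ] B} {β : ℝ}

/-- Bound on the resolvent on the whole disc, uniformly for `s` close to `1`. -/
lemma exists_norm_inverse_le (h : RenewalResolvent μ φ m e R) (hφ : Measurable φ)
    (hp : RegularTail (tailFun μ φ) β) (hβ0 : 0 < β) (hβ1 : β < 1) :
    ∃ s₀ M : ℝ, s₀ < 1 ∧ 0 < M ∧ ∀ s : ℝ, s₀ ≤ s → s ≤ 1 →
      (∀ z : ℂ, ‖z‖ < 1 → IsUnit (1 - (s : ℂ) • R z)) ∧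
      ∀ w : ℂ, 0 ≤ w.re → w.re ≤ 1 → |w.im| ≤ Real.pi → w ≠ 0 →
        ‖Ring.inverse (1 - (s : ℂ) • R (Complex.exp (-w)))‖ ≤ M / tailFun μ φ (1 / ‖w‖) := by
  obtain ⟨M₁, hM₁, hev⟩ := h.eventually_norm_inverse_le hφ hp hβ0 hβ1
  obtain ⟨ε, hε, hball⟩ := Metric.eventually_nhds_iff.1 hev
  set K : Set ℂ := {w | 0 ≤ w.re ∧ w.re ≤ 1 ∧ |w.im| ≤ Real.pi ∧ ε / 2 ≤ ‖w‖} with hKdef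
  have hKcl : IsClosed K :=
    (isClosed_le continuous_const Complex.continuous_re).inter
      ((isClosed_le Complex.continuous_re continuous_const).inter
      ((isClosed_le Complex.continuous_im.abs continuous_const).inter
      (isClosed_le continuous_const continuous_norm)))
  have hK : IsCompact K := by
    refine Metric.isCompact_of_isClosed_isBounded hKcl
      (isBounded_iff_forall_norm_le.2 ⟨1 + Real.pi, fun w hw => ?_⟩)
    have := Complex.norm_le_abs_re_add_abs_im w
    rw [abs_of_nonneg hw.1] at this
    linarith [hw.2.1, hw.2.2.1]
  have hgc : ContinuousOn (fun w : ℂ => R (Complex.exp (-w))) K :=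
    h.cont.comp (by fun_prop) fun w hw => by
      rw [mem_closedBall_zero_iff]; exact norm_exp_neg_le_one hw.1
  obtain ⟨s₁, M₂, hs₁, hM₂, hcomp⟩ := exists_isUnit_one_sub_smul hK hgc fun w hw => by
    refine h.isUnit _ (norm_exp_neg_le_one hw.1) fun h1 => ?_
    obtain ⟨k, hk⟩ := Complex.exp_eq_one_iff.1 h1
    have him := congrArg Complex.im hk
    have hre := congrArg Complex.re hk
    simp at him hre
    have hk0 : k = 0 := by
      by_contra hk0
      have : (1 : ℝ) ≤ |(k : ℝ)| := by
        rw [← Int.cast_abs]; exact_mod_cast Int.one_le_abs hk0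
      have h2 : |w.im| = |(k : ℝ)| * (2 * Real.pi) := by
        rw [← abs_neg, him, abs_mul, abs_of_pos Real.two_pi_pos]
      have h3 := hw.2.2.1
      rw [h2] at h3
      nlinarith [Real.pi_pos]
    have hw0 : w = 0 := Complex.ext hre (by rw [hk0] at him; simpa using him)
    have h4 := hw.2.2.2
    rw [hw0, norm_zero] at h4
    linarith
  obtain ⟨s₂, M₃, hs₂, hM₃, hcomp0⟩ := exists_isUnit_one_sub_smul
    (isCompact_closedBall (0 : ℂ) (Real.exp (-1))) (g := R)
    (h.cont.mono (Metric.closedBall_subset_closedBall (Real.exp_le_one_iff.2 (by norm_num))))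
    (fun z hz => by
      rw [mem_closedBall_zero_iff] at hz
      have h1 : Real.exp (-1) < 1 := by simp
      refine h.isUnit z (by linarith) ?_
      rintro rfl
      rw [norm_one] at hz
      linarith)
  have hw : ∀ s : ℝ, max (max s₁ s₂) (1 - ε / 2) ≤ s → s ≤ 1 →
      ∀ w : ℂ, 0 ≤ w.re → w.re ≤ 1 → |w.im| ≤ Real.pi → w ≠ 0 →
      IsUnit (1 - (s : ℂ) • R (Complex.exp (-w))) ∧
      ‖Ring.inverse (1 - (s : ℂ) • R (Complex.exp (-w)))‖ ≤
        (M₁ + M₂) / tailFun μ φ (1 / ‖w‖) := by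
    intro s hs hs1 w hw1 hw2 hw3 hw4
    have ht := hp.pos (1 / ‖w‖)
    rcases le_or_gt (ε / 2) ‖w‖ with hεw | hεw
    · have h1 := hcomp s ((le_max_left _ _).trans ((le_max_left _ _).trans hs)) hs1 w
        ⟨hw1, hw2, hw3, hεw⟩
      refine ⟨h1.1, h1.2.trans ?_⟩
      rw [le_div_iff₀ ht]
      nlinarith [hp.le_one (1 / ‖w‖)]
    · have hd : dist (s, w) ((1 : ℝ), (0 : ℂ)) < ε := by
        rw [Prod.dist_eq, max_lt_iff]
        have := (le_max_right _ _).trans hs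
        constructor
        · simp only [Real.dist_eq]
          rw [abs_sub_lt_iff]
          constructor <;> linarith
        · simp only [dist_zero_right]; linarith
      have h1 := hball hd hs1 hw1 hw4
      refine ⟨h1.1, h1.2.trans ?_⟩
      gcongr
      linarith
  refine ⟨max (max s₁ s₂) (1 - ε / 2), M₁ + M₂, max_lt (max_lt hs₁ hs₂) (by linarith),
    by positivity, fun s hs hs1 => ⟨fun z hz => ?_, fun w h1 h2 h3 h4 => (hw s hs hs1 w h1 h2 h3 h4).2⟩⟩
  rcases le_or_gt ‖z‖ (Real.exp (-1)) with hz1 | hz1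
  · exact (hcomp0 s ((le_max_right _ _).trans ((le_max_left _ _).trans hs)) hs1 z (by
      rwa [mem_closedBall_zero_iff])).1
  · have hz0 : z ≠ 0 := by
      rintro rfl
      rw [norm_zero] at hz1
      exact absurd hz1 (Real.exp_pos _).le.not_gt
    have hlog : Real.log ‖z‖ < 0 := Real.log_neg (norm_pos_iff.2 hz0) hz
    have hlog2 : -1 < Real.log ‖z‖ := by rwa [Real.lt_log_iff_exp_lt (norm_pos_iff.2 hz0)]
    have h1 := (hw s hs hs1 (-Complex.log z) (by simp [Complex.log_re]; linarith)
      (by simp [Complex.log_re]; linarith)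
      (by simpa [Complex.log_im] using Complex.abs_arg_le_pi z) (by
        intro h0
        have := congrArg Complex.re h0
        simp [Complex.log_re] at this
        rcases this with h | h | h
        · exact hz0 h
        · exact hz.ne h
        · linarith [norm_nonneg z])).1
    rwa [neg_neg, Complex.exp_log hz0] at h1

/-- Asymptotics of the resolvent at the scale `n`. -/
lemma tendsto_smul_inverse (h : RenewalResolvent μ φ m e R) (hφ : Measurable φ)
    (hp : RegularTail (tailFun μ φ) β) (hβ0 : 0 < β) (hβ1 : β < 1) {u : ℂ} (hu : 0 < u.re)
    {κ : ℝ} (hκ : 0 ≤ κ) :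
    Tendsto (fun n : ℕ => (tailFun μ φ n : ℂ) •
        Ring.inverse (1 - ((1 - κ * tailFun μ φ n : ℝ) : ℂ) • R (Complex.exp (-(u / n)))))
      atTop (𝓝 ((κ + (Real.Gamma (1 - β) : ℂ) * u ^ (β : ℂ))⁻¹ • m.smulRight e)) := by
  set p := tailFun μ φ with hpdef
  set P := m.smulRight e with hP
  set s : ℕ → ℝ := fun n => 1 - κ * p n with hs
  set z : ℕ → ℂ := fun n => Complex.exp (-(u / n)) with hz
  set A : ℕ → B →L[ℂ] B := fun n => 1 - (s n : ℂ) • R (z n) + P with hA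
  set X : ℕ → B →L[ℂ] B := fun n => Ring.inverse (A n) with hX
  have hu0 : u ≠ 0 := by rintro rfl; simp at hu
  have hp0 := hp.tendsto_zero hβ0
  have hs1 : Tendsto s atTop (𝓝 1) := by simpa using (hp0.const_mul κ).const_sub 1
  have hun : Tendsto (fun n : ℕ => u / n) atTop (𝓝 0) := tendsto_const_div_atTop_nhds_zero_nat u
  have hun_re : ∀ n : ℕ, 0 ≤ (u / n).re := fun n => by
    rw [Complex.div_natCast_re]; positivity
  obtain ⟨hAlim, hXlim⟩ := h.tendsto_regularized_seq hs1 hun hun_re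
  change Tendsto A atTop (𝓝 (1 - R 1 + P)) at hAlim
  change Tendsto X atTop (𝓝 (Ring.inverse (1 - R 1 + P))) at hXlim
  have hAunit : ∀ᶠ n in atTop, IsUnit (A n) :=
    hAlim.eventually (Units.isOpen.mem_nhds h.isUnit_one)
  have hXe : Tendsto (fun n => X n e) atTop (𝓝 e) := by
    have := ((ContinuousLinearMap.apply ℂ B e).continuous.tendsto _).comp hXlim
    simp only [ContinuousLinearMap.apply_apply, hP, h.inverse_one_e] at this
    exact this
  have hmX : Tendsto (fun n => m (X n e)) atTop (𝓝 1) := by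
    have := (m.continuous.tendsto e).comp hXe
    rwa [h.map_e] at this
  obtain ⟨C, hC, hup⟩ := integral_norm_one_sub_cexp_le hφ hp hβ0 hβ1
  set D : ℕ → ℂ := fun n => m (X n e - e) - m (R (z n) (X n e - e)) with hD
  have hDlim : Tendsto (fun n : ℕ => D n / (p n : ℂ)) atTop (𝓝 0) := by
    have hr : Tendsto (fun n : ℕ => p (‖u‖⁻¹ * n) / p n) atTop (𝓝 (‖u‖⁻¹ ^ (-β))) :=
      (hp.ratio (inv_pos.2 (norm_pos_iff.2 hu0))).comp tendsto_natCast_atTop_atTop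
    have hb : Tendsto (fun n : ℕ => ‖X n e - e‖ * (C * (p (‖u‖⁻¹ * n) / p n))) atTop (𝓝 0) := by
      have := (tendsto_iff_norm_sub_tendsto_zero.1 hXe).mul (hr.const_mul C)
      rwa [zero_mul] at this
    refine squeeze_zero_norm' ?_ hb
    filter_upwards [eventually_ge_atTop 1] with n hn
    have hn0 : (0 : ℝ) < n := by exact_mod_cast hn
    have hnc : (n : ℂ) ≠ 0 := by exact_mod_cast hn0.ne'
    have h1 := h.defect_le (z n) (norm_exp_neg_le_one (hun_re n)) (X n e - e)
    have h2 := hup (u / n) (hun_re n) (div_ne_zero hu0 hnc)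
    simp_rw [hz, exp_neg_pow] at h1
    have h3 : 1 / ‖u / n‖ = ‖u‖⁻¹ * n := by
      rw [norm_div, Complex.norm_natCast]; field_simp
    rw [h3] at h2
    rw [norm_div, Complex.norm_real, Real.norm_of_nonneg (hp.pos _).le, div_le_iff₀ (hp.pos _)]
    refine h1.trans ?_
    calc _ ≤ ‖X n e - e‖ * (C * p (‖u‖⁻¹ * n)) := by gcongr
      _ = _ := by
        have := (hp.pos n).ne'
        field_simp
  have hE := tendsto_integral_one_sub_cexp hφ hp hβ0 hβ1 hu
  set L := (κ : ℂ) + (Real.Gamma (1 - β) : ℂ) * u ^ (β : ℂ) with hL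
  have hL0 : L ≠ 0 := by
    intro h0
    have h1 := congrArg Complex.re h0
    rw [hL, Complex.add_re, Complex.re_ofReal_mul, Complex.ofReal_re, Complex.zero_re] at h1
    have h2 := mul_pos (Real.Gamma_pos_of_pos (by linarith : 0 < 1 - β))
      (Complex.re_cpow_pos hu hβ0 hβ1)
    linarith
  have hδ : Tendsto (fun n : ℕ => (1 - m (X n e)) / (p n : ℂ)) atTop (𝓝 L) := by
    have hsc : Tendsto (fun n => (s n : ℂ)) atTop (𝓝 1) := by
      have := (Complex.continuous_ofReal.tendsto 1).comp hs1
      rwa [Complex.ofReal_one] at this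
    have h1 := (hmX.const_mul (κ : ℂ)).add (hsc.mul (hE.add hDlim))
    rw [add_zero, mul_one, one_mul] at h1
    refine h1.congr' ?_
    filter_upwards [hAunit] with n hn
    have hone := h.one_sub_map_inverse (x := X n e) (norm_exp_neg_le_one (hun_re n)) hn rfl
    simp_rw [exp_neg_pow] at hone
    rw [hone]
    have hpn : (p n : ℂ) ≠ 0 := by exact_mod_cast (hp.pos n).ne'
    have hsn : 1 - (s n : ℂ) = κ * p n := by simp [hs]
    change _ = ((1 - (s n : ℂ)) * m (X n e) + (s n : ℂ) * ((∫ y, (1 -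
      Complex.exp (-(u / n) * φ y)) ∂μ) + D n)) / (p n : ℂ)
    rw [hsn, ← hpdef]
    field_simp
  have hfin := (((Complex.continuous_ofReal.tendsto 0).comp hp0).smul hXlim).add
    ((hδ.inv₀ hL0).smul ((hXlim.mul_const P).mul hXlim))
  have hPP : Ring.inverse (1 - R 1 + P) * P * Ring.inverse (1 - R 1 + P) = P := by
    ext v
    simp [hP, h.map_inverse_one, h.inverse_one_e]
  rw [hPP, Complex.ofReal_zero, zero_smul, zero_add] at hfin
  refine hfin.congr' ?_
  filter_upwards [hAunit, hδ.eventually_ne hL0] with n hn hδn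
  have hpn : (p n : ℂ) ≠ 0 := by exact_mod_cast (hp.pos n).ne'
  have hδ0 : 1 - m (X n e) ≠ 0 := fun h0 => hδn (by rw [h0, zero_div])
  rw [(resolvent_formula hn hδ0).2, smul_add, smul_smul, inv_div, div_eq_mul_inv]
  rfl

end RenewalResolvent

section Coeffs

variable {𝔸 : Type*} [NormedRing 𝔸] [NormedAlgebra ℂ 𝔸]

/-- `f` is given on the open unit disc by the absolutely convergent power series with
coefficients `a`. -/
def HasCoeffs (f : ℂ → 𝔸) (a : ℕ → 𝔸) : Prop :=
  ∀ z : ℂ, ‖z‖ < 1 → Summable (fun k => ‖z ^ k • a k‖) ∧ HasSum (fun k => z ^ k • a k) (f z)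

namespace HasCoeffs

variable {f g : ℂ → 𝔸} {a b : ℕ → 𝔸}

lemma congr (hf : HasCoeffs f a) (h : ∀ z : ℂ, ‖z‖ < 1 → f z = g z) : HasCoeffs g a :=
  fun z hz => ⟨(hf z hz).1, h z hz ▸ (hf z hz).2⟩

lemma one : HasCoeffs (fun _ => (1 : 𝔸)) (fun k => if k = 0 then 1 else 0) := by
  intro z _
  have h : ∀ k, k ≠ 0 → z ^ k • (if k = 0 then (1 : 𝔸) else 0) = 0 := fun k hk => by simp [hk]
  refine ⟨summable_of_ne_finset_zero (s := {0}) fun k hk => ?_, ?_⟩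
  · rw [h k (by simpa using hk), norm_zero]
  · simpa using hasSum_single 0 h

lemma zero : HasCoeffs (fun _ => (0 : 𝔸)) (fun _ => 0) := fun z _ => by
  simp [summable_zero, hasSum_zero]

lemma add (hf : HasCoeffs f a) (hg : HasCoeffs g b) :
    HasCoeffs (fun z => f z + g z) (fun k => a k + b k) := by
  intro z hz
  simp only [smul_add]
  refine ⟨Summable.of_nonneg_of_le (fun _ => norm_nonneg _) (fun _ => norm_add_le _ _)
    ((hf z hz).1.add (hg z hz).1), (hf z hz).2.add (hg z hz).2⟩

lemma smul (hf : HasCoeffs f a) (c : ℂ) : HasCoeffs (fun z => c • f z) (fun k => c • a k) := by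
  intro z hz
  simp only [smul_comm _ c, norm_smul c]
  exact ⟨(hf z hz).1.mul_left _, (hf z hz).2.const_smul c⟩

lemma mul [CompleteSpace 𝔸] (hf : HasCoeffs f a) (hg : HasCoeffs g b) :
    HasCoeffs (fun z => f z * g z)
      (fun k => ∑ q ∈ Finset.HasAntidiagonal.antidiagonal k, a q.1 * b q.2) := by
  intro z hz
  have h : ∀ k, z ^ k • ∑ q ∈ Finset.HasAntidiagonal.antidiagonal k, a q.1 * b q.2 =
      ∑ q ∈ Finset.HasAntidiagonal.antidiagonal k, (z ^ q.1 • a q.1) * (z ^ q.2 • b q.2) := by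
    intro k
    rw [Finset.smul_sum]
    refine Finset.sum_congr rfl fun q hq => ?_
    rw [smul_mul_smul_comm, ← pow_add, Finset.HasAntidiagonal.mem_antidiagonal.1 hq]
  simp only [h]
  have hs := summable_norm_sum_mul_antidiagonal_of_summable_norm (hf z hz).1 (hg z hz).1
  refine ⟨hs, ?_⟩
  rw [← (hf z hz).2.tsum_eq, ← (hg z hz).2.tsum_eq,
    tsum_mul_tsum_eq_tsum_sum_antidiagonal_of_summable_norm (hf z hz).1 (hg z hz).1]
  exact hs.of_norm.hasSum

lemma exists_of_differentiableOn [CompleteSpace 𝔸]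
    (hf : DifferentiableOn ℂ f (Metric.ball 0 1)) : ∃ a, HasCoeffs f a := by
  refine ⟨fun n => (n.factorial : ℂ)⁻¹ • iteratedDeriv n f 0, fun z hz => ?_⟩
  have hsum : ∀ z : ℂ, ‖z‖ < 1 →
      HasSum (fun n => z ^ n • (n.factorial : ℂ)⁻¹ • iteratedDeriv n f 0) (f z) := by
    intro z hz
    have := Complex.hasSum_taylorSeries_on_ball hf (mem_ball_zero_iff.2 hz)
    simp only [sub_zero] at this
    refine this.congr_fun fun n => ?_
    rw [smul_comm]
  refine ⟨?_, hsum z hz⟩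
  obtain ⟨r, hzr, hr1⟩ := exists_between hz
  have hr0 : 0 < r := (norm_nonneg z).trans_lt hzr
  have hr := (hsum (r : ℂ) (by rwa [Complex.norm_real, Real.norm_of_nonneg hr0.le])).summable
  obtain ⟨M, hM⟩ := (hr.tendsto_atTop_zero.norm).bddAbove_range
  have hq : ‖z‖ / r < 1 := (div_lt_one hr0).2 hzr
  refine Summable.of_nonneg_of_le (fun _ => norm_nonneg _) (fun n => ?_)
    ((summable_geometric_of_lt_one (by positivity) hq).mul_left M)
  have h1 : ‖(r : ℂ) ^ n • (n.factorial : ℂ)⁻¹ • iteratedDeriv n f 0‖ ≤ M := hM ⟨n, rfl⟩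
  rw [norm_smul, norm_pow, Complex.norm_real, Real.norm_of_nonneg hr0.le] at h1
  rw [norm_smul, norm_pow, div_pow, mul_div_assoc', le_div_iff₀ (by positivity)]
  calc _ = ‖z‖ ^ n * (r ^ n * ‖(n.factorial : ℂ)⁻¹ • iteratedDeriv n f 0‖) := by ring
    _ ≤ ‖z‖ ^ n * M := by gcongr
    _ = _ := mul_comm _ _

lemma integral_cexp_int_mul (j : ℤ) :
    ∫ θ in (-Real.pi)..Real.pi, Complex.exp (j * Complex.I * θ) =
      if j = 0 then (2 * Real.pi : ℂ) else 0 := by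
  split_ifs with hj
  · subst hj
    simp
    ring
  · have hc : (j : ℂ) * Complex.I ≠ 0 := mul_ne_zero (by exact_mod_cast hj) Complex.I_ne_zero
    rw [integral_exp_mul_complex hc]
    have : Complex.exp (j * Complex.I * (Real.pi : ℝ)) =
        Complex.exp (j * Complex.I * ((-Real.pi : ℝ) : ℂ)) := by
      rw [Complex.exp_eq_exp_iff_exists_int]
      exact ⟨j, by push_cast; ring⟩
    rw [this, sub_self, zero_div]

/-- Cauchy's formula for the coefficients. -/
lemma eq_integral [CompleteSpace 𝔸] (hf : HasCoeffs f a) {r : ℝ} (hr0 : 0 < r) (hr1 : r < 1)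
    (n : ℕ) :
    ∫ θ in (-Real.pi)..Real.pi, Complex.exp (-n * Complex.I * θ) •
      f (r * Complex.exp (Complex.I * θ)) = (2 * Real.pi * r ^ n : ℂ) • a n := by
  have hz : ∀ θ : ℝ, ‖(r : ℂ) * Complex.exp (Complex.I * θ)‖ = r := fun θ => by
    rw [norm_mul, mul_comm Complex.I, Complex.norm_exp_ofReal_mul_I, mul_one, Complex.norm_real,
      Real.norm_of_nonneg hr0.le]
  have hnorm1 : ∀ θ : ℝ, ‖Complex.exp (-n * Complex.I * θ)‖ = 1 := fun θ => by
    rw [Complex.norm_exp]; simp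
  have hterm : ∀ (k : ℕ) (θ : ℝ), Complex.exp (-n * Complex.I * θ) •
      ((r : ℂ) * Complex.exp (Complex.I * θ)) ^ k • a k =
      Complex.exp (((k - n : ℤ) : ℂ) * Complex.I * θ) • ((r : ℂ) ^ k • a k) := by
    intro k θ
    rw [smul_smul, smul_smul, mul_pow, ← Complex.exp_nat_mul]
    have : Complex.exp (((k - n : ℤ) : ℂ) * Complex.I * θ) =
        Complex.exp (-n * Complex.I * θ) * Complex.exp (k * (Complex.I * θ)) := by
      rw [← Complex.exp_add]
      congr 1
      push_cast
      ring
    rw [this]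
    congr 1
    ring
  have hsum := intervalIntegral.hasSum_integral_of_dominated_convergence
    (μ := volume) (a := -Real.pi) (b := Real.pi)
    (F := fun (k : ℕ) (θ : ℝ) => Complex.exp (-n * Complex.I * θ) •
      ((r : ℂ) * Complex.exp (Complex.I * θ)) ^ k • a k)
    (f := fun θ => Complex.exp (-n * Complex.I * θ) • f (r * Complex.exp (Complex.I * θ)))
    (fun k _ => ‖(r : ℂ) ^ k • a k‖)
    (fun k => by
      have : Continuous fun θ : ℝ => Complex.exp (-n * Complex.I * θ) •
        ((r : ℂ) * Complex.exp (Complex.I * θ)) ^ k • a k := by fun_prop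
      exact this.aestronglyMeasurable)
    (fun k => Eventually.of_forall fun θ _ => by
      rw [norm_smul, hnorm1, one_mul, norm_smul, norm_smul, norm_pow, norm_pow, hz,
        Complex.norm_real, Real.norm_of_nonneg hr0.le])
    (Eventually.of_forall fun θ _ =>
      (hf (r : ℂ) (by rwa [Complex.norm_real, Real.norm_of_nonneg hr0.le])).1)
    (by simp)
    (Eventually.of_forall fun θ _ => (hf _ (by rw [hz]; exact hr1)).2.const_smul _)
  have hval : ∀ k : ℕ, ∫ θ in (-Real.pi)..Real.pi, Complex.exp (-n * Complex.I * θ) •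
      ((r : ℂ) * Complex.exp (Complex.I * θ)) ^ k • a k =
      if k = n then (2 * Real.pi * r ^ n : ℂ) • a n else 0 := by
    intro k
    simp_rw [hterm]
    rw [intervalIntegral.integral_smul_const, integral_cexp_int_mul]
    by_cases hk : k = n
    · subst hk
      simp [smul_smul]
    · have : ((k : ℤ) - n) ≠ 0 := by omega
      simp [hk, this]
  simp_rw [hval] at hsum
  exact hsum.unique (by simpa using hasSum_ite_eq n ((2 * Real.pi * r ^ n : ℂ) • a n))

lemma unique [CompleteSpace 𝔸] (hf : HasCoeffs f a) (hf' : HasCoeffs f b) : a = b := by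
  ext n
  have h := (hf.eq_integral (r := 1 / 2) (by norm_num) (by norm_num) n).symm.trans
    (hf'.eq_integral (by norm_num) (by norm_num) n)
  refine smul_right_injective _ ?_ h
  have := Real.pi_pos.ne'
  simp [this]

end HasCoeffs

/-- `f` is given on the open unit disc by a power series with coefficients in `Q`. -/
def HasCoeffsIn (Q : Subsemiring 𝔸) (f : ℂ → 𝔸) : Prop :=
  ∃ a, HasCoeffs f a ∧ ∀ k, a k ∈ Q

namespace HasCoeffsIn

variable {Q : Subsemiring 𝔸} {f g : ℂ → 𝔸}

lemma one : HasCoeffsIn Q (fun _ => (1 : 𝔸)) :=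
  ⟨_, HasCoeffs.one, fun k => by split_ifs; exacts [Q.one_mem, Q.zero_mem]⟩

lemma add (hf : HasCoeffsIn Q f) (hg : HasCoeffsIn Q g) : HasCoeffsIn Q (fun z => f z + g z) := by
  obtain ⟨a, ha, ha'⟩ := hf
  obtain ⟨b, hb, hb'⟩ := hg
  exact ⟨_, ha.add hb, fun k => Q.add_mem (ha' k) (hb' k)⟩

lemma mul [CompleteSpace 𝔸] (hf : HasCoeffsIn Q f) (hg : HasCoeffsIn Q g) :
    HasCoeffsIn Q (fun z => f z * g z) := by
  obtain ⟨a, ha, ha'⟩ := hf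
  obtain ⟨b, hb, hb'⟩ := hg
  exact ⟨_, ha.mul hb, fun k => Q.sum_mem fun q _ => Q.mul_mem (ha' _) (hb' _)⟩

lemma smul (hQ : ∀ (c : ℝ) (x : 𝔸), 0 ≤ c → x ∈ Q → (c : ℂ) • x ∈ Q) (hf : HasCoeffsIn Q f)
    {c : ℝ} (hc : 0 ≤ c) : HasCoeffsIn Q (fun z => (c : ℂ) • f z) := by
  obtain ⟨a, ha, ha'⟩ := hf
  exact ⟨_, ha.smul c, fun k => hQ c _ hc (ha' k)⟩

lemma pow [CompleteSpace 𝔸] (hf : HasCoeffsIn Q f) (k : ℕ) : HasCoeffsIn Q (fun z => f z ^ k) := by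
  induction k with
  | zero => simpa using one
  | succ k ih => simpa only [pow_succ] using ih.mul hf

lemma geom_sum [CompleteSpace 𝔸] (hf : HasCoeffsIn Q f) (k : ℕ) :
    HasCoeffsIn Q (fun z => ∑ i ∈ Finset.range k, f z ^ i) := by
  induction k with
  | zero => exact ⟨_, by simpa using HasCoeffs.zero, fun k => Q.zero_mem⟩
  | succ k ih => simpa only [Finset.sum_range_succ] using ih.add (hf.pow k)

end HasCoeffsIn

variable [CompleteSpace 𝔸]

lemma differentiableOn_inverse_one_sub_smul {R : ℂ → 𝔸}
    (hd : DifferentiableOn ℂ R (Metric.ball 0 1)) {s : ℂ}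
    (hu : ∀ z : ℂ, ‖z‖ < 1 → IsUnit (1 - s • R z)) :
    DifferentiableOn ℂ (fun z => Ring.inverse (1 - s • R z)) (Metric.ball 0 1) := by
  intro z hz
  have h1 : DifferentiableAt ℂ R z := hd.differentiableAt (Metric.isOpen_ball.mem_nhds hz)
  have h2 : DifferentiableAt ℂ (fun z => 1 - s • R z) z :=
    (differentiableAt_const _).sub (h1.const_smul s)
  exact (h2.inverse (hu z (mem_ball_zero_iff.1 hz))).differentiableWithinAt

/-- The coefficients of `(1 - s R)⁻¹` satisfy the renewal equation. -/
lemma exists_hasCoeffs_inverse {R : ℂ → 𝔸} {ρ : ℕ → 𝔸} (hR : HasCoeffs R ρ)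
    (hd : DifferentiableOn ℂ R (Metric.ball 0 1)) {s : ℂ}
    (hu : ∀ z : ℂ, ‖z‖ < 1 → IsUnit (1 - s • R z)) :
    ∃ a, HasCoeffs (fun z => Ring.inverse (1 - s • R z)) a ∧
      ∀ n, a n = (if n = 0 then 1 else 0) + s • ∑ q ∈ Finset.HasAntidiagonal.antidiagonal n, a q.1 * ρ q.2 := by
  obtain ⟨a, ha⟩ := HasCoeffs.exists_of_differentiableOn (differentiableOn_inverse_one_sub_smul hd hu)
  refine ⟨a, ha, fun n => ?_⟩
  have h3 := HasCoeffs.one.add ((ha.mul hR).smul s)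
  have h4 := ha.unique (h3.congr fun z hz => ?_)
  · exact congrFun h4 n
  · have h5 := Ring.inverse_mul_cancel _ (hu z hz)
    rw [mul_sub, mul_one, mul_smul_comm] at h5
    exact (sub_eq_iff_eq_add.1 h5).symm

lemma hasCoeffsIn_inverse {Q : Subsemiring 𝔸}
    (hQ : ∀ (c : ℝ) (x : 𝔸), 0 ≤ c → x ∈ Q → (c : ℂ) • x ∈ Q)
    {R : ℂ → 𝔸} {ρ : ℕ → 𝔸} (hR : HasCoeffs R ρ) (hρ0 : ρ 0 = 0) (hρ : ∀ n, ρ n ∈ Q)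
    (hd : DifferentiableOn ℂ R (Metric.ball 0 1)) {s : ℝ} (hs : 0 ≤ s)
    (hu : ∀ z : ℂ, ‖z‖ < 1 → IsUnit (1 - (s : ℂ) • R z)) :
    HasCoeffsIn Q (fun z => Ring.inverse (1 - (s : ℂ) • R z)) := by
  obtain ⟨a, ha, hrec⟩ := exists_hasCoeffs_inverse hR hd hu
  refine ⟨a, ha, fun n => ?_⟩
  induction n using Nat.strong_induction_on with
  | _ n ih =>
    rw [hrec n]
    refine Q.add_mem (by split_ifs; exacts [Q.one_mem, Q.zero_mem]) (hQ s _ hs ?_)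
    refine Q.sum_mem fun q hq => ?_
    rcases Nat.eq_zero_or_pos q.2 with h0 | h0
    · rw [h0, hρ0, mul_zero]; exact Q.zero_mem
    · have := Finset.HasAntidiagonal.mem_antidiagonal.1 hq
      exact Q.mul_mem (ih _ (by omega)) (hρ _)

/-- Damping the resolvent `(1 - R)⁻¹` by a power of `(1 - s) (1 - s R)⁻¹` decreases the
coefficients. -/
lemma exists_hasCoeffs_damped {Q : Subsemiring 𝔸}
    (hQ : ∀ (c : ℝ) (x : 𝔸), 0 ≤ c → x ∈ Q → (c : ℂ) • x ∈ Q)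
    {R : ℂ → 𝔸} {ρ : ℕ → 𝔸} (hR : HasCoeffs R ρ) (hρ0 : ρ 0 = 0) (hρ : ∀ n, ρ n ∈ Q)
    (hd : DifferentiableOn ℂ R (Metric.ball 0 1)) {s : ℝ} (hs : 0 ≤ s) (hs1 : s ≤ 1)
    (hu : ∀ z : ℂ, ‖z‖ < 1 → IsUnit (1 - (s : ℂ) • R z))
    (hu1 : ∀ z : ℂ, ‖z‖ < 1 → IsUnit (1 - R z)) {t : ℕ → 𝔸}
    (ht : HasCoeffs (fun z => Ring.inverse (1 - R z)) t) (k : ℕ) :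
    ∃ g, HasCoeffs (fun z => Ring.inverse (1 - R z) *
        (((1 - s : ℝ) : ℂ) • Ring.inverse (1 - (s : ℂ) • R z)) ^ k) g ∧
      ∀ n, t n - g n ∈ Q := by
  have hU := hasCoeffsIn_inverse hQ hR hρ0 hρ hd hs hu
  have hT : HasCoeffsIn Q (fun z => Ring.inverse (1 - R z)) := by
    have := hasCoeffsIn_inverse hQ hR hρ0 hρ hd zero_le_one (s := 1) (by simpa using hu1)
    simpa using this
  have hD := hU.smul hQ (c := 1 - s) (by linarith)
  obtain ⟨g, hg, -⟩ := hT.mul (hD.pow k)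
  obtain ⟨c, hc, hcQ⟩ := (hU.smul hQ hs).mul (hD.geom_sum k)
  refine ⟨g, hg, fun n => ?_⟩
  have h1 : t = fun n => g n + c n := ht.unique ((hg.add hc).congr fun z hz => ?_)
  · rw [h1]
    simpa using hcQ n
  · set T := Ring.inverse (1 - R z)
    set U := Ring.inverse (1 - (s : ℂ) • R z)
    set D := ((1 - s : ℝ) : ℂ) • U
    have h2 : (1 - (s : ℂ) • R z) * U = 1 := Ring.mul_inverse_cancel _ (hu z hz)
    have h3 : T * (1 - R z) = 1 := Ring.inverse_mul_cancel _ (hu1 z hz)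
    have h4 : 1 - D = (s : ℂ) • ((1 - R z) * U) := by
      have h5 : 1 - D = (1 - (s : ℂ) • R z) * U - D := by rw [h2]
      rw [h5]
      simp only [D, sub_mul, one_mul, smul_mul_assoc, smul_sub]
      push_cast
      rw [sub_smul, one_smul]
      abel
    have h6 : T * (1 - D) = (s : ℂ) • U := by
      rw [h4, mul_smul_comm, ← mul_assoc, h3, one_mul]
    rw [← h6, mul_assoc, mul_neg_geom_sum, mul_sub, mul_one]
    abel

end Coeffs

/-- The Laplace transform of the limiting damped renewal density. -/
noncomputable def dampedKernel (β κ : ℝ) (k : ℕ) (u : ℂ) : ℂ :=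
  ((Real.Gamma (1 - β) : ℂ) * u ^ (β : ℂ))⁻¹ *
    (κ * (κ + (Real.Gamma (1 - β) : ℂ) * u ^ (β : ℂ))⁻¹) ^ k

namespace RenewalResolvent

variable {Y : Type*} [MeasurableSpace Y] {μ : Measure Y} [IsProbabilityMeasure μ] {φ : Y → ℕ}
  {B : Type*} [NormedAddCommGroup B] [NormedSpace ℂ B] [CompleteSpace B]
  {m : B →L[ℂ] ℂ} {e : B} {R : ℂ → B →L[ℂ] B} {β : ℝ}

lemma tendsto_damped (h : RenewalResolvent μ φ m e R) (hφ : Measurable φ)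
    (hp : RegularTail (tailFun μ φ) β) (hβ0 : 0 < β) (hβ1 : β < 1) {u : ℂ} (hu : 0 < u.re)
    {κ : ℝ} (hκ : 0 ≤ κ) (k : ℕ) :
    Tendsto (fun n : ℕ => (tailFun μ φ n : ℂ) • (Ring.inverse (1 - R (Complex.exp (-(u / n)))) *
      (((1 - (1 - κ * tailFun μ φ n) : ℝ) : ℂ) • Ring.inverse
        (1 - ((1 - κ * tailFun μ φ n : ℝ) : ℂ) • R (Complex.exp (-(u / n))))) ^ k))
      atTop (𝓝 (dampedKernel β κ k u • m.smulRight e)) := by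
  have h0 := h.tendsto_smul_inverse hφ hp hβ0 hβ1 hu le_rfl
  have h1 := (h.tendsto_smul_inverse hφ hp hβ0 hβ1 hu hκ).const_smul (κ : ℂ)
  have h2 := h0.mul (h1.pow k)
  have hP : ∀ j : ℕ, m.smulRight e * (m.smulRight e) ^ j = m.smulRight e := by
    intro j
    induction j with
    | zero => simp
    | succ j ih =>
      rw [pow_succ, ← mul_assoc, ih]
      ext v
      simp [h.map_e]
  rw [smul_smul, smul_pow, smul_mul_smul_comm, hP, Complex.ofReal_zero, zero_add] at h2
  refine h2.congr fun n => ?_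
  simp only [zero_mul, sub_zero, Complex.ofReal_one, one_smul, smul_mul_assoc, smul_smul,
    sub_sub_cancel, Complex.ofReal_mul]

lemma norm_damped_le (h : RenewalResolvent μ φ m e R) (hφ : Measurable φ)
    (hp : RegularTail (tailFun μ φ) β) (hβ0 : 0 < β) (hβ1 : β < 1) {κ : ℝ} (hκ : 0 ≤ κ)
    {k : ℕ} (hk : 4 ≤ β * (k + 1)) :
    ∃ K : ℝ, ∀ᶠ n : ℕ in atTop, ∀ t : ℝ, |t| ≤ Real.pi * n →
      ‖(tailFun μ φ n : ℂ) • (Ring.inverse (1 - R (Complex.exp (-((1 - Complex.I * t) / n)))) *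
        (((1 - (1 - κ * tailFun μ φ n) : ℝ) : ℂ) • Ring.inverse
          (1 - ((1 - κ * tailFun μ φ n : ℝ) : ℂ) •
            R (Complex.exp (-((1 - Complex.I * t) / n))))) ^ k)‖ ≤ K * (1 + t ^ 2)⁻¹ := by
  obtain ⟨s₀, M, hs₀, hM, hb⟩ := h.exists_norm_inverse_le hφ hp hβ0 hβ1
  obtain ⟨C, hC, hpot⟩ := hp.potter_upper (α := β / 2) (by linarith) (by linarith)
  set p := tailFun μ φ with hpdef
  refine ⟨κ ^ k * (M * C) ^ (k + 1), ?_⟩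
  have hs : Tendsto (fun n : ℕ => 1 - κ * p n) atTop (𝓝 1) := by
    simpa using ((hp.tendsto_zero hβ0).const_mul κ).const_sub 1
  filter_upwards [hs.eventually (lt_mem_nhds hs₀), eventually_ge_atTop 2] with n hsn hn t ht
  have hn2 : (2 : ℝ) ≤ n := by exact_mod_cast hn
  have hn0 : (0 : ℝ) < n := by linarith
  have hpn := hp.pos n
  set u : ℂ := 1 - Complex.I * t with hu
  have hure : u.re = 1 := by simp [hu]
  have huim : u.im = -t := by simp [hu]
  have hu2 : ‖u‖ ^ 2 = 1 + t ^ 2 := by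
    rw [Complex.sq_norm, Complex.normSq_apply, hure, huim]; ring
  have hu1 : 1 ≤ ‖u‖ := by rw [← hure]; exact Complex.re_le_norm u
  have hu4 : ‖u‖ ≤ 4 * n := by
    have h1 := Complex.norm_le_abs_re_add_abs_im u
    rw [hure, huim, abs_one, abs_neg] at h1
    nlinarith [Real.pi_lt_d2]
  have hw0 : u / n ≠ 0 := by
    refine div_ne_zero (fun h0 => ?_) (by exact_mod_cast hn0.ne')
    rw [h0, Complex.zero_re] at hure
    norm_num at hure
  have hwre : (u / n).re = 1 / n := by rw [Complex.div_natCast_re, hure]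
  have hwim : |(u / n).im| ≤ Real.pi := by
    rw [Complex.div_natCast_im, huim, abs_div, abs_neg, Nat.abs_cast, div_le_iff₀ hn0]
    exact ht
  have hb' : ∀ s : ℝ, s₀ ≤ s → s ≤ 1 →
      ‖Ring.inverse (1 - (s : ℂ) • R (Complex.exp (-(u / n))))‖ ≤ M / p (1 / ‖u / n‖) :=
    fun s h1 h2 => (hb s h1 h2).2 (u / n) (by rw [hwre]; positivity)
      (by rw [hwre, div_le_one hn0]; linarith) hwim hw0
  have hx : 1 / ‖u / n‖ = n / ‖u‖ := by rw [norm_div, Complex.norm_natCast, one_div_div]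
  rw [hx] at hb'
  set q := p (n / ‖u‖) with hq
  have hq0 : 0 < q := hp.pos _
  have hpq : p n ≤ C * ‖u‖ ^ (-(β / 2)) * q := by
    have h1 := hpot (n / ‖u‖) n (by rw [le_div_iff₀ (by linarith)]; linarith)
      (div_le_self hn0.le hu1)
    have h2 : (n : ℝ) / ‖u‖ / n = ‖u‖⁻¹ := by field_simp
    rwa [h2, Real.inv_rpow (norm_nonneg _), ← Real.rpow_neg (norm_nonneg _)] at h1
  have hT : ‖Ring.inverse (1 - R (Complex.exp (-(u / n))))‖ ≤ M / q := by
    simpa using hb' 1 hs₀.le le_rfl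
  have hU := hb' (1 - κ * p n) hsn.le (by nlinarith)
  have hratio : p n * (M / q) ≤ M * C * ‖u‖ ^ (-(β / 2)) := by
    rw [← mul_div_assoc, div_le_iff₀ hq0]
    calc _ ≤ C * ‖u‖ ^ (-(β / 2)) * q * M := by gcongr
      _ = _ := by ring
  rw [norm_smul, Complex.norm_real, Real.norm_of_nonneg hpn.le]
  have hD : ‖((1 - (1 - κ * p n) : ℝ) : ℂ) • Ring.inverse
      (1 - ((1 - κ * p n : ℝ) : ℂ) • R (Complex.exp (-(u / n))))‖ ≤ κ * (p n * (M / q)) := by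
    rw [norm_smul, Complex.norm_real, sub_sub_cancel, Real.norm_of_nonneg (by positivity),
      mul_assoc]
    gcongr
  have hpow : ‖(((1 - (1 - κ * p n) : ℝ) : ℂ) • Ring.inverse
      (1 - ((1 - κ * p n : ℝ) : ℂ) • R (Complex.exp (-(u / n))))) ^ k‖ ≤
      (κ * (p n * (M / q))) ^ k := by
    rcases Nat.eq_zero_or_pos k with rfl | hk0
    · exfalso
      simp at hk
      linarith
    · exact (norm_pow_le' _ hk0).trans (pow_le_pow_left₀ (norm_nonneg _) hD k)
  calc _ ≤ p n * ((M / q) * (κ * (p n * (M / q))) ^ k) := by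
        gcongr
        exact (norm_mul_le _ _).trans (mul_le_mul hT hpow (norm_nonneg _) (by positivity))
    _ = κ ^ k * (p n * (M / q)) ^ (k + 1) := by rw [mul_pow, pow_succ]; ring
    _ ≤ κ ^ k * (M * C * ‖u‖ ^ (-(β / 2))) ^ (k + 1) := by gcongr
    _ = κ ^ k * (M * C) ^ (k + 1) * (‖u‖ ^ (-(β / 2))) ^ (k + 1) := by rw [mul_pow]; ring
    _ ≤ κ ^ k * (M * C) ^ (k + 1) * (1 + t ^ 2)⁻¹ := by
        gcongr
        rw [← hu2, ← Real.rpow_natCast, ← Real.rpow_mul (norm_nonneg _), ← Real.rpow_natCast,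
          ← Real.rpow_neg (norm_nonneg _)]
        refine Real.rpow_le_rpow_of_exponent_le hu1 ?_
        push_cast
        nlinarith

/-- Asymptotics of the coefficients of the damped resolvent. -/
lemma tendsto_coeff_damped (h : RenewalResolvent μ φ m e R) (hφ : Measurable φ)
    (hp : RegularTail (tailFun μ φ) β) (hβ0 : 0 < β) (hβ1 : β < 1)
    (hd : DifferentiableOn ℂ R (Metric.ball 0 1)) {κ : ℝ} (hκ : 0 ≤ κ)
    {k : ℕ} (hk : 4 ≤ β * (k + 1)) {g : ℕ → ℕ → B →L[ℂ] B}
    (hg : ∀ᶠ n : ℕ in atTop, HasCoeffs (fun z => Ring.inverse (1 - R z) *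
      (((1 - (1 - κ * tailFun μ φ n) : ℝ) : ℂ) • Ring.inverse
        (1 - ((1 - κ * tailFun μ φ n : ℝ) : ℂ) • R z)) ^ k) (g n)) :
    Tendsto (fun n : ℕ => ((n * tailFun μ φ n : ℝ) : ℂ) • g n n) atTop
      (𝓝 (((Real.exp 1 / (2 * Real.pi) : ℝ) * ∫ t : ℝ, Complex.exp (-Complex.I * t) *
        dampedKernel β κ k (1 - Complex.I * t) : ℂ) • m.smulRight e)) := by
  obtain ⟨s₀, M, hs₀, hM, hb⟩ := h.exists_norm_inverse_le hφ hp hβ0 hβ1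
  obtain ⟨K, hK⟩ := h.norm_damped_le hφ hp hβ0 hβ1 hκ hk
  set p := tailFun μ φ with hpdef
  set G : ℕ → ℂ → B →L[ℂ] B := fun n z => Ring.inverse (1 - R z) *
      (((1 - (1 - κ * p n) : ℝ) : ℂ) • Ring.inverse
        (1 - ((1 - κ * p n : ℝ) : ℂ) • R z)) ^ k with hG
  set F : ℕ → ℝ → B →L[ℂ] B := fun n => (Set.Ioc (-Real.pi * n) (Real.pi * n)).indicator
    (fun t => Complex.exp (-Complex.I * t) •
      ((p n : ℂ) • G n (Complex.exp (-((1 - Complex.I * t) / n))))) with hF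
  have hs : Tendsto (fun n : ℕ => 1 - κ * p n) atTop (𝓝 1) := by
    simpa using ((hp.tendsto_zero hβ0).const_mul κ).const_sub 1
  have hpi := Real.pi_pos
  have hmeas : ∀ᶠ n : ℕ in atTop, AEStronglyMeasurable (F n) volume := by
    filter_upwards [hs.eventually (lt_mem_nhds hs₀), eventually_ge_atTop 1] with n hsn hn
    have hn0 : (0 : ℝ) < n := by exact_mod_cast hn
    have hpn := hp.pos n
    have hd1 := differentiableOn_inverse_one_sub_smul (s := 1) hd fun z hz => by
      simpa using (hb 1 hs₀.le le_rfl).1 z hz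
    have hd2 := differentiableOn_inverse_one_sub_smul hd
      ((hb (1 - κ * p n) hsn.le (by nlinarith)).1)
    simp only [one_smul] at hd1
    have hGd : DifferentiableOn ℂ (G n) (Metric.ball 0 1) :=
      hd1.mul ((hd2.const_smul (((1 - (1 - κ * p n) : ℝ) : ℂ))).pow k)
    have hGc : Continuous fun t : ℝ => G n (Complex.exp (-((1 - Complex.I * t) / n))) := by
      refine hGd.continuousOn.comp_continuous (by fun_prop) fun t => ?_
      rw [mem_ball_zero_iff, Complex.norm_exp]
      have : (-((1 - Complex.I * (t : ℂ)) / n)).re = -(1 / n) := by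
        rw [Complex.neg_re, Complex.div_natCast_re]; simp
      rw [this, Real.exp_lt_one_iff]
      have : 0 < 1 / (n : ℝ) := by positivity
      linarith
    refine AEStronglyMeasurable.indicator ?_ measurableSet_Ioc
    have h1 : Continuous fun t : ℝ => (p n : ℂ) • G n (Complex.exp (-((1 - Complex.I * t) / n))) :=
      hGc.const_smul (p n : ℂ)
    have h2 : Continuous fun t : ℝ => Complex.exp (-Complex.I * t) := by fun_prop
    exact (h2.smul h1).aestronglyMeasurable
  have hnorm1 : ∀ t : ℝ, ‖Complex.exp (-Complex.I * t)‖ = 1 := fun t => by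
    rw [Complex.norm_exp]; simp
  have hlim : Tendsto (fun n => ∫ t, F n t) atTop (𝓝 (∫ t : ℝ, (Complex.exp (-Complex.I * t) *
      dampedKernel β κ k (1 - Complex.I * t)) • m.smulRight e)) := by
    refine tendsto_integral_filter_of_dominated_convergence (fun t => |K| * (1 + t ^ 2)⁻¹) hmeas
      ?_ (integrable_inv_one_add_sq.const_mul _) (Eventually.of_forall fun t => ?_)
    · filter_upwards [hK] with n hn
      refine Eventually.of_forall fun t => ?_
      rw [hF]
      simp only [Set.indicator_apply]
      split_ifs with hmem
      · rw [norm_smul, hnorm1, one_mul]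
        refine (hn t (abs_le.2 ⟨by linarith [hmem.1], hmem.2⟩)).trans ?_
        gcongr
        exact le_abs_self K
      · rw [norm_zero]; positivity
    · have hu : 0 < (1 - Complex.I * (t : ℂ)).re := by simp
      have h1 := (h.tendsto_damped hφ hp hβ0 hβ1 hu hκ k).const_smul (Complex.exp (-Complex.I * t))
      rw [smul_smul] at h1
      refine h1.congr' ?_
      have ht : Tendsto (fun n : ℕ => Real.pi * (n : ℝ)) atTop atTop :=
        tendsto_natCast_atTop_atTop.const_mul_atTop hpi
      filter_upwards [ht.eventually_gt_atTop |t|] with n hn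
      rw [hF]
      simp only
      rw [Set.indicator_of_mem]
      rw [abs_lt] at hn
      exact ⟨by linarith [hn.1], hn.2.le⟩
  rw [integral_smul_const] at hlim
  have hfin := hlim.const_smul ((Real.exp 1 / (2 * Real.pi) : ℝ) : ℂ)
  rw [smul_smul] at hfin
  refine hfin.congr' ?_
  filter_upwards [hg, eventually_ge_atTop 1] with n hgn hn
  have hn0 : (0 : ℝ) < n := by exact_mod_cast hn
  have hnc : (n : ℂ) ≠ 0 := by exact_mod_cast hn0.ne'
  have hr1 : Real.exp (-(1 / n)) < 1 := by
    rw [Real.exp_lt_one_iff]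
    have : 0 < 1 / (n : ℝ) := by positivity
    linarith
  have hcauchy := hgn.eq_integral (Real.exp_pos (-(1 / n))) hr1 n
  have hchange := intervalIntegral.integral_comp_div (a := -Real.pi * n) (b := Real.pi * n)
    (fun θ : ℝ => Complex.exp (-n * Complex.I * θ) •
      G n ((Real.exp (-(1 / n)) : ℝ) * Complex.exp (Complex.I * θ))) hn0.ne'
  rw [mul_div_cancel_right₀ _ hn0.ne', mul_div_cancel_right₀ _ hn0.ne'] at hchange
  have hFint : ∫ t, F n t = (p n : ℂ) • ∫ t in (-Real.pi * n)..(Real.pi * n),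
      Complex.exp (-n * Complex.I * ((t / n : ℝ) : ℂ)) •
      G n ((Real.exp (-(1 / n)) : ℝ) * Complex.exp (Complex.I * ((t / n : ℝ) : ℂ))) := by
    rw [hF, integral_indicator measurableSet_Ioc, ← intervalIntegral.integral_of_le (by nlinarith),
      ← intervalIntegral.integral_smul]
    refine intervalIntegral.integral_congr fun t _ => ?_
    have h1 : -(n : ℂ) * Complex.I * ((t / n : ℝ) : ℂ) = -Complex.I * t := by
      push_cast; field_simp
    have h2 : ((Real.exp (-(1 / n)) : ℝ) : ℂ) * Complex.exp (Complex.I * ((t / n : ℝ) : ℂ)) =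
        Complex.exp (-((1 - Complex.I * t) / n)) := by
      rw [Complex.ofReal_exp, ← Complex.exp_add]
      congr 1
      push_cast
      field_simp
      ring
    rw [h1, h2, smul_comm]
  have hrn : ((Real.exp (-(1 / n)) : ℝ) : ℂ) ^ n = (Real.exp (-1) : ℝ) := by
    rw [← Complex.ofReal_pow, ← Real.exp_nat_mul]
    congr 2
    field_simp
  rw [hFint, hchange, hcauchy, hrn, ← Complex.coe_smul, smul_smul, smul_smul, smul_smul]
  congr 1
  have h2pi : (Real.pi : ℂ) ≠ 0 := by exact_mod_cast hpi.ne'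
  have he : (Real.exp 1 : ℂ) * (Real.exp (-1) : ℝ) = 1 := by
    rw [← Complex.ofReal_mul, ← Real.exp_add]; simp
  push_cast at he ⊢
  field_simp
  linear_combination (p n : ℂ) * he

end RenewalResolvent

section Kernel

lemma re_one_sub_I_mul (t : ℝ) : (1 - Complex.I * (t : ℂ)).re = 1 := by simp

lemma sq_norm_one_sub_I_mul (t : ℝ) : ‖1 - Complex.I * (t : ℂ)‖ ^ 2 = 1 + t ^ 2 := by
  rw [Complex.sq_norm, Complex.normSq_apply]
  simp
  ring

lemma one_le_norm_one_sub_I_mul (t : ℝ) : 1 ≤ ‖1 - Complex.I * (t : ℂ)‖ := by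
  conv_lhs => rw [← re_one_sub_I_mul t]
  exact Complex.re_le_norm _

lemma one_sub_I_mul_ne_zero (t : ℝ) : 1 - Complex.I * (t : ℂ) ≠ 0 := fun h => by
  have := one_le_norm_one_sub_I_mul t
  rw [h, norm_zero] at this
  linarith

lemma continuous_one_sub_I_mul_cpow (a : ℂ) :
    Continuous fun t : ℝ => (1 - Complex.I * (t : ℂ)) ^ a := by
  refine Continuous.cpow (by fun_prop) continuous_const fun t => Or.inl ?_
  rw [re_one_sub_I_mul]
  exact one_pos

lemma integrable_norm_one_sub_I_mul_rpow {r : ℝ} (hr : 1 < r) :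
    Integrable fun t : ℝ => ‖1 - Complex.I * (t : ℂ)‖ ^ (-r) := by
  have h := integrable_rpow_neg_one_add_norm_sq (E := ℝ) (μ := volume) (r := r) (by simpa using hr)
  refine h.congr (Eventually.of_forall fun t => ?_)
  have h1 : 1 + ‖t‖ ^ 2 = ‖1 - Complex.I * (t : ℂ)‖ ^ (2 : ℝ) := by
    rw [Real.rpow_two, sq_norm_one_sub_I_mul, Real.norm_eq_abs, sq_abs]
  simp only [h1]
  rw [← Real.rpow_mul (norm_nonneg _)]
  congr 1
  ring

/-- The inverse Laplace transform of `u ↦ u ^ (-(β + 1))` at `1`. -/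
lemma integral_cexp_mul_one_sub_I_mul_cpow {β : ℝ} (hβ : 0 < β) :
    ∫ t : ℝ, Complex.exp (-Complex.I * t) * (1 - Complex.I * (t : ℂ)) ^ (-((β + 1 : ℝ) : ℂ)) =
      2 * Real.pi * Real.exp (-1) / Real.Gamma (β + 1) := by
  set g : ℝ → ℂ := (Set.Ioi (0 : ℝ)).indicator fun x => ((x ^ β * Real.exp (-x) : ℝ) : ℂ) with hg
  have hgi : Integrable g := by
    rw [hg, integrable_indicator_iff measurableSet_Ioi]
    have h1 := integrableOn_rpow_mul_exp_neg_mul_rpow (s := β) (by linarith) one_pos one_pos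
    have h2 : IntegrableOn (fun x : ℝ => x ^ β * Real.exp (-x)) (Set.Ioi 0) := by simpa using h1
    exact h2.ofReal
  have hF : ∀ ξ : ℝ, FourierTransform.fourier g ξ = (Real.Gamma (β + 1) : ℂ) *
      (1 - Complex.I * ((-(2 * Real.pi) * ξ : ℝ) : ℂ)) ^ (-((β + 1 : ℝ) : ℂ)) := by
    intro ξ
    have hre : 0 < (1 - Complex.I * ((-(2 * Real.pi) * ξ : ℝ) : ℂ)).re := by
      rw [re_one_sub_I_mul]; exact one_pos
    rw [← integral_rpow_mul_cexp_neg_mul (by linarith) hre, Real.fourier_real_eq_integral_exp_smul,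
      ← integral_indicator measurableSet_Ioi]
    refine integral_congr_ae (Eventually.of_forall fun x => ?_)
    simp only [hg, Set.indicator_apply]
    split_ifs with hx
    · rw [add_sub_cancel_right, smul_eq_mul]
      push_cast
      rw [mul_left_comm, ← Complex.exp_add]
      congr 2
      ring
    · simp
  have hFi : Integrable (FourierTransform.fourier g) := by
    have h1 := (integrable_norm_one_sub_I_mul_rpow (r := β + 1) (by linarith)).comp_mul_left'
      (R := -(2 * Real.pi)) (by simp [Real.pi_ne_zero])
    have h2 : FourierTransform.fourier g = fun ξ : ℝ => (Real.Gamma (β + 1) : ℂ) *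
      (1 - Complex.I * ((-(2 * Real.pi) * ξ : ℝ) : ℂ)) ^ (-((β + 1 : ℝ) : ℂ)) := funext hF
    rw [h2]
    refine Integrable.const_mul (h1.mono' ?_ (Eventually.of_forall fun ξ => ?_)) _
    · exact ((continuous_one_sub_I_mul_cpow _).comp
        (continuous_const.mul continuous_id)).aestronglyMeasurable
    · rw [← Complex.ofReal_neg, Complex.norm_cpow_real]
  have hcont : ContinuousAt g 1 := by
    have h1 : ContinuousAt (fun x : ℝ => ((x ^ β * Real.exp (-x) : ℝ) : ℂ)) 1 := by
      refine Complex.continuous_ofReal.continuousAt.comp (ContinuousAt.mul ?_ (by fun_prop))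
      exact Real.continuousAt_rpow_const _ _ (Or.inl one_ne_zero)
    refine h1.congr ?_
    filter_upwards [lt_mem_nhds (zero_lt_one : (0 : ℝ) < 1)] with x hx
    rw [hg, Set.indicator_of_mem (Set.mem_Ioi.2 hx)]
  have hinv := hgi.fourierInv_fourier_eq hFi hcont
  rw [Real.fourierInv_eq'] at hinv
  have h1 : g 1 = (Real.exp (-1) : ℝ) := by
    rw [hg, Set.indicator_of_mem (Set.mem_Ioi.2 one_pos)]
    simp
  have h2 := Measure.integral_comp_mul_left (fun t : ℝ => Complex.exp (-Complex.I * t) *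
    (1 - Complex.I * (t : ℂ)) ^ (-((β + 1 : ℝ) : ℂ))) (-(2 * Real.pi))
  have h3 : ∫ ξ : ℝ, Complex.exp (((2 * Real.pi * inner ℝ ξ (1 : ℝ) : ℝ) : ℂ) * Complex.I) •
      FourierTransform.fourier g ξ = (Real.Gamma (β + 1) : ℂ) * ∫ ξ : ℝ,
      Complex.exp (-Complex.I * ((-(2 * Real.pi) * ξ : ℝ) : ℂ)) *
      (1 - Complex.I * ((-(2 * Real.pi) * ξ : ℝ) : ℂ)) ^ (-((β + 1 : ℝ) : ℂ)) := by
    rw [← integral_const_mul]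
    refine integral_congr_ae (Eventually.of_forall fun ξ => ?_)
    simp only [hF, smul_eq_mul]
    rw [mul_left_comm]
    congr 3
    simp
    ring
  rw [h3, h2, h1] at hinv
  have hG : (Real.Gamma (β + 1) : ℂ) ≠ 0 := by
    exact_mod_cast (Real.Gamma_pos_of_pos (by linarith)).ne'
  have hpi : (Real.pi : ℂ) ≠ 0 := by exact_mod_cast Real.pi_ne_zero
  have habs : |(-(2 * Real.pi))⁻¹| = (2 * Real.pi)⁻¹ := by
    rw [abs_inv, abs_neg, abs_of_pos Real.two_pi_pos]
  rw [habs, Complex.real_smul] at hinv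
  rw [eq_div_iff hG, ← hinv]
  push_cast
  field_simp

lemma norm_le_norm_ofReal_add {κ : ℝ} (hκ : 0 ≤ κ) {w : ℂ} (hw : 0 ≤ w.re) :
    ‖w‖ ≤ ‖(κ : ℂ) + w‖ ∧ ‖(κ : ℂ)‖ ≤ ‖(κ : ℂ) + w‖ := by
  constructor
  · rw [Complex.norm_def, Complex.norm_def]
    refine Real.sqrt_le_sqrt ?_
    simp only [Complex.normSq_apply, Complex.add_re, Complex.add_im, Complex.ofReal_re,
      Complex.ofReal_im, zero_add]
    nlinarith [mul_nonneg hκ hw, mul_nonneg hκ hκ]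
  · rw [Complex.norm_real, Real.norm_of_nonneg hκ]
    refine le_trans ?_ (Complex.re_le_norm _)
    simpa using hw

variable {β : ℝ}

/-- The derivative of `t ↦ dampedKernel β κ k (1 - I t)`. -/
noncomputable def dampedKernelDeriv (β κ : ℝ) (k : ℕ) (t : ℝ) : ℂ :=
  Complex.I * β * (Real.Gamma (1 - β) : ℂ)⁻¹ * (1 - Complex.I * t) ^ (-((β + 1 : ℝ) : ℂ)) *
    (κ * (κ + (Real.Gamma (1 - β) : ℂ) * (1 - Complex.I * t) ^ (β : ℂ))⁻¹) ^ k *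
    (1 + k * ((Real.Gamma (1 - β) : ℂ) * (1 - Complex.I * t) ^ (β : ℂ) *
      (κ + (Real.Gamma (1 - β) : ℂ) * (1 - Complex.I * t) ^ (β : ℂ))⁻¹))

lemma re_gamma_mul_cpow_pos (hβ0 : 0 < β) (hβ1 : β < 1) (t : ℝ) :
    0 < ((Real.Gamma (1 - β) : ℂ) * (1 - Complex.I * t) ^ (β : ℂ)).re := by
  rw [Complex.re_ofReal_mul]
  exact mul_pos (Real.Gamma_pos_of_pos (by linarith))
    (Complex.re_cpow_pos (by rw [re_one_sub_I_mul]; exact one_pos) hβ0 hβ1)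

lemma ne_zero_of_re_pos' {w : ℂ} (hw : 0 < w.re) : w ≠ 0 := by
  rintro rfl
  simp at hw

lemma ofReal_add_ne_zero {κ : ℝ} (hκ : 0 ≤ κ) {w : ℂ} (hw : 0 < w.re) : (κ : ℂ) + w ≠ 0 :=
  ne_zero_of_re_pos' (by simp; linarith)

lemma hasDerivAt_dampedKernel (hβ0 : 0 < β) (hβ1 : β < 1) {κ : ℝ} (hκ : 0 ≤ κ) (k : ℕ) (t : ℝ) :
    HasDerivAt (fun t : ℝ => dampedKernel β κ (k + 1) (1 - Complex.I * t))
      (dampedKernelDeriv β κ (k + 1) t) t := by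
  set c : ℂ := (Real.Gamma (1 - β) : ℂ) with hc
  have hc0 : c ≠ 0 := by
    rw [hc]; exact_mod_cast (Real.Gamma_pos_of_pos (by linarith : 0 < 1 - β)).ne'
  have hW := re_gamma_mul_cpow_pos hβ0 hβ1 t
  have hW0 := ne_zero_of_re_pos' hW
  have hκW := ofReal_add_ne_zero hκ hW
  rw [← hc] at hW0 hκW
  have hf0 := one_sub_I_mul_ne_zero t
  have hf : HasDerivAt (fun x : ℂ => 1 - Complex.I * x) (-Complex.I) (t : ℂ) := by
    simpa using ((hasDerivAt_id (t : ℂ)).const_mul Complex.I).const_sub 1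
  have hv := (hf.cpow_const (c := (β : ℂ))
    (Or.inl (by rw [re_one_sub_I_mul]; exact one_pos))).const_mul c
  have h1 := hv.inv hW0
  have h2 := (((hv.const_add (κ : ℂ)).inv hκW).const_mul (κ : ℂ)).pow (k + 1)
  have h3 := (h1.mul h2).comp_ofReal
  refine HasDerivAt.congr_deriv (f := fun t : ℝ => dampedKernel β κ (k + 1) (1 - Complex.I * t)) h3 ?_
  have e1 : (1 - Complex.I * (t : ℂ)) ^ ((β : ℂ) - 1) =
      (1 - Complex.I * (t : ℂ)) ^ (β : ℂ) * (1 - Complex.I * (t : ℂ))⁻¹ := by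
    rw [Complex.cpow_sub _ _ hf0, Complex.cpow_one, div_eq_mul_inv]
  have e2 : (1 - Complex.I * (t : ℂ)) ^ (-((β + 1 : ℝ) : ℂ)) =
      ((1 - Complex.I * (t : ℂ)) ^ (β : ℂ))⁻¹ * (1 - Complex.I * (t : ℂ))⁻¹ := by
    rw [Complex.cpow_neg, Complex.ofReal_add, Complex.ofReal_one, Complex.cpow_add _ _ hf0,
      Complex.cpow_one, mul_inv]
  unfold dampedKernelDeriv
  simp only [← hc, Pi.inv_apply, Pi.pow_apply]
  rw [e1, e2]
  have hv0 : (1 - Complex.I * (t : ℂ)) ^ (β : ℂ) ≠ 0 := right_ne_zero_of_mul hW0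
  set f := 1 - Complex.I * (t : ℂ) with hfdef
  set v := f ^ (β : ℂ) with hvdef
  simp only [Nat.add_sub_cancel]
  push_cast
  simp only [pow_succ]
  set Z := ((κ : ℂ) * ((κ : ℂ) + c * v)⁻¹) ^ k
  field_simp

lemma norm_dampedKernelDeriv_le (hβ0 : 0 < β) (hβ1 : β < 1) {κ : ℝ} (hκ : 0 ≤ κ) (k : ℕ) (t : ℝ) :
    ‖dampedKernelDeriv β κ k t‖ ≤
      β * (Real.Gamma (1 - β))⁻¹ * (1 + k) * ‖1 - Complex.I * (t : ℂ)‖ ^ (-(β + 1)) := by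
  have hΓ := Real.Gamma_pos_of_pos (by linarith : 0 < 1 - β)
  have hW := re_gamma_mul_cpow_pos hβ0 hβ1 t
  have hκW := norm_pos_iff.2 (ofReal_add_ne_zero hκ hW)
  obtain ⟨hn1, hn2⟩ := norm_le_norm_ofReal_add hκ hW.le
  unfold dampedKernelDeriv
  set w := (Real.Gamma (1 - β) : ℂ) * (1 - Complex.I * t) ^ (β : ℂ) with hw
  have a1 : ‖(κ * (κ + w)⁻¹ : ℂ) ^ k‖ ≤ 1 := by
    rw [norm_pow, norm_mul, norm_inv]
    exact pow_le_one₀ (by positivity) (by rw [← div_eq_mul_inv]; exact (div_le_one hκW).2 hn2)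
  have a2 : ‖(1 + k * (w * (κ + w)⁻¹) : ℂ)‖ ≤ 1 + k := by
    refine (norm_add_le _ _).trans ?_
    rw [norm_one, norm_mul, Complex.norm_natCast, norm_mul, norm_inv, ← div_eq_mul_inv]
    have := (div_le_one hκW).2 hn1
    have hk : (0 : ℝ) ≤ k := Nat.cast_nonneg k
    nlinarith
  have a3 : ‖Complex.I * β * (Real.Gamma (1 - β) : ℂ)⁻¹ *
      (1 - Complex.I * t) ^ (-((β + 1 : ℝ) : ℂ))‖ =
      β * (Real.Gamma (1 - β))⁻¹ * ‖1 - Complex.I * (t : ℂ)‖ ^ (-(β + 1)) := by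
    rw [← Complex.ofReal_neg, norm_mul, norm_mul, norm_mul, Complex.norm_I, norm_inv,
      Complex.norm_real, Complex.norm_real, Complex.norm_cpow_real, Real.norm_of_nonneg hβ0.le,
      Real.norm_of_nonneg hΓ.le, one_mul]
  rw [norm_mul, norm_mul, a3]
  calc _ ≤ β * (Real.Gamma (1 - β))⁻¹ * ‖1 - Complex.I * (t : ℂ)‖ ^ (-(β + 1)) * 1 * (1 + k) := by
        gcongr
    _ = _ := by ring

lemma continuous_gamma_mul_cpow (β : ℝ) :
    Continuous fun t : ℝ => (Real.Gamma (1 - β) : ℂ) * (1 - Complex.I * t) ^ (β : ℂ) :=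
  continuous_const.mul (continuous_one_sub_I_mul_cpow _)

lemma continuous_dampedKernelDeriv (hβ0 : 0 < β) (hβ1 : β < 1) {κ : ℝ} (hκ : 0 ≤ κ) (k : ℕ) :
    Continuous (dampedKernelDeriv β κ k) := by
  have h1 := continuous_gamma_mul_cpow β
  have h2 : Continuous fun t : ℝ =>
      ((κ : ℂ) + (Real.Gamma (1 - β) : ℂ) * (1 - Complex.I * t) ^ (β : ℂ))⁻¹ :=
    (continuous_const.add h1).inv₀ fun t => ofReal_add_ne_zero hκ (re_gamma_mul_cpow_pos hβ0 hβ1 t)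
  have h3 := continuous_one_sub_I_mul_cpow (-((β + 1 : ℝ) : ℂ))
  unfold dampedKernelDeriv
  exact ((continuous_const.mul h3).mul ((continuous_const.mul h2).pow k)).mul
    (continuous_const.add (continuous_const.mul (h1.mul h2)))

lemma integrable_dampedKernel (hβ0 : 0 < β) (hβ1 : β < 1) {κ : ℝ} (hκ : 0 ≤ κ) {k : ℕ}
    (hk : 4 ≤ β * (k + 1)) :
    Integrable fun t : ℝ => dampedKernel β κ k (1 - Complex.I * t) := by
  have hΓ := Real.Gamma_pos_of_pos (by linarith : 0 < 1 - β)
  have h1 := continuous_gamma_mul_cpow β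
  have h2 : Continuous fun t : ℝ =>
      ((κ : ℂ) + (Real.Gamma (1 - β) : ℂ) * (1 - Complex.I * t) ^ (β : ℂ))⁻¹ :=
    (continuous_const.add h1).inv₀ fun t => ofReal_add_ne_zero hκ (re_gamma_mul_cpow_pos hβ0 hβ1 t)
  have h3 : Continuous fun t : ℝ =>
      ((Real.Gamma (1 - β) : ℂ) * (1 - Complex.I * t) ^ (β : ℂ))⁻¹ :=
    h1.inv₀ fun t => ne_zero_of_re_pos' (re_gamma_mul_cpow_pos hβ0 hβ1 t)
  refine ((integrable_norm_one_sub_I_mul_rpow (r := β * (k + 1)) (by linarith)).const_mul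
    (κ ^ k * ((Real.Gamma (1 - β))⁻¹) ^ (k + 1))).mono'
    (h3.mul ((continuous_const.mul h2).pow k)).aestronglyMeasurable
    (Eventually.of_forall fun t => ?_)
  have hW := re_gamma_mul_cpow_pos hβ0 hβ1 t
  obtain ⟨hn1, -⟩ := norm_le_norm_ofReal_add hκ hW.le
  unfold dampedKernel
  set w := (Real.Gamma (1 - β) : ℂ) * (1 - Complex.I * t) ^ (β : ℂ) with hw
  have hw0 := norm_pos_iff.2 (ne_zero_of_re_pos' hW)
  have hwn : ‖w‖ = Real.Gamma (1 - β) * ‖1 - Complex.I * (t : ℂ)‖ ^ β := by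
    rw [hw, norm_mul, Complex.norm_real, Complex.norm_cpow_real, Real.norm_of_nonneg hΓ.le]
  rw [norm_mul, norm_pow, norm_mul, norm_inv, norm_inv, Complex.norm_real, Real.norm_of_nonneg hκ]
  calc _ ≤ ‖w‖⁻¹ * (κ * ‖w‖⁻¹) ^ k := by gcongr
    _ = κ ^ k * (‖w‖⁻¹) ^ (k + 1) := by rw [mul_pow, pow_succ]; ring
    _ = _ := by
      rw [hwn, mul_inv, mul_pow, ← mul_assoc, ← Real.rpow_neg (norm_nonneg _),
        ← Real.rpow_natCast (‖1 - Complex.I * (t : ℂ)‖ ^ (-β)), ← Real.rpow_mul (norm_nonneg _)]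
      congr 2
      push_cast
      ring

lemma integral_cexp_mul_dampedKernel (hβ0 : 0 < β) (hβ1 : β < 1) {κ : ℝ} (hκ : 0 ≤ κ) {k : ℕ}
    (hk : 4 ≤ β * (k + 1)) :
    ∫ t : ℝ, Complex.exp (-Complex.I * t) * dampedKernel β κ k (1 - Complex.I * t) =
      - ∫ t : ℝ, dampedKernelDeriv β κ k t * (Complex.I * Complex.exp (-Complex.I * t)) := by
  obtain ⟨j, rfl⟩ : ∃ j, k = j + 1 := Nat.exists_eq_succ_of_ne_zero (by
    rintro rfl
    simp at hk
    linarith)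
  have hnorm1 : ∀ t : ℝ, ‖Complex.exp (-Complex.I * t)‖ = 1 := fun t => by
    rw [Complex.norm_exp]; simp
  have hH := integrable_dampedKernel hβ0 hβ1 hκ hk
  have hec : Continuous fun t : ℝ => Complex.exp (-Complex.I * t) := by fun_prop
  have hderiv : Integrable (dampedKernelDeriv β κ (j + 1)) :=
    ((integrable_norm_one_sub_I_mul_rpow (r := β + 1) (by linarith)).const_mul _).mono'
      (continuous_dampedKernelDeriv hβ0 hβ1 hκ _).aestronglyMeasurable
      (Eventually.of_forall (norm_dampedKernelDeriv_le hβ0 hβ1 hκ _))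
  have hv : ∀ t : ℝ, HasDerivAt (fun t : ℝ => Complex.I * Complex.exp (-Complex.I * t))
      (Complex.exp (-Complex.I * t)) t := by
    intro t
    have h1 := ((((hasDerivAt_id (t : ℂ)).const_mul (-Complex.I)).cexp).const_mul
      Complex.I).comp_ofReal
    refine HasDerivAt.congr_deriv (f := fun t : ℝ => Complex.I * Complex.exp (-Complex.I * t)) h1 ?_
    simp only [id, mul_one]
    linear_combination (-Complex.exp (-Complex.I * t)) * Complex.I_sq
  have hb1 : ∀ᵐ t : ℝ, ‖Complex.exp (-Complex.I * t)‖ ≤ 1 :=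
    Eventually.of_forall fun t => (hnorm1 t).le
  have hb2 : ∀ᵐ t : ℝ, ‖Complex.I * Complex.exp (-Complex.I * t)‖ ≤ 1 :=
    Eventually.of_forall fun t => by rw [norm_mul, hnorm1, Complex.norm_I, mul_one]
  have hec2 : Continuous fun t : ℝ => Complex.I * Complex.exp (-Complex.I * t) :=
    continuous_const.mul hec
  have := integral_mul_deriv_eq_deriv_mul_of_integrable
    (u := fun t : ℝ => dampedKernel β κ (j + 1) (1 - Complex.I * t))
    (v := fun t : ℝ => Complex.I * Complex.exp (-Complex.I * t))
    (fun t _ => hasDerivAt_dampedKernel hβ0 hβ1 hκ j t) (fun t _ => hv t)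
    (hH.mul_bdd hec.aestronglyMeasurable hb1)
    (hderiv.mul_bdd hec2.aestronglyMeasurable hb2) (hH.mul_bdd hec2.aestronglyMeasurable hb2)
  rw [← this]
  exact integral_congr_ae (Eventually.of_forall fun t => mul_comm _ _)

/-- The limiting damped renewal density converges to the undamped one as `κ → ∞`. -/
lemma tendsto_integral_dampedKernel (hβ0 : 0 < β) (hβ1 : β < 1) {k : ℕ}
    (hk : 4 ≤ β * (k + 1)) :
    Tendsto (fun κ : ℕ => ((Real.exp 1 / (2 * Real.pi) : ℝ) : ℂ) *
        ∫ t : ℝ, Complex.exp (-Complex.I * t) * dampedKernel β κ k (1 - Complex.I * t)) atTop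
      (𝓝 ((Real.pi⁻¹ * Real.sin (β * Real.pi) : ℝ) : ℂ)) := by
  have hnorm1 : ∀ t : ℝ, ‖Complex.exp (-Complex.I * t)‖ = 1 := fun t => by
    rw [Complex.norm_exp]; simp
  have hec : Continuous fun t : ℝ => Complex.I * Complex.exp (-Complex.I * t) := by fun_prop
  have hlim : Tendsto (fun κ : ℕ => ∫ t : ℝ, dampedKernelDeriv β κ k t *
      (Complex.I * Complex.exp (-Complex.I * t))) atTop
      (𝓝 (∫ t : ℝ, Complex.I * β * (Real.Gamma (1 - β) : ℂ)⁻¹ *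
        (1 - Complex.I * t) ^ (-((β + 1 : ℝ) : ℂ)) *
        (Complex.I * Complex.exp (-Complex.I * t)))) := by
    refine tendsto_integral_of_dominated_convergence
      (fun t => β * (Real.Gamma (1 - β))⁻¹ * (1 + k) * ‖1 - Complex.I * (t : ℂ)‖ ^ (-(β + 1)))
      (fun κ => ((continuous_dampedKernelDeriv hβ0 hβ1 κ.cast_nonneg k).mul
        hec).aestronglyMeasurable)
      ((integrable_norm_one_sub_I_mul_rpow (by linarith)).const_mul _)
      (fun κ => Eventually.of_forall fun t => ?_) (Eventually.of_forall fun t => ?_)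
    · rw [norm_mul, norm_mul, hnorm1, Complex.norm_I, mul_one, mul_one]
      exact norm_dampedKernelDeriv_le hβ0 hβ1 κ.cast_nonneg k t
    · refine Tendsto.mul_const _ ?_
      unfold dampedKernelDeriv
      set w := (Real.Gamma (1 - β) : ℂ) * (1 - Complex.I * t) ^ (β : ℂ) with hw
      have hi : Tendsto (fun κ : ℕ => (((κ : ℝ) : ℂ) + w)⁻¹) atTop (𝓝 0) := by
        refine tendsto_inv₀_cobounded.comp ?_
        rw [← tendsto_norm_atTop_iff_cobounded]
        refine tendsto_atTop_mono (fun κ => ?_) (tendsto_natCast_atTop_atTop (R := ℝ))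
        have := (norm_le_norm_ofReal_add (κ := (κ : ℝ)) κ.cast_nonneg
          (re_gamma_mul_cpow_pos hβ0 hβ1 t).le).2
        rwa [Complex.norm_real, Real.norm_of_nonneg κ.cast_nonneg] at this
      have h1 : Tendsto (fun κ : ℕ => w * (((κ : ℝ) : ℂ) + w)⁻¹) atTop (𝓝 0) := by
        simpa using hi.const_mul w
      have h2 : Tendsto (fun κ : ℕ => ((κ : ℝ) : ℂ) * (((κ : ℝ) : ℂ) + w)⁻¹) atTop (𝓝 1) := by
        have h3 := h1.const_sub 1
        rw [sub_zero] at h3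
        refine h3.congr fun κ => ?_
        have := ofReal_add_ne_zero (κ := (κ : ℝ)) κ.cast_nonneg (re_gamma_mul_cpow_pos hβ0 hβ1 t)
        rw [← hw] at this
        field_simp
        ring
      have h4 := ((h2.pow k).const_mul (Complex.I * β * (Real.Gamma (1 - β) : ℂ)⁻¹ *
        (1 - Complex.I * t) ^ (-((β + 1 : ℝ) : ℂ)))).mul ((h1.const_mul (k : ℂ)).const_add 1)
      simpa using h4
  have hval : ∫ t : ℝ, Complex.I * β * (Real.Gamma (1 - β) : ℂ)⁻¹ *
      (1 - Complex.I * t) ^ (-((β + 1 : ℝ) : ℂ)) * (Complex.I * Complex.exp (-Complex.I * t)) =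
      -(β * (Real.Gamma (1 - β) : ℂ)⁻¹ * (2 * Real.pi * Real.exp (-1) / Real.Gamma (β + 1))) := by
    rw [← integral_cexp_mul_one_sub_I_mul_cpow hβ0, ← integral_const_mul, ← integral_neg]
    refine integral_congr_ae (Eventually.of_forall fun t => ?_)
    simp only
    linear_combination (β * (Real.Gamma (1 - β) : ℂ)⁻¹ *
      (1 - Complex.I * t) ^ (-((β + 1 : ℝ) : ℂ)) * Complex.exp (-Complex.I * t)) * Complex.I_sq
  rw [hval] at hlim
  have hfin := hlim.neg.const_mul ((Real.exp 1 / (2 * Real.pi) : ℝ) : ℂ)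
  have hconst : ((Real.exp 1 / (2 * Real.pi) : ℝ) : ℂ) *
      -(-(β * (Real.Gamma (1 - β) : ℂ)⁻¹ * (2 * Real.pi * Real.exp (-1) / Real.Gamma (β + 1)))) =
      ((Real.pi⁻¹ * Real.sin (β * Real.pi) : ℝ) : ℂ) := by
    have hreal : Real.exp 1 / (2 * Real.pi) * (β * (Real.Gamma (1 - β))⁻¹ *
        (2 * Real.pi * Real.exp (-1) / Real.Gamma (β + 1))) =
        Real.pi⁻¹ * Real.sin (β * Real.pi) := by
      have h1 := Real.Gamma_mul_Gamma_one_sub β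
      have hG1 := (Real.Gamma_pos_of_pos (by linarith : 0 < 1 - β)).ne'
      have hG2 := (Real.Gamma_pos_of_pos hβ0).ne'
      have hpi := Real.pi_pos
      have hsin : Real.sin (Real.pi * β) ≠ 0 :=
        (Real.sin_pos_of_pos_of_lt_pi (by positivity) (by nlinarith)).ne'
      rw [Real.Gamma_add_one hβ0.ne', mul_comm β Real.pi, Real.exp_neg]
      have he := (Real.exp_pos 1).ne'
      rw [eq_div_iff hsin] at h1
      field_simp
      linarith
    rw [← hreal]
    push_cast
    ring
  rw [hconst] at hfin
  refine hfin.congr fun κ => ?_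
  rw [integral_cexp_mul_dampedKernel hβ0 hβ1 κ.cast_nonneg hk]

end Kernel

/-- The operators `Rn n` on a Banach space `B` of bounded functions on `Y` are the restrictions of
`v ↦ R (1_{φ = n} v)`, with norms dominated by `μ (φ = n)`. -/
structure RenewalOperators {Y : Type*} [MeasurableSpace Y] (μ : Measure Y) (F : Y → Y) (φ : Y → ℕ)
    {B : Type*} [NormedAddCommGroup B] [NormedSpace ℂ B] (ι : B →ₗ[ℂ] Lp ℂ ⊤ μ)
    (Rn : ℕ → B →L[ℂ] B) (C : ℝ) : Prop where
  preserving : MeasurePreserving F μ μ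
  measurable : Measurable φ
  one_le : ∀ y, 1 ≤ φ y
  injective : Function.Injective ι
  norm_le : ∀ v : B, ‖ι v‖ ≤ ‖v‖
  transfer : ∀ n : ℕ, 1 ≤ n → ∀ v : B,
    IsTransferOf μ F (Set.indicator {y | φ y = n} (ι v)) (ι (Rn n v))
  norm_op_le : ∀ n : ℕ, 1 ≤ n → ‖Rn n‖ ≤ C * μ.real {y | φ y = n}

/-- The cone of almost everywhere nonnegative elements. -/
def AENonneg {Y : Type*} [MeasurableSpace Y] {μ : Measure Y} {B : Type*} [NormedAddCommGroup B]
    [NormedSpace ℂ B] (ι : B →ₗ[ℂ] Lp ℂ ⊤ μ) (v : B) : Prop :=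
  ∀ᵐ y ∂μ, 0 ≤ (ι v y).re ∧ (ι v y).im = 0

section Embedding

variable {Y : Type*} [MeasurableSpace Y] {μ : Measure Y} {B : Type*} [NormedAddCommGroup B]
  [NormedSpace ℂ B] {ι : B →ₗ[ℂ] Lp ℂ ⊤ μ}

lemma ae_embedding_add (v v' : B) : ∀ᵐ y ∂μ, ι (v + v') y = ι v y + ι v' y := by
  rw [map_add]
  exact Lp.coeFn_add _ _

lemma ae_embedding_sub (v v' : B) : ∀ᵐ y ∂μ, ι (v - v') y = ι v y - ι v' y := by
  rw [map_sub]
  exact Lp.coeFn_sub _ _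

lemma ae_embedding_smul (c : ℂ) (v : B) : ∀ᵐ y ∂μ, ι (c • v) y = c * ι v y := by
  rw [map_smul]
  exact Lp.coeFn_smul _ _

lemma ae_embedding_zero : ∀ᵐ y ∂μ, ι (0 : B) y = 0 := by
  rw [map_zero]
  exact Lp.coeFn_zero _ _ _

lemma ae_norm_embedding_le (hι : ∀ v : B, ‖ι v‖ ≤ ‖v‖) (v : B) : ∀ᵐ y ∂μ, ‖ι v y‖ ≤ ‖v‖ := by
  filter_upwards [ae_le_eLpNormEssSup (f := ι v) (μ := μ)] with y hy
  refine le_trans ?_ (hι v)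
  rw [Lp.norm_def, eLpNorm_exponent_top]
  have hfin : eLpNormEssSup (ι v) μ ≠ ⊤ := by
    have := Lp.eLpNorm_ne_top (ι v)
    rwa [eLpNorm_exponent_top] at this
  rw [← toReal_enorm]
  exact ENNReal.toReal_mono hfin hy

lemma integrable_embedding [IsFiniteMeasure μ] (v : B) : Integrable (ι v) μ :=
  (Lp.memLp (ι v)).integrable le_top

/-- Norm convergence in `B` implies almost everywhere convergence. -/
lemma ae_tendsto_embedding (hι : ∀ v : B, ‖ι v‖ ≤ ‖v‖) {X : ℕ → B} {x : B}
    (hX : Tendsto X atTop (𝓝 x)) : ∀ᵐ y ∂μ, Tendsto (fun n => ι (X n) y) atTop (𝓝 (ι x y)) := by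
  have h1 : ∀ᵐ y ∂μ, ∀ n, ‖ι (X n - x) y‖ ≤ ‖X n - x‖ :=
    ae_all_iff.2 fun n => ae_norm_embedding_le hι _
  have h2 : ∀ᵐ y ∂μ, ∀ n, ι (X n - x) y = ι (X n) y - ι x y :=
    ae_all_iff.2 fun n => ae_embedding_sub _ _
  filter_upwards [h1, h2] with y hy1 hy2
  refine tendsto_iff_norm_sub_tendsto_zero.2 (squeeze_zero (fun _ => norm_nonneg _) (fun n => ?_)
    (tendsto_iff_norm_sub_tendsto_zero.1 hX))
  rw [← hy2]
  exact hy1 n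

lemma ae_embedding_sum (c : ℕ → ℂ) (X : ℕ → B) (K : ℕ) :
    ∀ᵐ y ∂μ, ι (∑ k ∈ Finset.range K, c k • X k) y = ∑ k ∈ Finset.range K, c k * ι (X k) y := by
  induction K with
  | zero => simpa using ae_embedding_zero (ι := ι)
  | succ K ih =>
    simp only [Finset.sum_range_succ]
    filter_upwards [ih, ae_embedding_add (ι := ι) (∑ k ∈ Finset.range K, c k • X k) (c K • X K),
      ae_embedding_smul (ι := ι) (c K) (X K)] with y h1 h2 h3
    rw [h2, h1, h3]

/-- Integration against a bounded function, as a functional on `B`. -/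
noncomputable def pairing [IsProbabilityMeasure μ] (hι : ∀ v : B, ‖ι v‖ ≤ ‖v‖) {w : Y → ℂ}
    (hw : Measurable w) {M : ℝ} (hM : ∀ y, ‖w y‖ ≤ M) : B →L[ℂ] ℂ :=
  LinearMap.mkContinuous
    { toFun := fun v => ∫ y, ι v y * w y ∂μ
      map_add' := fun v v' => by
        have hi : ∀ v : B, Integrable (fun y => ι v y * w y) μ := fun v =>
          (integrable_embedding v).mul_bdd hw.aestronglyMeasurable (Eventually.of_forall hM)
        rw [← integral_add (hi v) (hi v')]
        refine integral_congr_ae ?_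
        filter_upwards [ae_embedding_add (ι := ι) v v'] with y hy
        rw [hy, add_mul]
      map_smul' := fun c v => by
        rw [RingHom.id_apply, smul_eq_mul, ← integral_const_mul]
        refine integral_congr_ae ?_
        filter_upwards [ae_embedding_smul (ι := ι) c v] with y hy
        rw [hy, mul_assoc] }
    M fun v => by
      have h := norm_integral_le_of_norm_le_const (μ := μ) (f := fun y => ι v y * w y)
        (C := M * ‖v‖) (by
          filter_upwards [ae_norm_embedding_le hι v] with y hy
          rw [norm_mul, mul_comm]
          exact mul_le_mul (hM y) hy (norm_nonneg _) ((norm_nonneg _).trans (hM y)))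
      simpa using h

lemma pairing_apply [IsProbabilityMeasure μ] (hι : ∀ v : B, ‖ι v‖ ≤ ‖v‖) {w : Y → ℂ}
    (hw : Measurable w) {M : ℝ} (hM : ∀ y, ‖w y‖ ≤ M) (v : B) :
    pairing hι hw hM v = ∫ y, ι v y * w y ∂μ := rfl

/-- The operators preserving the cone of nonnegative elements. -/
def positiveOperators (ι : B →ₗ[ℂ] Lp ℂ ⊤ μ) : Subsemiring (B →L[ℂ] B) where
  carrier := {X | ∀ v, AENonneg ι v → AENonneg ι (X v)}
  mul_mem' := fun {a b} ha hb v hv => ha _ (hb v hv)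
  one_mem' := fun v hv => hv
  add_mem' := fun {a b} ha hb v hv => by
    filter_upwards [ha v hv, hb v hv, ae_embedding_add (ι := ι) (a v) (b v)] with y h1 h2 h3
    rw [add_apply, h3, Complex.add_re, Complex.add_im, h1.2, h2.2]
    exact ⟨add_nonneg h1.1 h2.1, add_zero 0⟩
  zero_mem' := fun v _ => by
    filter_upwards [ae_embedding_zero (ι := ι)] with y hy
    rw [zero_apply, hy]
    simp

lemma smul_mem_positiveOperators (c : ℝ) (X : B →L[ℂ] B) (hc : 0 ≤ c)
    (hX : X ∈ positiveOperators ι) : (c : ℂ) • X ∈ positiveOperators ι := fun v hv => by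
  filter_upwards [hX v hv, ae_embedding_smul (ι := ι) (c : ℂ) (X v)] with y h1 h2
  rw [smul_apply, h2, Complex.re_ofReal_mul, Complex.im_ofReal_mul, h1.2]
  exact ⟨mul_nonneg hc h1.1, mul_zero _⟩

end Embedding

namespace RenewalOperators

variable {Y : Type*} [MeasurableSpace Y] {μ : Measure Y} {F : Y → Y}
  {φ : Y → ℕ} {B : Type*} [NormedAddCommGroup B] [NormedSpace ℂ B]
  {ι : B →ₗ[ℂ] Lp ℂ ⊤ μ} {Rn : ℕ → B →L[ℂ] B} {C : ℝ}

lemma measurableSet_eq (h : RenewalOperators μ F φ ι Rn C) (n : ℕ) :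
    MeasurableSet {y | φ y = n} := h.measurable (measurableSet_singleton n)

lemma measurable_pow (h : RenewalOperators μ F φ ι Rn C) (z : ℂ) : Measurable fun y => z ^ φ y :=
  (measurable_from_top (f := fun n : ℕ => z ^ n)).comp h.measurable

lemma hasSum_setIntegral (h : RenewalOperators μ F φ ι Rn C) {E : Type*} [NormedAddCommGroup E]
    [NormedSpace ℝ E] {f : Y → E} (hf : Integrable f μ) :
    HasSum (fun n : ℕ => ∫ y in {y | φ y = n + 1}, f y ∂μ) (∫ y, f y ∂μ) := by
  have hd : Pairwise (Function.onFun Disjoint fun n : ℕ => {y | φ y = n + 1}) := by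
    intro i j hij
    refine Set.disjoint_left.2 fun y (hy : φ y = i + 1) (hy' : φ y = j + 1) => hij ?_
    omega
  have hU : ⋃ n : ℕ, {y | φ y = n + 1} = Set.univ := by
    refine Set.eq_univ_of_forall fun y => Set.mem_iUnion.2 ⟨φ y - 1, ?_⟩
    have := h.one_le y
    simp only [Set.mem_ofPred_eq]
    omega
  have := hasSum_integral_iUnion (f := f) (fun n : ℕ => h.measurableSet_eq (n + 1)) hd
    hf.integrableOn
  rwa [hU, setIntegral_univ] at this

variable [IsProbabilityMeasure μ]

lemma summable_norm (h : RenewalOperators μ F φ ι Rn C) : Summable fun n => ‖Rn (n + 1)‖ := by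
  have h1 := (h.hasSum_setIntegral (integrable_const (1 : ℝ))).summable
  simp only [setIntegral_const, smul_eq_mul, mul_one] at h1
  exact Summable.of_nonneg_of_le (fun _ => norm_nonneg _)
    (fun n => h.norm_op_le (n + 1) (by omega)) (h1.mul_left C)

lemma norm_term_le {z : ℂ} (hz : ‖z‖ ≤ 1) (n : ℕ) :
    ‖z ^ (n + 1) • Rn (n + 1)‖ ≤ ‖Rn (n + 1)‖ := by
  rw [norm_smul, norm_pow]
  exact mul_le_of_le_one_left (norm_nonneg _) (pow_le_one₀ (norm_nonneg _) hz)

lemma summable_norm_term (h : RenewalOperators μ F φ ι Rn C) {z : ℂ} (hz : ‖z‖ ≤ 1) :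
    Summable fun n => ‖z ^ (n + 1) • Rn (n + 1)‖ :=
  Summable.of_nonneg_of_le (fun _ => norm_nonneg _) (norm_term_le hz) h.summable_norm

/-- Duality for `R(z)`. -/
lemma integral_renewalSeries [CompleteSpace B] (h : RenewalOperators μ F φ ι Rn C) {z : ℂ}
    (hz : ‖z‖ ≤ 1)
    (v : B) {w : Y → ℂ} (hw : Measurable w) {M : ℝ} (hM : ∀ y, ‖w y‖ ≤ M) :
    ∫ y, ι (renewalSeries Rn z v) y * w y ∂μ = ∫ y, z ^ φ y * ι v y * w (F y) ∂μ := by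
  have hs : HasSum (fun n => z ^ (n + 1) • Rn (n + 1)) (renewalSeries Rn z) :=
    (h.summable_norm_term hz).of_norm.hasSum
  have h1 := ((ContinuousLinearMap.apply ℂ B v).hasSum hs).mapL (pairing h.norm_le hw hM)
  have hzφ : ∀ y, ‖z ^ φ y‖ ≤ 1 := fun y => by
    rw [norm_pow]; exact pow_le_one₀ (norm_nonneg _) hz
  have hint : Integrable (fun y => z ^ φ y * ι v y * w (F y)) μ :=
    ((integrable_embedding v).bdd_mul (h.measurable_pow z).aestronglyMeasurable
      (Eventually.of_forall hzφ)).mul_bdd (hw.comp h.preserving.measurable).aestronglyMeasurable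
      (Eventually.of_forall fun y => hM (F y))
  have h2 := h.hasSum_setIntegral hint
  have h3 : ∀ n : ℕ, pairing h.norm_le hw hM ((ContinuousLinearMap.apply ℂ B v)
      (z ^ (n + 1) • Rn (n + 1))) = ∫ y in {y | φ y = n + 1}, z ^ φ y * ι v y * w (F y) ∂μ := by
    intro n
    have ht := (h.transfer (n + 1) (by omega) v).2 w hw ⟨M, hM⟩
    rw [map_smul, map_smul, ContinuousLinearMap.apply_apply, pairing_apply, ht, smul_eq_mul,
      ← integral_const_mul, ← integral_indicator (h.measurableSet_eq (n + 1))]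
    congr 1 with y
    by_cases hy : φ y = n + 1
    · rw [Set.indicator_of_mem (show y ∈ {y | φ y = n + 1} from hy),
        Set.indicator_of_mem (show y ∈ {y | φ y = n + 1} from hy), hy, mul_assoc]
    · rw [Set.indicator_of_notMem (show y ∉ {y | φ y = n + 1} from hy),
        Set.indicator_of_notMem (show y ∉ {y | φ y = n + 1} from hy), zero_mul, mul_zero]
  refine h1.unique ?_
  simp only [h3]
  exact h2

end RenewalOperators

/-- The renewal operators are determined by the recursion for the coefficients of
`(1 - R(z))⁻¹`. -/
lemma eq_renewalOp_of_forall_eq {B : Type*} [NormedAddCommGroup B] [NormedSpace ℂ B]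
    {Rn : ℕ → B →L[ℂ] B} {a : ℕ → B →L[ℂ] B}
    (ha : ∀ n, a n = (if n = 0 then 1 else 0) + (1 : ℂ) •
      ∑ q ∈ Finset.HasAntidiagonal.antidiagonal n, a q.1 * (if q.2 = 0 then 0 else Rn q.2)) (n : ℕ) :
    a n = renewalOp Rn n := by
  induction n using Nat.strong_induction_on with
  | _ n ih =>
    rw [ha n, one_smul]
    cases n with
    | zero => simp [renewalOp]; rfl
    | succ n =>
      rw [Finset.Nat.sum_antidiagonal_succ', renewalOp]
      simp only [Nat.add_eq_zero_iff, one_ne_zero, and_false, if_false, if_true, mul_zero, zero_add]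
      rw [← Finset.Nat.sum_antidiagonal_swap, Finset.Nat.sum_antidiagonal_eq_sum_range_succ_mk,
        Finset.sum_range]
      refine Finset.sum_congr rfl fun j _ => ?_
      simp only [Prod.fst_swap, Prod.snd_swap]
      rw [ih (n - j) (by omega)]
      rfl

namespace RenewalOperators

variable {Y : Type*} [MeasurableSpace Y] {μ : Measure Y} [IsProbabilityMeasure μ] {F : Y → Y}
  {φ : Y → ℕ} {B : Type*} [NormedAddCommGroup B] [NormedSpace ℂ B]
  {ι : B →ₗ[ℂ] Lp ℂ ⊤ μ} {Rn : ℕ → B →L[ℂ] B} {C : ℝ}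

/-- Each `Rₙ` is a positive operator. -/
lemma mem_positiveOperators (h : RenewalOperators μ F φ ι Rn C) {n : ℕ} (hn : 1 ≤ n) :
    Rn n ∈ positiveOperators ι := by
  intro v hv
  have hg : Integrable (ι (Rn n v)) μ := integrable_embedding _
  have key : ∀ s : Set Y, MeasurableSet s → ∃ c : ℝ, 0 ≤ c ∧ ∫ y in s, ι (Rn n v) y ∂μ = c := by
    intro s hs
    have ht := (h.transfer n hn v).2 (s.indicator 1) (measurable_one.indicator hs)
      ⟨1, fun y => by
        by_cases hy : y ∈ s
        · simp [hy]
        · simp [hy]⟩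
    set q : Y → ℝ := fun y =>
      (Set.indicator {y | φ y = n} (ι v) y * s.indicator (1 : Y → ℂ) (F y)).re with hq
    have h1 : ∀ᵐ y ∂μ, 0 ≤ q y ∧
        Set.indicator {y | φ y = n} (ι v) y * s.indicator (1 : Y → ℂ) (F y) = (q y : ℂ) := by
      filter_upwards [hv] with y hy
      have hvy : ι v y = ((ι v y).re : ℂ) := Complex.ext (by simp) (by simp [hy.2])
      by_cases h2 : y ∈ {y | φ y = n} <;> by_cases h3 : F y ∈ s
      · simp only [hq, Set.indicator_of_mem h2, Set.indicator_of_mem h3, Pi.one_apply, mul_one]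
        exact ⟨hy.1, hvy⟩
      all_goals simp [hq, h2, h3]
    refine ⟨∫ y, q y ∂μ, integral_nonneg_of_ae (h1.mono fun y hy => hy.1), ?_⟩
    rw [← integral_complex_ofReal, ← integral_congr_ae (h1.mono fun y hy => hy.2), ← ht,
      ← integral_indicator hs]
    congr 1 with y
    by_cases hy : y ∈ s <;> simp [hy]
  have hre : 0 ≤ᵐ[μ] fun y => (ι (Rn n v) y).re := by
    refine ae_nonneg_of_forall_setIntegral_nonneg hg.re fun s hs _ => ?_
    obtain ⟨c, hc, hc'⟩ := key s hs
    have := Complex.reCLM.integral_comp_comm (hg.integrableOn (s := s))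
    simp only [Complex.reCLM_apply] at this
    change 0 ≤ ∫ y in s, (ι (Rn n v) y).re ∂μ
    rw [this, hc', Complex.ofReal_re]
    exact hc
  have him : (fun y => (ι (Rn n v) y).im) =ᵐ[μ] 0 := by
    refine Integrable.ae_eq_zero_of_forall_setIntegral_eq_zero hg.im fun s hs _ => ?_
    obtain ⟨c, hc, hc'⟩ := key s hs
    have := Complex.imCLM.integral_comp_comm (hg.integrableOn (s := s))
    simp only [Complex.imCLM_apply] at this
    change ∫ y in s, (ι (Rn n v) y).im ∂μ = 0
    rw [this, hc', Complex.ofReal_im]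
  filter_upwards [hre, him] with y h1 h2
  exact ⟨h1, h2⟩

/-- Integration with respect to `μ`, as a functional on `B`. -/
noncomputable def mean (h : RenewalOperators μ F φ ι Rn C) : B →L[ℂ] ℂ :=
  pairing h.norm_le (w := 1) measurable_one (M := 1) (fun _ => by simp)

lemma mean_apply (h : RenewalOperators μ F φ ι Rn C) (v : B) : h.mean v = ∫ y, ι v y ∂μ := by
  rw [mean, pairing_apply]
  simp

lemma renewalOp_mem_positiveOperators (h : RenewalOperators μ F φ ι Rn C) (n : ℕ) :
    renewalOp Rn n ∈ positiveOperators ι := by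
  induction n using Nat.strong_induction_on with
  | _ n ih =>
    cases n with
    | zero => rw [renewalOp]; exact (positiveOperators ι).one_mem
    | succ n =>
      rw [renewalOp]
      exact sum_mem fun j _ => (positiveOperators ι).mul_mem (ih _ (by omega))
        (h.mem_positiveOperators (by omega))

variable [CompleteSpace B]

lemma mean_sub_mean_renewalSeries (h : RenewalOperators μ F φ ι Rn C) {z : ℂ} (hz : ‖z‖ ≤ 1)
    (v : B) : h.mean v - h.mean (renewalSeries Rn z v) = ∫ y, (1 - z ^ φ y) * ι v y ∂μ := by
  have h1 := h.integral_renewalSeries hz v (w := 1) measurable_one (M := 1) (fun _ => by simp)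
  simp only [Pi.one_apply, mul_one] at h1
  have h2 : Integrable (fun y => z ^ φ y * ι v y) μ :=
    (integrable_embedding v).bdd_mul (c := 1) (h.measurable_pow z).aestronglyMeasurable
      (Eventually.of_forall fun y => by
        rw [norm_pow]; exact pow_le_one₀ (norm_nonneg _) hz)
  rw [mean_apply, mean_apply, h1, ← integral_sub (integrable_embedding v) h2]
  simp only [sub_mul, one_mul]

lemma continuousOn_renewalSeries (h : RenewalOperators μ F φ ι Rn C) :
    ContinuousOn (renewalSeries Rn) (Metric.closedBall 0 1) :=
  continuousOn_tsum (fun n => by fun_prop) h.summable_norm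
    fun n z hz => norm_term_le (mem_closedBall_zero_iff.1 hz) n

lemma differentiableOn_renewalSeries (h : RenewalOperators μ F φ ι Rn C) :
    DifferentiableOn ℂ (renewalSeries Rn) (Metric.ball 0 1) :=
  Complex.differentiableOn_tsum_of_summable_norm h.summable_norm (fun n => by fun_prop)
    Metric.isOpen_ball fun n z hz => norm_term_le (mem_ball_zero_iff.1 hz).le n

lemma hasCoeffs_renewalSeries (h : RenewalOperators μ F φ ι Rn C) :
    HasCoeffs (renewalSeries Rn) (fun n => if n = 0 then 0 else Rn n) := by
  intro z hz
  have h1 := h.summable_norm_term hz.le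
  refine ⟨(summable_nat_add_iff 1).1 (by simpa using h1), ?_⟩
  have h2 : HasSum (fun n => z ^ (n + 1) • Rn (n + 1)) (renewalSeries Rn z) := h1.of_norm.hasSum
  refine (hasSum_nat_add_iff' 1).1 ?_
  simpa using h2

/-- The constant function `1` is invariant. -/
lemma renewalSeries_one_apply (h : RenewalOperators μ F φ ι Rn C) {e : B}
    (he : ∀ᵐ y ∂μ, ι e y = 1) : renewalSeries Rn 1 e = e := by
  refine h.injective (Lp.ext ?_)
  refine Integrable.ae_eq_of_forall_setIntegral_eq _ _ (integrable_embedding _)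
    (integrable_embedding _) fun s hs _ => ?_
  have hb : ∀ y, ‖s.indicator (1 : Y → ℂ) y‖ ≤ 1 := fun y => by
    by_cases hy : y ∈ s <;> simp [hy]
  have h1 := h.integral_renewalSeries (z := 1) (by simp) e (w := s.indicator 1)
    (measurable_one.indicator hs) hb
  have h2 : ∀ x : B, ∫ y in s, ι x y ∂μ = ∫ y, ι x y * s.indicator 1 y ∂μ := by
    intro x
    rw [← integral_indicator hs]
    congr 1 with y
    by_cases hy : y ∈ s <;> simp [hy]
  rw [h2, h2, h1]
  calc ∫ y, 1 ^ φ y * ι e y * s.indicator 1 (F y) ∂μ = ∫ y, s.indicator (1 : Y → ℂ) (F y) ∂μ := by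
        refine integral_congr_ae (he.mono fun y hy => ?_)
        simp only [hy, one_pow, one_mul]
    _ = ∫ y, s.indicator (1 : Y → ℂ) y ∂μ := by
        have hm : AEStronglyMeasurable (s.indicator (1 : Y → ℂ)) (μ.map F) :=
          (measurable_one.indicator hs).aestronglyMeasurable
        rw [← integral_map h.preserving.measurable.aemeasurable hm, h.preserving.map_eq]
    _ = ∫ y, ι e y * s.indicator 1 y ∂μ := by
        refine integral_congr_ae (he.mono fun y hy => ?_)
        simp only [hy, one_mul]

lemma renewalResolvent (h : RenewalOperators μ F φ ι Rn C) {e : B} (he : ∀ᵐ y ∂μ, ι e y = 1)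
    (h1 : IsSimpleIsolatedEigenvalue (renewalSeries Rn 1) 1)
    (h2 : ∀ z : ℂ, ‖z‖ ≤ 1 → z ≠ 1 → (1 : ℂ) ∉ spectrum ℂ (renewalSeries Rn z)) :
    RenewalResolvent μ φ h.mean e (renewalSeries Rn) := by
  have hme : h.mean e = 1 := by
    rw [mean_apply, integral_congr_ae he]
    simp
  have hm1 : ∀ v, h.mean (renewalSeries Rn 1 v) = h.mean v := fun v => by
    have := h.mean_sub_mean_renewalSeries (z := 1) (by simp) v
    simp only [one_pow, sub_self, zero_mul, integral_zero] at this
    exact (sub_eq_zero.1 this).symm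
  have hRe := h.renewalSeries_one_apply he
  refine ⟨hme, hRe, hm1, fun z hz => ?_, fun z hz v => ?_, h.continuousOn_renewalSeries, ?_,
    fun z hz hz1 => ?_⟩
  · rw [h.mean_sub_mean_renewalSeries hz]
    refine integral_congr_ae (he.mono fun y hy => ?_)
    simp only [hy, mul_one]
  · rw [h.mean_sub_mean_renewalSeries hz, ← integral_const_mul]
    refine norm_integral_le_of_norm_le ?_ ?_
    · refine Integrable.const_mul (Integrable.norm ?_) _
      exact (integrable_const (1 : ℂ)).sub (Integrable.of_bound
        (h.measurable_pow z).aestronglyMeasurable 1 (Eventually.of_forall fun y => by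
          rw [norm_pow]; exact pow_le_one₀ (norm_nonneg _) hz))
    · filter_upwards [ae_norm_embedding_le h.norm_le v] with y hy
      rw [norm_mul, mul_comm]
      exact mul_le_mul_of_nonneg_right hy (norm_nonneg _)
  · obtain ⟨-, hdim, hc⟩ := h1
    set A : B →ₗ[ℂ] B := ((renewalSeries Rn 1 : B →L[ℂ] B) : B →ₗ[ℂ] B) - (1 : ℂ) • LinearMap.id
      with hA
    have hAv : ∀ x, A x = renewalSeries Rn 1 x - x := fun x => by simp [hA]
    have he0 : e ≠ 0 := by rintro rfl; simp at hme
    have heA : e ∈ LinearMap.ker A := by rw [LinearMap.mem_ker, hAv, hRe, sub_self]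
    have hspan : ∀ x ∈ LinearMap.ker A, ∃ c : ℂ, x = c • e := by
      intro x hx
      obtain ⟨c, hc⟩ := (finrank_eq_one_iff_of_nonzero' (⟨e, heA⟩ : LinearMap.ker A)
        (fun h0 => he0 (congrArg Subtype.val h0))).1 hdim ⟨x, hx⟩
      exact ⟨c, (congrArg Subtype.val hc).symm⟩
    have happ : ∀ x, (1 - renewalSeries Rn 1 + h.mean.smulRight e) x
        = x - renewalSeries Rn 1 x + h.mean x • e := fun x => by
      rw [add_apply, sub_apply, ContinuousLinearMap.smulRight_apply]; rfl
    rw [ContinuousLinearMap.isUnit_iff_bijective]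
    constructor
    · rw [injective_iff_map_eq_zero]
      intro x hx
      rw [happ] at hx
      have h3 := congrArg h.mean hx
      simp only [map_add, map_sub, map_smul, hm1, hme, map_zero, smul_eq_mul, mul_one, sub_self,
        zero_add] at h3
      rw [h3, zero_smul, add_zero] at hx
      obtain ⟨c, rfl⟩ := hspan x (by
        rw [LinearMap.mem_ker, hAv, ← neg_sub, hx, neg_zero])
      rw [map_smul, hme, smul_eq_mul, mul_one] at h3
      rw [h3, zero_smul]
    · intro w
      obtain ⟨k, hk, r, ⟨x, rfl⟩, rfl⟩ := Submodule.mem_sup.1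
        (show w ∈ LinearMap.ker A ⊔ LinearMap.range A by rw [hc.sup_eq_top]; trivial)
      obtain ⟨c, rfl⟩ := hspan k hk
      refine ⟨-x + (c + h.mean x) • e, ?_⟩
      rw [happ]
      simp only [map_add, map_neg, map_smul, hRe, hme, hAv, smul_eq_mul, mul_one]
      module
  · have := spectrum.notMem_iff.1 (h2 z hz hz1)
    simpa using this

lemma hasCoeffs_renewalOp (h : RenewalOperators μ F φ ι Rn C)
    (hu : ∀ z : ℂ, ‖z‖ < 1 → IsUnit (1 - renewalSeries Rn z)) :
    HasCoeffs (fun z => Ring.inverse (1 - renewalSeries Rn z)) (renewalOp Rn) := by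
  obtain ⟨a, ha, ha'⟩ := exists_hasCoeffs_inverse h.hasCoeffs_renewalSeries
    h.differentiableOn_renewalSeries (s := 1) (by simpa using hu)
  rw [← funext (eq_renewalOp_of_forall_eq ha')]
  simpa using ha

end RenewalOperators

namespace RenewalOperators

variable {Y : Type*} [MeasurableSpace Y] {μ : Measure Y} [IsProbabilityMeasure μ] {F : Y → Y}
  {φ : Y → ℕ} {B : Type*} [NormedAddCommGroup B] [NormedSpace ℂ B]
  {ι : B →ₗ[ℂ] Lp ℂ ⊤ μ} {Rn : ℕ → B →L[ℂ] B} {C : ℝ}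

lemma mean_eq_ofReal (h : RenewalOperators μ F φ ι Rn C) {v : B} (hv : AENonneg ι v) :
    h.mean v = ((∫ y, (ι v y).re ∂μ : ℝ) : ℂ) := by
  rw [mean_apply, ← integral_complex_ofReal]
  refine integral_congr_ae (hv.mono fun y hy => ?_)
  exact Complex.ext (by simp) (by simp [hy.2])

lemma ae_tendsto_apply (h : RenewalOperators μ F φ ι Rn C) {e : B} (he : ∀ᵐ y ∂μ, ι e y = 1)
    {v : B} {X : ℕ → B →L[ℂ] B} {r : ℕ → ℝ} {c : ℂ}
    (hX : Tendsto (fun n => ((r n : ℝ) : ℂ) • X n) atTop (𝓝 (c • h.mean.smulRight e))) :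
    ∀ᵐ y ∂μ, Tendsto (fun n => r n * (ι (X n v) y).re) atTop (𝓝 (c * h.mean v).re) := by
  have h1 := ((ContinuousLinearMap.apply ℂ B v).continuous.tendsto _).comp hX
  simp only [Function.comp_def, ContinuousLinearMap.apply_apply, smul_apply,
    ContinuousLinearMap.smulRight_apply, smul_smul] at h1
  have h2 : ∀ᵐ y ∂μ, ∀ n, ι (((r n : ℝ) : ℂ) • X n v) y = r n * ι (X n v) y :=
    ae_all_iff.2 fun n => ae_embedding_smul _ _
  filter_upwards [ae_tendsto_embedding h.norm_le h1, h2, he,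
    ae_embedding_smul (ι := ι) (c * h.mean v) e] with y h3 h4 h5 h6
  rw [h6, h5, mul_one] at h3
  simp only [h4] at h3
  have h7 := (Complex.continuous_re.tendsto _).comp h3
  simpa only [Function.comp_def, Complex.re_ofReal_mul] using h7

variable [CompleteSpace B]

/-- The lower bound along the full sequence. -/
lemma ae_eventually_lt (h : RenewalOperators μ F φ ι Rn C) {e : B} (he : ∀ᵐ y ∂μ, ι e y = 1)
    (hr : RenewalResolvent μ φ h.mean e (renewalSeries Rn)) {β : ℝ}
    (hp : RegularTail (tailFun μ φ) β) (hβ0 : 0 < β) (hβ1 : β < 1) {v : B} (hv : AENonneg ι v) :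
    ∀ᵐ y ∂μ, ∀ a : ℝ, a < Real.pi⁻¹ * Real.sin (β * Real.pi) * ∫ x, (ι v x).re ∂μ →
      ∀ᶠ n : ℕ in atTop, a < n * tailFun μ φ n * (ι (renewalOp Rn n v) y).re := by
  obtain ⟨k, hk⟩ : ∃ k : ℕ, 4 ≤ β * (k + 1) := by
    refine ⟨⌈4 / β⌉₊, ?_⟩
    have := Nat.le_ceil (4 / β)
    rw [div_le_iff₀' hβ0] at this
    linarith
  obtain ⟨s₀, M, hs₀, -, hinv⟩ := hr.exists_norm_inverse_le h.measurable hp hβ0 hβ1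
  have hu : ∀ z : ℂ, ‖z‖ < 1 → IsUnit (1 - renewalSeries Rn z) := fun z hz =>
    hr.isUnit z hz.le (by rintro rfl; simp at hz)
  have hT := h.hasCoeffs_renewalOp hu
  have hρ : ∀ n, (if n = 0 then 0 else Rn n) ∈ positiveOperators ι := fun n => by
    split_ifs with hn
    · exact zero_mem _
    · exact h.mem_positiveOperators (Nat.one_le_iff_ne_zero.2 hn)
  set L : ℕ → ℂ := fun κ => ((Real.exp 1 / (2 * Real.pi) : ℝ) : ℂ) *
    ∫ t : ℝ, Complex.exp (-Complex.I * t) * dampedKernel β κ k (1 - Complex.I * t) with hL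
  have hκ : ∀ κ : ℕ, ∀ᵐ y ∂μ, ∀ a : ℝ, a < (L κ * h.mean v).re →
      ∀ᶠ n : ℕ in atTop, a < n * tailFun μ φ n * (ι (renewalOp Rn n v) y).re := by
    intro κ
    have hs : Tendsto (fun n : ℕ => 1 - (κ : ℝ) * tailFun μ φ n) atTop (𝓝 1) := by
      simpa using ((hp.tendsto_zero hβ0).const_mul (κ : ℝ)).const_sub 1
    have hex : ∀ᶠ n : ℕ in atTop, ∃ g : ℕ → B →L[ℂ] B,
        HasCoeffs (fun z => Ring.inverse (1 - renewalSeries Rn z) *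
          (((1 - (1 - κ * tailFun μ φ n) : ℝ) : ℂ) • Ring.inverse
            (1 - ((1 - κ * tailFun μ φ n : ℝ) : ℂ) • renewalSeries Rn z)) ^ k) g ∧
          ∀ j, renewalOp Rn j - g j ∈ positiveOperators ι := by
      filter_upwards [hs.eventually (lt_mem_nhds hs₀), hs.eventually (lt_mem_nhds zero_lt_one)]
        with n hn hn0
      have hs1 : 1 - (κ : ℝ) * tailFun μ φ n ≤ 1 :=
        sub_le_self _ (mul_nonneg (Nat.cast_nonneg _) measureReal_nonneg)
      exact exists_hasCoeffs_damped (fun c x hc hx => smul_mem_positiveOperators c x hc hx)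
        h.hasCoeffs_renewalSeries (by simp) hρ h.differentiableOn_renewalSeries hn0.le hs1
        (hinv _ hn.le hs1).1 hu hT k
    obtain ⟨g, hg⟩ := hex.choice
    have hlim := hr.tendsto_coeff_damped h.measurable hp hβ0 hβ1 h.differentiableOn_renewalSeries
      (Nat.cast_nonneg κ) hk (hg.mono fun n hn => hn.1)
    have hlim' := h.ae_tendsto_apply he (v := v) hlim
    have hle : ∀ᵐ y ∂μ, ∀ n, (∀ j, renewalOp Rn j - g n j ∈ positiveOperators ι) →
        (ι (g n n v) y).re ≤ (ι (renewalOp Rn n v) y).re := by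
      refine ae_all_iff.2 fun n => ?_
      by_cases hn : ∀ j, renewalOp Rn j - g n j ∈ positiveOperators ι
      · filter_upwards [hn n v hv, ae_embedding_sub (ι := ι) (renewalOp Rn n v) (g n n v)]
          with y h1 h2 _
        rw [sub_apply, h2, Complex.sub_re] at h1
        exact sub_nonneg.1 h1.1
      · exact Eventually.of_forall fun y hy => absurd hy hn
    filter_upwards [hlim', hle] with y h1 h2 a ha
    filter_upwards [h1.eventually (lt_mem_nhds ha), hg] with n hn hgn
    refine hn.trans_le (mul_le_mul_of_nonneg_left (h2 n hgn.2) ?_)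
    exact mul_nonneg (Nat.cast_nonneg _) measureReal_nonneg
  have hLlim : Tendsto (fun κ => (L κ * h.mean v).re) atTop
      (𝓝 (Real.pi⁻¹ * Real.sin (β * Real.pi) * ∫ x, (ι v x).re ∂μ)) := by
    have h1 := (tendsto_integral_dampedKernel hβ0 hβ1 hk).mul_const (h.mean v)
    have h2 := (Complex.continuous_re.tendsto _).comp h1
    rw [h.mean_eq_ofReal hv, ← Complex.ofReal_mul, Complex.ofReal_re] at h2
    rw [h.mean_eq_ofReal hv]
    exact h2
  filter_upwards [ae_all_iff.2 hκ] with y hy a ha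
  obtain ⟨κ, hκa⟩ := (hLlim.eventually (lt_mem_nhds ha)).exists
  exact hy κ a hκa

/-- The Abelian upper bound for eventual lower bounds. -/
lemma ae_mul_gamma_le (h : RenewalOperators μ F φ ι Rn C) {e : B} (he : ∀ᵐ y ∂μ, ι e y = 1)
    (hr : RenewalResolvent μ φ h.mean e (renewalSeries Rn)) {β : ℝ}
    (hp : RegularTail (tailFun μ φ) β) (hβ0 : 0 < β) (hβ1 : β < 1) {v : B} (hv : AENonneg ι v) :
    ∀ᵐ y ∂μ, ∀ a : ℝ, 0 ≤ a →
      (∀ᶠ n : ℕ in atTop, a ≤ n * tailFun μ φ n * (ι (renewalOp Rn n v) y).re) →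
      a * Real.Gamma β ≤ (Real.Gamma (1 - β))⁻¹ * ∫ x, (ι v x).re ∂μ := by
  have hu : ∀ z : ℂ, ‖z‖ < 1 → IsUnit (1 - renewalSeries Rn z) := fun z hz =>
    hr.isUnit z hz.le (by rintro rfl; simp at hz)
  have hT := h.hasCoeffs_renewalOp hu
  set z : ℕ → ℂ := fun n => Complex.exp (-(1 / n)) with hz
  set X : ℕ → B →L[ℂ] B := fun n => Ring.inverse (1 - renewalSeries Rn (z n)) with hX
  have hzpow : ∀ n k : ℕ, z n ^ k = ((Real.exp (-(k / n)) : ℝ) : ℂ) := fun n k => by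
    rw [hz, ← Complex.exp_nat_mul]
    push_cast
    congr 1
    ring
  have hz1 : ∀ n : ℕ, 1 ≤ n → ‖z n‖ < 1 := fun n hn => by
    have h1 := hzpow n 1
    rw [pow_one, Nat.cast_one] at h1
    rw [h1, Complex.norm_real, Real.norm_eq_abs, Real.abs_exp, Real.exp_lt_one_iff, neg_lt_zero]
    positivity
  have hlim : ∀ᵐ y ∂μ, Tendsto (fun n : ℕ => tailFun μ φ n * (ι (X n v) y).re) atTop
      (𝓝 ((Real.Gamma (1 - β))⁻¹ * ∫ x, (ι v x).re ∂μ)) := by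
    have h1 := hr.tendsto_smul_inverse h.measurable hp hβ0 hβ1 (u := 1) (by simp) (κ := 0) le_rfl
    simp only [zero_mul, sub_zero, Complex.ofReal_one, one_smul, Complex.ofReal_zero, zero_add,
      Complex.one_cpow, mul_one] at h1
    have h2 := h.ae_tendsto_apply he (v := v) h1
    rw [h.mean_eq_ofReal hv, ← Complex.ofReal_inv, ← Complex.ofReal_mul, Complex.ofReal_re] at h2
    exact h2
  have hsum : ∀ᵐ y ∂μ, ∀ n : ℕ, 1 ≤ n → Tendsto
      (fun K => ∑ k ∈ Finset.range K, Real.exp (-(k / n)) * (ι (renewalOp Rn k v) y).re) atTop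
      (𝓝 (ι (X n v) y).re) := by
    refine ae_all_iff.2 fun n => ?_
    by_cases hn : 1 ≤ n
    · have h1 := ((ContinuousLinearMap.apply ℂ B v).hasSum (hT (z n) (hz1 n hn)).2).tendsto_sum_nat
      simp only [ContinuousLinearMap.apply_apply, smul_apply] at h1
      filter_upwards [ae_tendsto_embedding h.norm_le h1, ae_all_iff.2
        (ae_embedding_sum (ι := ι) (fun k => z n ^ k) (fun k => renewalOp Rn k v))] with y h2 h3 _
      have h4 := (Complex.continuous_re.tendsto _).comp h2
      simp only [Function.comp_def, h3, Complex.re_sum] at h4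
      simpa only [hzpow, Complex.re_ofReal_mul] using h4
    · exact Eventually.of_forall fun y hy => absurd hy hn
  have hpos : ∀ᵐ y ∂μ, ∀ n, 0 ≤ (ι (renewalOp Rn n v) y).re :=
    ae_all_iff.2 fun n => (h.renewalOp_mem_positiveOperators n v hv).mono fun y hy => hy.1
  filter_upwards [hlim, hsum, hpos] with y h1 h2 h3 a ha hev
  refine hp.mul_gamma_le_of_abel_sum_le hβ0 ha h3 hev h1 ?_
  filter_upwards [eventually_ge_atTop 1] with n hn K
  refine mul_le_mul_of_nonneg_left (Monotone.ge_of_tendsto ?_ (h2 n hn) K) measureReal_nonneg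
  refine monotone_nat_of_le_succ fun K => ?_
  rw [Finset.sum_range_succ]
  exact le_add_of_nonneg_right (mul_nonneg (Real.exp_nonneg _) (h3 K))

end RenewalOperators

theorem operator_renewal_liminf
    {Y : Type*} [MeasurableSpace Y] (μ : Measure Y) [IsProbabilityMeasure μ]
    (F : Y → Y) (hF : MeasurePreserving F μ μ)
    (φ : Y → ℕ) (hφmeas : Measurable φ) (hφpos : ∀ y, 1 ≤ φ y)
    (l : ℝ → ℝ) (hl : SlowlyVarying l) (β : ℝ) (hβ1 : 0 < β) (hβ2 : β ≤ 1 / 2)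
    (htail : ∀ n : ℕ, 1 ≤ n → μ.real {y | n < φ y} = l n * (n : ℝ) ^ (-β))
    -- the Banach space `B`, a linear subspace of `L^∞(μ)` via `ι`, with its own norm
    {B : Type*} [NormedAddCommGroup B] [NormedSpace ℂ B] [CompleteSpace B]
    (ι : B →ₗ[ℂ] Lp ℂ ⊤ μ) (hι_inj : Function.Injective ι)
    (hι_norm : ∀ v : B, ‖ι v‖ ≤ ‖v‖)
    (hι_const : ∀ c : ℂ, ∃ v : B, ∀ᵐ y ∂μ, ι v y = c)
    -- (H1): the operators `v ↦ R (1_{φ = n} v)` restrict to bounded operators on `B`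
    (Rn : ℕ → B →L[ℂ] B)
    (hRn : ∀ n : ℕ, 1 ≤ n → ∀ v : B,
      IsTransferOf μ F (Set.indicator {y | φ y = n} (ι v)) (ι (Rn n v)))
    (C : ℝ) (hC : 0 < C)
    (hH1 : ∀ n : ℕ, 1 ≤ n → ‖Rn n‖ ≤ C * μ.real {y | φ y = n})
    -- (H2)
    (hH2i : IsSimpleIsolatedEigenvalue (renewalSeries Rn 1) 1)
    (hH2ii : ∀ z : ℂ, ‖z‖ ≤ 1 → z ≠ 1 → (1 : ℂ) ∉ spectrum ℂ (renewalSeries Rn z))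
    (v : B) (hv : ∀ᵐ y ∂μ, 0 ≤ (ι v y).re ∧ (ι v y).im = 0) :
    ∀ᵐ y ∂μ,
      (∀ n : ℕ, (ι (renewalOp Rn n v) y).im = 0) ∧
      liminf (fun n : ℕ =>
          ((l n * (n : ℝ) ^ (1 - β) * (ι (renewalOp Rn n v) y).re : ℝ) : EReal)) atTop
        = ((Real.pi⁻¹ * Real.sin (β * Real.pi) * ∫ x, (ι v x).re ∂μ : ℝ) : EReal) := by

  have h : RenewalOperators μ F φ ι Rn C := ⟨hF, hφmeas, hφpos, hι_inj, hι_norm, hRn, hH1⟩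
  have hβ : β < 1 := by linarith
  have hp : RegularTail (tailFun μ φ) β := regularTail_tailFun hl htail
  obtain ⟨e, he⟩ := hι_const 1
  have hr := h.renewalResolvent he hH2i hH2ii
  have hpos : ∀ᵐ y ∂μ, ∀ n, 0 ≤ (ι (renewalOp Rn n v) y).re ∧ (ι (renewalOp Rn n v) y).im = 0 :=
    ae_all_iff.2 fun n => h.renewalOp_mem_positiveOperators n v hv
  filter_upwards [hpos, h.ae_eventually_lt he hr hp hβ1 hβ hv,
    h.ae_mul_gamma_le he hr hp hβ1 hβ hv] with y h1 h2 h3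
  refine ⟨fun n => (h1 n).2, ?_⟩
  have hscale : ∀ᶠ n : ℕ in atTop, l n * (n : ℝ) ^ (1 - β) = n * tailFun μ φ n := by
    filter_upwards [eventually_ge_atTop 1] with n hn
    have hn' : (0 : ℝ) < n := by exact_mod_cast hn
    rw [tailFun_natCast, htail n hn, sub_eq_add_neg, Real.rpow_add hn', Real.rpow_one]
    ring
  rw [liminf_congr (hscale.mono fun n hn => by rw [hn])]
  have hI : 0 ≤ ∫ x, (ι v x).re ∂μ := integral_nonneg_of_ae (hv.mono fun y hy => hy.1)
  have hsin : 0 < Real.sin (β * Real.pi) := Real.sin_pos_of_pos_of_lt_pi (by positivity)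
    (by nlinarith [Real.pi_pos])
  refine le_antisymm ?_ ?_
  · by_contra! hlt
    obtain ⟨a, ha, hal⟩ := EReal.lt_iff_exists_real_btwn.1 hlt
    rw [EReal.coe_lt_coe_iff] at ha
    have ha0 : 0 ≤ a := le_trans (by positivity) ha.le
    have hev : ∀ᶠ n : ℕ in atTop, a ≤ n * tailFun μ φ n * (ι (renewalOp Rn n v) y).re :=
      (eventually_lt_of_lt_liminf hal).mono fun n hn => (EReal.coe_lt_coe_iff.1 hn).le
    have hG := Real.Gamma_mul_Gamma_one_sub β
    have hG1 : 0 < Real.Gamma (1 - β) := Real.Gamma_pos_of_pos (by linarith)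
    have h4 := h3 a ha0 hev
    rw [inv_mul_eq_div, le_div_iff₀ hG1, mul_assoc, hG, mul_comm Real.pi β, ← mul_div_assoc,
      div_le_iff₀ hsin] at h4
    refine absurd ha (not_lt.2 ?_)
    rw [mul_assoc, inv_mul_eq_div, le_div_iff₀ Real.pi_pos]
    linarith
  · refine EReal.ge_of_forall_gt_iff_ge.1 fun a ha => ?_
    refine le_liminf_of_le (by isBoundedDefault) ?_
    filter_upwards [h2 a (EReal.coe_lt_coe_iff.1 ha)] with n hn
    exact (EReal.coe_lt_coe_iff.2 hn).le
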